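/- arXiv:1504.06795 — 5 statements merged into one kernel-verified Lean document; each statement's English description precedes it below -/
import Mathlib

section
/- Let g ≥ 1, let δ₁,…,δ_g ≥ 0 be nonnegative reals, let t ≥ 0, let D_t be the g×g diagonal matrix with entries e^{tδ₁},…,e^{tδ_g}, and let R_t ∈ Sp(2g,ℝ) be the block-diagonal symplectic matrix (D_t⁻¹ 0; 0 D_t). Then for every β ∈ Sp(2g,ℝ): det Im((R_t β)⁻¹(i·I)) ≤ (det D_t)² · det Im(β⁻¹(i·I)), where i·I denotes the point iI_g of the Siegel upper half-space and γ(Z) denotes the Möbius action of a symplectic matrix γ on Z. -/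
open Matrix

/-- The standard symplectic form matrix `J = (0 I; -I 0)` in `g × g` block form. -/
def Jmat (g : ℕ) : Matrix (Fin g ⊕ Fin g) (Fin g ⊕ Fin g) ℝ :=
  Matrix.fromBlocks 0 1 (-1) 0

/-- The Möbius action of a real `2g × 2g` matrix (written in `g × g` blocks
`(A B; C D)`) on a complex `g × g` matrix: `Z ↦ (AZ + B)(CZ + D)⁻¹`. -/
noncomputable def moebius {g : ℕ} (γ : Matrix (Fin g ⊕ Fin g) (Fin g ⊕ Fin g) ℝ)
    (Z : Matrix (Fin g) (Fin g) ℂ) : Matrix (Fin g) (Fin g) ℂ :=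
  (γ.toBlocks₁₁.map Complex.ofReal * Z + γ.toBlocks₁₂.map Complex.ofReal) *
    (γ.toBlocks₂₁.map Complex.ofReal * Z + γ.toBlocks₂₂.map Complex.ofReal)⁻¹

/-- The diagonal symplectic matrix `R_t = (D_t⁻¹ 0; 0 D_t)` with
`D_t = diag (e^{tδ₁}, …, e^{tδ_g})`. -/
noncomputable def Rmat (g : ℕ) (δ : Fin g → ℝ) (t : ℝ) :
    Matrix (Fin g ⊕ Fin g) (Fin g ⊕ Fin g) ℝ :=
  Matrix.fromBlocks (Matrix.diagonal fun i => Real.exp (-(t * δ i))) 0 0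
    (Matrix.diagonal fun i => Real.exp (t * δ i))

open scoped ComplexOrder

/-- The determinant of `1 + P` with `P` positive semidefinite is at least one. -/
theorem Matrix.PosSemidef.one_le_det_one_add {n : Type*} [Fintype n] [DecidableEq n]
    {P : Matrix n n ℂ} (hP : P.PosSemidef) : 1 ≤ (1 + P).det := by
  have hH : (1 + P).IsHermitian := Matrix.isHermitian_one.add hP.isHermitian
  rw [hH.det_eq_prod_eigenvalues]
  suffices h : (1 : ℝ) ≤ ∏ i, hH.eigenvalues i by
    rw [← RCLike.ofReal_prod]
    exact Complex.ofReal_one ▸ Complex.real_le_real.mpr h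
  refine Finset.one_le_prod fun i _ => ?_
  have h1 := hH.mulVec_eigenvectorBasis i
  set v : n → ℂ := ⇑(hH.eigenvectorBasis i) with hv
  have hvne : v ≠ 0 := fun h => hH.eigenvectorBasis.toBasis.ne_zero i (by
    ext j; simpa [hv] using congrFun h j)
  have hpos : 0 < star v ⬝ᵥ v := Matrix.dotProduct_star_self_pos_iff.mpr hvne
  have hnn := hP.dotProduct_mulVec_nonneg v
  have h2 : P *ᵥ v = ((hH.eigenvalues i - 1 : ℝ) : ℂ) • v := by
    have : (1 + P) *ᵥ v = ((hH.eigenvalues i : ℝ) : ℂ) • v := by simpa using h1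
    rw [Matrix.add_mulVec, Matrix.one_mulVec] at this
    rw [Complex.ofReal_sub, sub_smul, ← this]; simp
  rw [h2, dotProduct_smul, smul_eq_mul] at hnn
  rw [Complex.pos_iff] at hpos
  have hre := (Complex.nonneg_iff.mp hnn).1
  rw [Complex.re_ofReal_mul] at hre
  linarith [nonneg_of_mul_nonneg_left hre hpos.1]

/-- Scaling a matrix with positive semidefinite Hermitian part by a nonnegative diagonal matrix
and adding the identity gives a determinant of modulus at least one. -/
theorem one_le_norm_det_one_add_diagonal_mul {n : Type*} [Fintype n] [DecidableEq n]
    (f : n → ℝ) (hf : ∀ i, 0 ≤ f i) {W : Matrix n n ℂ} (hW : (W + Wᴴ).PosSemidef) :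
    1 ≤ ‖(1 + Matrix.diagonal (fun i => (f i : ℂ)) * W).det‖ := by
  set G : Matrix n n ℂ := Matrix.diagonal fun i => ((Real.sqrt (f i) : ℝ) : ℂ) with hG
  have hGH : Gᴴ = G := by
    rw [hG, Matrix.diagonal_conjTranspose]; congr 1; ext i; simp
  have hGG : Matrix.diagonal (fun i => (f i : ℂ)) = G * G := by
    rw [hG, Matrix.diagonal_mul_diagonal]; congr 1; ext i
    rw [← Complex.ofReal_mul, Real.mul_self_sqrt (hf i)]
  rw [hGG, Matrix.mul_assoc, Matrix.det_one_add_mul_comm]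
  set V := G * W * G with hV
  have hP : (G * (W + Wᴴ) * G + Vᴴ * V).PosSemidef := by
    refine Matrix.PosSemidef.add ?_ (Matrix.posSemidef_conjTranspose_mul_self V)
    simpa [hGH] using hW.conjTranspose_mul_mul_same G
  have hVH : Vᴴ = G * Wᴴ * G := by simp [hV, hGH, Matrix.mul_assoc]
  have key : (1 + V)ᴴ * (1 + V) = 1 + (G * (W + Wᴴ) * G + Vᴴ * V) := by
    rw [Matrix.conjTranspose_add, Matrix.conjTranspose_one, hVH, hV]
    noncomm_ring
  have h := hP.one_le_det_one_add
  rw [← key, Matrix.det_mul, Matrix.det_conjTranspose, RCLike.star_def, Complex.conj_mul'] at h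
  have h' : 1 ≤ ‖(1 + V).det‖ ^ 2 := by exact_mod_cast h
  exact (one_le_sq_iff₀ (norm_nonneg _)).mp h'

/-- Scaling the imaginary part of `A - iC`, with `AᵀC` symmetric, by a diagonal matrix with entries
at least one does not decrease the modulus of the determinant. -/
theorem norm_det_sub_le {n : Type*} [Fintype n] [DecidableEq n]
    (e : n → ℝ) (he : ∀ i, 1 ≤ e i) {A C : Matrix n n ℂ} (hA : Aᴴ = Aᵀ) (hC : Cᴴ = Cᵀ)
    (hAC : Aᵀ * C = Cᵀ * A) :
    ‖(A - Complex.I • C).det‖ ≤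
      ‖(A - Complex.I • (Matrix.diagonal (fun i => (e i : ℂ)) * C)).det‖ := by
  set M := A - Complex.I • C with hM
  by_cases hdet : M.det = 0
  · simp [hdet]
  have hu : IsUnit M.det := isUnit_iff_ne_zero.mpr hdet
  set W := -(Complex.I • (C * M⁻¹)) with hWdef
  have hWM : W * M = -(Complex.I • C) := by
    simp [hWdef, Matrix.mul_assoc, Matrix.nonsing_inv_mul _ hu]
  have hMM : M * M⁻¹ = 1 := Matrix.mul_nonsing_inv _ hu
  have hW : (W + Wᴴ).PosSemidef := by
    have h1 : Mᴴ * (W + Wᴴ) * M = (2 : ℂ) • (Cᴴ * C) := by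
      have h2 : Mᴴ * (W + Wᴴ) * M = Mᴴ * (W * M) + (W * M)ᴴ * M := by
        rw [Matrix.conjTranspose_mul]; noncomm_ring
      rw [h2, hWM, hM]
      simp only [Matrix.conjTranspose_sub, Matrix.conjTranspose_smul, Matrix.conjTranspose_neg,
        hA, hC, Matrix.sub_mul, Matrix.mul_sub, Matrix.mul_smul,
        Matrix.smul_mul, hAC, smul_smul, smul_sub, smul_neg, RCLike.star_def, Complex.conj_I,
        Complex.I_mul_I,
        mul_neg, neg_mul, neg_smul]
      module
    have h3 : W + Wᴴ = (M⁻¹)ᴴ * ((2 : ℂ) • (Cᴴ * C)) * M⁻¹ := by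
      rw [← h1]
      have h4 : (M⁻¹)ᴴ * Mᴴ = 1 := by
        rw [← Matrix.conjTranspose_mul, hMM, Matrix.conjTranspose_one]
      calc W + Wᴴ = ((M⁻¹)ᴴ * Mᴴ) * (W + Wᴴ) * (M * M⁻¹) := by rw [h4, hMM]; simp
        _ = _ := by simp only [Matrix.mul_assoc]
    rw [h3]
    exact ((Matrix.posSemidef_conjTranspose_mul_self C).smul
      (by norm_num)).conjTranspose_mul_mul_same _
  have hfac : A - Complex.I • (Matrix.diagonal (fun i => (e i : ℂ)) * C) =
      (1 + Matrix.diagonal (fun i => ((e i - 1 : ℝ) : ℂ)) * W) * M := by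
    have hd : Matrix.diagonal (fun i => ((e i - 1 : ℝ) : ℂ)) =
        Matrix.diagonal (fun i => (e i : ℂ)) - 1 := by
      rw [← Matrix.diagonal_one, Matrix.diagonal_sub]; congr 1; ext i; simp
    rw [Matrix.add_mul, Matrix.mul_assoc, hWM, hd, hM]
    simp only [Matrix.one_mul, Matrix.sub_mul, Matrix.mul_neg, Matrix.mul_smul]
    module
  rw [hfac, Matrix.det_mul, norm_mul]
  exact le_mul_of_one_le_left (norm_nonneg _)
    (one_le_norm_det_one_add_diagonal_mul _ (fun i => by linarith [he i]) hW)

/-- If `KᴴN - NᴴK = 2i` and `KᵀN` is symmetric, then `Im (NK⁻¹)` has determinant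
`|det K|⁻²`. -/
theorem det_im_mul_inv {n : Type*} [Fintype n] [DecidableEq n] {N K : Matrix n n ℂ}
    (h1 : Kᴴ * N - Nᴴ * K = (2 * Complex.I) • (1 : Matrix n n ℂ)) (h2 : Kᵀ * N = Nᵀ * K) :
    K.det ≠ 0 ∧ ((N * K⁻¹).map Complex.im).det = (‖K.det‖ ^ 2)⁻¹ := by
  have hK : K.det ≠ 0 := by
    intro h0
    obtain ⟨v, hv, hKv⟩ := Matrix.exists_mulVec_eq_zero_iff.mpr h0
    have h3 := congrArg (fun X => star v ⬝ᵥ (X *ᵥ v)) h1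
    have h4 : star v ᵥ* Kᴴ = 0 := by rw [← Matrix.star_mulVec, hKv, star_zero]
    simp only [Matrix.sub_mulVec, ← Matrix.mulVec_mulVec, hKv, Matrix.mulVec_zero, sub_zero,
      Matrix.smul_mulVec, Matrix.one_mulVec, dotProduct_smul, Matrix.dotProduct_mulVec (star v) Kᴴ,
      h4, zero_dotProduct] at h3
    have : star v ⬝ᵥ v = 0 := by simpa using h3.symm
    exact hv (dotProduct_star_self_eq_zero.mp this)
  refine ⟨hK, ?_⟩
  have hu : IsUnit K.det := isUnit_iff_ne_zero.mpr hK
  set Z := N * K⁻¹ with hZ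
  have hZK : Z * K = N := by rw [hZ, Matrix.mul_assoc, Matrix.nonsing_inv_mul _ hu, Matrix.mul_one]
  have hsymm : Zᵀ = Z := by
    have h3 : Kᵀ * Zᵀ * K = Kᵀ * Z * K := by
      rw [← Matrix.transpose_mul, Matrix.mul_assoc Kᵀ, hZK, h2]
    have huT : IsUnit Kᵀ := (Matrix.isUnit_iff_isUnit_det _).mpr (by rwa [Matrix.det_transpose])
    exact huT.mul_left_cancel (((Matrix.isUnit_iff_isUnit_det _).mpr hu).mul_right_cancel h3)
  have him : Z - Zᴴ = (2 * Complex.I) • (Z.map Complex.im).map Complex.ofReal := by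
    ext i j
    have hs : Z j i = Z i j := congrFun (congrFun hsymm i) j
    simp only [Matrix.sub_apply, Matrix.conjTranspose_apply, Matrix.smul_apply, Matrix.map_apply,
      hs, RCLike.star_def, Complex.sub_conj, smul_eq_mul]
    push_cast; ring
  have hprod : Kᴴ * (Z.map Complex.im).map Complex.ofReal * K = 1 := by
    have h3 : (2 * Complex.I) • (Kᴴ * (Z.map Complex.im).map Complex.ofReal * K) =
        (2 * Complex.I) • (1 : Matrix n n ℂ) := by
      rw [← h1, ← Matrix.smul_mul, ← Matrix.mul_smul, ← him, Matrix.mul_sub, Matrix.sub_mul,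
        Matrix.mul_assoc, hZK, ← Matrix.conjTranspose_mul, hZK]
    exact smul_right_injective _ (by simp) h3
  have hd := congrArg Matrix.det hprod
  have hmap : ((Z.map Complex.im).map Complex.ofReal).det = (((Z.map Complex.im).det : ℝ) : ℂ) :=
    (RingHom.map_det Complex.ofRealHom _).symm
  rw [Matrix.det_mul, Matrix.det_mul, Matrix.det_conjTranspose, Matrix.det_one, hmap,
    RCLike.star_def, mul_right_comm, Complex.conj_mul'] at hd
  have hd' : ‖K.det‖ ^ 2 * (Z.map Complex.im).det = 1 := by exact_mod_cast hd
  exact eq_inv_of_mul_eq_one_right hd'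

/-- For symplectic `β = (A B; C D)`, the height of `β⁻¹(iI)` is `|det (A - iC)|⁻²`. -/
theorem det_im_moebius_inv {g : ℕ} {β : Matrix (Fin g ⊕ Fin g) (Fin g ⊕ Fin g) ℝ}
    (hβ : βᵀ * Jmat g * β = Jmat g) :
    (β.toBlocks₁₁.map Complex.ofReal - Complex.I • β.toBlocks₂₁.map Complex.ofReal).det ≠ 0 ∧
    ((moebius β⁻¹ (Complex.I • (1 : Matrix (Fin g) (Fin g) ℂ))).map Complex.im).det =
      (‖(β.toBlocks₁₁.map Complex.ofReal -
        Complex.I • β.toBlocks₂₁.map Complex.ofReal).det‖ ^ 2)⁻¹ := by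
  obtain ⟨A, B, C, D, rfl⟩ : ∃ A B C D, β = Matrix.fromBlocks A B C D :=
    ⟨_, _, _, _, (Matrix.fromBlocks_toBlocks β).symm⟩
  have hJJ : Jmat g * Jmat g = -1 := by
    simp [Jmat, Matrix.fromBlocks_multiply, ← Matrix.fromBlocks_one, Matrix.fromBlocks_neg]
  have hinv : (Matrix.fromBlocks A B C D)⁻¹ = Matrix.fromBlocks Dᵀ (-Bᵀ) (-Cᵀ) Aᵀ := by
    refine Matrix.inv_eq_left_inv ?_
    have : Matrix.fromBlocks Dᵀ (-Bᵀ) (-Cᵀ) Aᵀ =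
        -(Jmat g * (Matrix.fromBlocks A B C D)ᵀ * Jmat g) := by
      simp [Jmat, Matrix.fromBlocks_multiply, Matrix.fromBlocks_transpose, Matrix.fromBlocks_neg]
    rw [this, Matrix.neg_mul, Matrix.mul_assoc, Matrix.mul_assoc, ← Matrix.mul_assoc _ (Jmat g),
      hβ, hJJ, neg_neg]
  have hβ' : Matrix.fromBlocks A B C D * Matrix.fromBlocks Dᵀ (-Bᵀ) (-Cᵀ) Aᵀ = 1 := by
    rw [← hinv]
    refine Matrix.mul_nonsing_inv _ (isUnit_iff_ne_zero.mpr fun h0 => ?_)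
    have := congrArg Matrix.det hβ
    have hJ : (Jmat g).det ≠ 0 := fun hJ => by
      have := congrArg Matrix.det hJJ
      simp [hJ, Matrix.det_neg] at this
    rw [Matrix.det_mul, h0, mul_zero] at this
    exact hJ this.symm
  rw [Matrix.fromBlocks_multiply, ← Matrix.fromBlocks_one, Matrix.fromBlocks_inj] at hβ'
  obtain ⟨h11, h12, h21, h22⟩ := hβ'
  have cast_mul : ∀ X Y : Matrix (Fin g) (Fin g) ℝ, (X * Y).map Complex.ofReal =
      X.map Complex.ofReal * Y.map Complex.ofReal := fun X Y =>
    Matrix.map_mul (f := Complex.ofRealHom)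
  have cast_add : ∀ X Y : Matrix (Fin g) (Fin g) ℝ, (X + Y).map Complex.ofReal =
      X.map Complex.ofReal + Y.map Complex.ofReal := fun X Y => by ext; simp
  have cast_neg : ∀ X : Matrix (Fin g) (Fin g) ℝ, (-X).map Complex.ofReal =
      -X.map Complex.ofReal := fun X => by ext; simp
  have cast_H : ∀ X : Matrix (Fin g) (Fin g) ℝ, (X.map Complex.ofReal)ᴴ =
      (X.map Complex.ofReal)ᵀ := fun X => by ext; simp
  have cast_one : (1 : Matrix (Fin g) (Fin g) ℝ).map Complex.ofReal = 1 := by simp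
  have cast_zero : (0 : Matrix (Fin g) (Fin g) ℝ).map Complex.ofReal = 0 := by simp
  have h11 := congrArg (fun X => X.map Complex.ofReal) h11
  have h12 := congrArg (fun X => X.map Complex.ofReal) h12
  have h21 := congrArg (fun X => X.map Complex.ofReal) h21
  have h22 := congrArg (fun X => X.map Complex.ofReal) h22
  simp only [cast_mul, cast_add, cast_neg, cast_one, cast_zero, Matrix.transpose_map,
    Matrix.mul_neg] at h11 h12 h21 h22
  rw [hinv]
  simp only [moebius, Matrix.toBlocks_fromBlocks₁₁, Matrix.toBlocks_fromBlocks₁₂,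
    Matrix.toBlocks_fromBlocks₂₁, Matrix.toBlocks_fromBlocks₂₂, cast_neg, Matrix.transpose_map]
  have hA := cast_H A
  have hB := cast_H B
  have hC := cast_H C
  have hD := cast_H D
  generalize A.map Complex.ofReal = a at *
  generalize B.map Complex.ofReal = b at *
  generalize C.map Complex.ofReal = c at *
  generalize D.map Complex.ofReal = d at *
  have hT : ∀ x : Matrix (Fin g) (Fin g) ℂ, xᴴ = xᵀ → xᵀᴴ = x := fun x hx => by
    rw [← hx, Matrix.conjTranspose_conjTranspose]
  have hK : (-cᵀ * (Complex.I • 1) + aᵀ : Matrix (Fin g) (Fin g) ℂ) = (a - Complex.I • c)ᵀ := by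
    simp [sub_eq_add_neg, add_comm]
  have key := det_im_mul_inv (N := dᵀ * (Complex.I • 1) + -bᵀ)
    (K := -cᵀ * (Complex.I • 1) + aᵀ) ?_ ?_
  · rw [hK, Matrix.det_transpose] at key
    rw [hK]
    exact key
  · simp only [Matrix.conjTranspose_add, Matrix.conjTranspose_neg, Matrix.conjTranspose_smul,
      hT a hA, hT b hB, hT c hC, hT d hD, Matrix.mul_smul, Matrix.mul_one, RCLike.star_def,
      Complex.conj_I, Matrix.add_mul, Matrix.mul_add, Matrix.smul_mul, Matrix.neg_mul,
      Matrix.mul_neg, smul_neg, neg_smul, smul_add, smul_smul, Complex.I_mul_I]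
    linear_combination (norm := module) Complex.I • h11 + h12 - h21 + Complex.I • h22
  · simp only [Matrix.transpose_add, Matrix.transpose_neg, Matrix.transpose_smul,
      Matrix.transpose_transpose, Matrix.mul_smul, Matrix.mul_one,
      Matrix.add_mul, Matrix.mul_add, Matrix.smul_mul, Matrix.neg_mul,
      Matrix.mul_neg, smul_neg, neg_smul, smul_add, smul_smul, Complex.I_mul_I]
    linear_combination (norm := module) Complex.I • h11 + h12 + h21 - Complex.I • h22

/-- The diagonal matrix `R_t` is symplectic. -/
theorem Rmat_symplectic (g : ℕ) (δ : Fin g → ℝ) (t : ℝ) :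
    (Rmat g δ t)ᵀ * Jmat g * Rmat g δ t = Jmat g := by
  rw [Rmat, Jmat, Matrix.fromBlocks_transpose, Matrix.fromBlocks_multiply,
    Matrix.fromBlocks_multiply]
  simp [Matrix.diagonal_mul_diagonal, ← Real.exp_add]
  rw [← Matrix.diagonal_one, Matrix.diagonal_neg]

/-- The trivial bound `det Im ((R_t β)⁻¹(iI)) ≤ (det D_t)² ⬝ det Im (β⁻¹(iI))` for the
height along the diagonal Cartan flow. -/
theorem height_cartan_flow_bound (g : ℕ) (hg : 1 ≤ g)
    (δ : Fin g → ℝ) (hδ : ∀ i, 0 ≤ δ i) (t : ℝ) (ht : 0 ≤ t)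
    (β : Matrix (Fin g ⊕ Fin g) (Fin g ⊕ Fin g) ℝ)
    (hβ : βᵀ * Jmat g * β = Jmat g) :
    ((moebius (Rmat g δ t * β)⁻¹
        (Complex.I • (1 : Matrix (Fin g) (Fin g) ℂ))).map Complex.im).det ≤
      ((Matrix.diagonal fun i => Real.exp (t * δ i)).det) ^ 2 *
        ((moebius β⁻¹ (Complex.I • (1 : Matrix (Fin g) (Fin g) ℂ))).map Complex.im).det := by
  have hRβ : (Rmat g δ t * β)ᵀ * Jmat g * (Rmat g δ t * β) = Jmat g := by
    calc _ = βᵀ * ((Rmat g δ t)ᵀ * Jmat g * Rmat g δ t) * β := by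
          simp only [Matrix.transpose_mul, Matrix.mul_assoc]
      _ = _ := by rw [Rmat_symplectic, hβ]
  obtain ⟨hne, h1⟩ := det_im_moebius_inv hβ
  obtain ⟨-, h2⟩ := det_im_moebius_inv hRβ
  rw [h1, h2]
  obtain ⟨A, B, C, D, rfl⟩ : ∃ A B C D, β = Matrix.fromBlocks A B C D :=
    ⟨_, _, _, _, (Matrix.fromBlocks_toBlocks β).symm⟩
  have hAC : Aᵀ * C = Cᵀ * A := by
    simp only [Jmat, Matrix.fromBlocks_transpose, Matrix.fromBlocks_multiply,
      Matrix.fromBlocks_inj] at hβ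
    have := hβ.1
    simp only [Matrix.mul_zero, Matrix.mul_one, zero_add, add_zero, Matrix.mul_neg,
      Matrix.neg_mul] at this
    linear_combination (norm := module) this
  have hACc : (A.map Complex.ofReal)ᵀ * C.map Complex.ofReal =
      (C.map Complex.ofReal)ᵀ * A.map Complex.ofReal := by
    rw [← Matrix.transpose_map, ← Matrix.transpose_map]
    exact (Matrix.map_mul (f := Complex.ofRealHom)).symm.trans
      ((congrArg (fun X => X.map Complex.ofRealHom) hAC).trans
        (Matrix.map_mul (f := Complex.ofRealHom)))
  have hle := norm_det_sub_le (fun i => Real.exp (t * δ i) ^ 2)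
    (fun i => one_le_pow₀ (Real.one_le_exp (mul_nonneg ht (hδ i))))
    (A := A.map Complex.ofReal) (C := C.map Complex.ofReal)
    (by ext; simp) (by ext; simp) hACc
  have hfac : ((Rmat g δ t * Matrix.fromBlocks A B C D).toBlocks₁₁.map Complex.ofReal -
      Complex.I • (Rmat g δ t * Matrix.fromBlocks A B C D).toBlocks₂₁.map Complex.ofReal) =
      (Matrix.diagonal fun i => ((Real.exp (-(t * δ i)) : ℝ) : ℂ)) *
      (A.map Complex.ofReal - Complex.I •
        ((Matrix.diagonal fun i => ((Real.exp (t * δ i) ^ 2 : ℝ) : ℂ)) * C.map Complex.ofReal)) := by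
    ext i j
    have he : Real.exp (t * δ i) = Real.exp (-(t * δ i)) * Real.exp (t * δ i) ^ 2 := by
      rw [sq, ← mul_assoc, ← Real.exp_add]; simp
    have he' : (Real.exp (t * δ i) : ℂ) =
        (Real.exp (-(t * δ i)) : ℂ) * (Real.exp (t * δ i) : ℂ) ^ 2 := by exact_mod_cast he
    simp only [Rmat, Matrix.fromBlocks_multiply, Matrix.toBlocks_fromBlocks₁₁,
      Matrix.toBlocks_fromBlocks₂₁, Matrix.zero_mul, add_zero, zero_add, Matrix.sub_apply,
      Matrix.smul_apply, Matrix.map_apply, Matrix.diagonal_mul, smul_eq_mul, Complex.ofReal_mul,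
      Complex.ofReal_pow]
    linear_combination (-Complex.I * (C i j : ℂ)) * he'
  have hdet : ‖(Matrix.diagonal fun i => ((Real.exp (-(t * δ i)) : ℝ) : ℂ)).det‖ =
      ((Matrix.diagonal fun i => Real.exp (t * δ i)).det)⁻¹ := by
    rw [Matrix.det_diagonal, Matrix.det_diagonal, ← Finset.prod_inv_distrib, norm_prod]
    exact Finset.prod_congr rfl fun i _ => by
      rw [Complex.norm_real, Real.norm_eq_abs, Real.abs_exp, Real.exp_neg]
  simp only [Matrix.toBlocks_fromBlocks₁₁, Matrix.toBlocks_fromBlocks₂₁] at hne ⊢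
  rw [hfac, Matrix.det_mul, norm_mul, hdet, mul_pow, mul_inv, inv_pow, inv_inv]
  refine mul_le_mul_of_nonneg_left ?_ (sq_nonneg _)
  exact inv_anti₀ (pow_pos (norm_pos_iff.mpr hne) 2) (pow_le_pow_left₀ (norm_nonneg _) hle 2)
end

section
/- Let g ≥ 1. For every Schwartz function f : ℝ^g → ℂ one has g · ∫_{ℝ^g} |f(x)|² dx ≤ ∫_{ℝ^g} ‖x‖² |f(x)|² dx + ∫_{ℝ^g} ‖∇f(x)‖² dx. (Equivalently, the harmonic oscillator ‖x‖² − Δ on ℝ^g is a positive operator whose spectrum is bounded below by g.) -/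
open MeasureTheory

namespace SchwartzMap

open scoped LineDeriv

variable {E F : Type*} [NormedAddCommGroup E] [InnerProductSpace ℝ E]
  [NormedAddCommGroup F] [InnerProductSpace ℝ F]

theorem hasTemperateGrowth_inner_left (v : E) :
    (fun x : E ↦ inner ℝ v x).HasTemperateGrowth :=
  (innerSL ℝ v).hasTemperateGrowth

theorem lineDerivOp_smulLeftCLM_inner (f : SchwartzMap E F) (v x : E) :
    (∂_{v} (smulLeftCLM F (fun y : E ↦ inner ℝ v y) f)) x =
      ‖v‖ ^ 2 • f x + inner ℝ v x • fderiv ℝ f x v := by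
  have hcoe : ⇑(smulLeftCLM F (fun y : E ↦ inner ℝ v y) f) =
      fun y ↦ (innerSL ℝ v) y • f y := by
    ext y
    simp [smulLeftCLM_apply_apply (hasTemperateGrowth_inner_left v)]
  rw [lineDerivOp_apply_eq_fderiv, hcoe,
    ((innerSL ℝ v).hasFDerivAt.fun_smul f.differentiableAt.hasFDerivAt).fderiv]
  simp [add_comm]

variable [FiniteDimensional ℝ E]

theorem inner_fderiv_apply_self_eq_sum (f : SchwartzMap E F) (x : E) :
    inner ℝ (f x) (fderiv ℝ f x x) =
      ∑ i, inner ℝ (stdOrthonormalBasis ℝ E i) x *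
        inner ℝ (f x) (fderiv ℝ f x (stdOrthonormalBasis ℝ E i)) := by
  simp_rw [← real_inner_smul_right, ← inner_sum, ← map_smul, ← map_sum,
    (stdOrthonormalBasis ℝ E).sum_repr' x]

variable [MeasurableSpace E] [BorelSpace E]

theorem integrable_inner (f g : SchwartzMap E F) :
    Integrable (fun x ↦ inner ℝ (f x) (g x)) :=
  (bilinLeftCLM (innerSL ℝ) g.hasTemperateGrowth f).integrable

theorem integrable_inner_mul_inner_fderiv (f : SchwartzMap E F) (v : E) :
    Integrable (fun x ↦ inner ℝ v x * inner ℝ (f x) (fderiv ℝ f x v)) := by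
  convert integrable_inner (smulLeftCLM F (fun y : E ↦ inner ℝ v y) f) (∂_{v} f) using 2 with x
  simp [smulLeftCLM_apply_apply (hasTemperateGrowth_inner_left v), lineDerivOp_apply_eq_fderiv,
    real_inner_smul_left]

theorem integrable_norm_sq (f : SchwartzMap E F) : Integrable (fun x ↦ ‖f x‖ ^ 2) := by
  simpa using integrable_inner f f

theorem sq_norm_mul_integral_norm_sq (f : SchwartzMap E F) (v : E) :
    ‖v‖ ^ 2 * ∫ x, ‖f x‖ ^ 2 =
      ∫ x, -2 * (inner ℝ v x * inner ℝ (f x) (fderiv ℝ f x v)) := by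
  set h := smulLeftCLM F (fun y : E ↦ inner ℝ v y) f with h_def
  have key : ∫ x, inner ℝ (f x) (∂_{v} h x) = -∫ x, inner ℝ (∂_{v} f x) (h x) :=
    integral_bilinear_lineDerivOp_right_eq_neg_left f h (innerSL ℝ) v
  simp only [h_def, lineDerivOp_smulLeftCLM_inner, inner_add_right, real_inner_smul_right,
    real_inner_self_eq_norm_sq, lineDerivOp_apply_eq_fderiv v f,
    smulLeftCLM_apply_apply (hasTemperateGrowth_inner_left v)] at key
  rw [integral_add (f.integrable_norm_sq.const_mul _) (f.integrable_inner_mul_inner_fderiv v),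
    integral_const_mul] at key
  simp only [real_inner_comm (f _) (fderiv ℝ f _ v)] at key
  rw [integral_const_mul]
  linarith

theorem integrable_inner_fderiv_apply_self (f : SchwartzMap E F) :
    Integrable (fun x ↦ inner ℝ (f x) (fderiv ℝ f x x)) := by
  simp only [inner_fderiv_apply_self_eq_sum]
  exact integrable_finsetSum _ fun i _ ↦ f.integrable_inner_mul_inner_fderiv _

/-- Integration by parts against the Euler vector field `x ↦ x`, whose divergence is the
dimension. -/
theorem finrank_mul_integral_norm_sq (f : SchwartzMap E F) :
    Module.finrank ℝ E * ∫ x, ‖f x‖ ^ 2 = ∫ x, -2 * inner ℝ (f x) (fderiv ℝ f x x) := by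
  simp only [inner_fderiv_apply_self_eq_sum, Finset.mul_sum]
  rw [integral_finsetSum _ fun i _ ↦ (f.integrable_inner_mul_inner_fderiv _).const_mul _]
  simp only [← sq_norm_mul_integral_norm_sq]
  simp

theorem integrable_norm_sq_mul_norm_sq (f : SchwartzMap E F) :
    Integrable (fun x ↦ ‖x‖ ^ 2 * ‖f x‖ ^ 2) := by
  have h := (f.integrable_pow_mul volume 2).mul_bdd (f.memLp_top.1.norm)
    (c := SchwartzMap.seminorm ℝ 0 0 f) (.of_forall fun x ↦ by simpa using f.norm_le_seminorm ℝ x)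
  simpa only [mul_assoc, ← sq] using h

theorem integrable_norm_fderiv_sq (f : SchwartzMap E F) :
    Integrable (fun x ↦ ‖fderiv ℝ f x‖ ^ 2) :=
  ((fderivCLM ℝ E F f).memLp 2 volume).integrable_norm_pow (by simp)

/-- The uncertainty inequality for the harmonic oscillator, with the operator norm of the
derivative. -/
theorem finrank_mul_integral_norm_sq_le (f : SchwartzMap E F) :
    Module.finrank ℝ E * ∫ x, ‖f x‖ ^ 2 ≤
      (∫ x, ‖x‖ ^ 2 * ‖f x‖ ^ 2) + ∫ x, ‖fderiv ℝ f x‖ ^ 2 := by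
  rw [finrank_mul_integral_norm_sq,
    ← integral_add f.integrable_norm_sq_mul_norm_sq f.integrable_norm_fderiv_sq]
  refine integral_mono (f.integrable_inner_fderiv_apply_self.const_mul _)
    (f.integrable_norm_sq_mul_norm_sq.add f.integrable_norm_fderiv_sq) fun x ↦ ?_
  have h₁ := (abs_le.1 (abs_real_inner_le_norm (f x) (fderiv ℝ f x x))).1
  have h₂ := mul_le_mul_of_nonneg_left ((fderiv ℝ f x).le_opNorm x) (norm_nonneg (f x))
  dsimp only
  nlinarith [sq_nonneg (‖x‖ * ‖f x‖ - ‖fderiv ℝ f x‖)]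

end SchwartzMap

/-- The harmonic oscillator `‖x‖² - Δ` on `ℝ^g` is bounded below by `g`:
for every Schwartz function `f`,
`g ∫ |f|² ≤ ∫ ‖x‖²|f(x)|² dx + ∫ ‖∇f(x)‖² dx`. -/
theorem harmonic_oscillator_lower_bound (g : ℕ) (hg : 1 ≤ g)
    (f : SchwartzMap (EuclideanSpace ℝ (Fin g)) ℂ) :
    (g : ℝ) * ∫ x : EuclideanSpace ℝ (Fin g), ‖f x‖ ^ 2 ≤
      (∫ x : EuclideanSpace ℝ (Fin g), ‖x‖ ^ 2 * ‖f x‖ ^ 2) +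
        ∫ x : EuclideanSpace ℝ (Fin g), ‖fderiv ℝ (⇑f) x‖ ^ 2 := by
  simpa using f.finrank_mul_integral_norm_sq_le
end

section
/- Let 2 ≤ d ≤ g and let f₁,…,f_d : ℝ^g → ℂ be Schwartz functions satisfying the closedness (curl-free) conditions ∂f_i/∂x_j = ∂f_j/∂x_i for all 1 ≤ i, j ≤ d, where ∂/∂x_j denotes the partial derivative in the j-th coordinate of ℝ^g. Then there exists a Schwartz function Ω : ℝ^g → ℂ with ∂Ω/∂x_i = f_i for all 1 ≤ i ≤ d. (This is the degree-one case of the vanishing, with Schwartz primitives, of the cohomology in degrees k < d of the translation action of ℝ^d on 𝓢(ℝ^g).) -/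
open MeasureTheory Set Filter Topology SchwartzMap

section LineIntegral

variable {E F : Type} [NormedAddCommGroup E] [InnerProductSpace ℝ E]
  [NormedAddCommGroup F] [NormedSpace ℝ F]

/-- Decay of a Schwartz function in terms of a parameter bounded by the norm of the argument. -/
lemma SchwartzMap.exists_pow_mul_norm_le_inv_one_add_sq (f : 𝓢(E, F)) (k : ℕ) (R : ℝ) :
    ∃ C, 0 ≤ C ∧ ∀ (z : E) (t : ℝ), |t| ≤ ‖z‖ + R → ‖z‖ ^ k * ‖f z‖ ≤ C * (1 + t ^ 2)⁻¹ := by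
  obtain ⟨A, hA0, hA⟩ := f.decay k 0
  obtain ⟨B, hB0, hB⟩ := f.decay (k + 2) 0
  simp only [norm_iteratedFDeriv_zero] at hA hB
  refine ⟨(1 + 2 * R ^ 2) * A + 2 * B, by positivity, fun z t ht => ?_⟩
  rw [← div_eq_mul_inv, le_div_iff₀ (by positivity)]
  have h1 : t ^ 2 ≤ (‖z‖ + R) ^ 2 := by
    rw [← sq_abs t]
    gcongr
  have h2 : 1 + t ^ 2 ≤ (1 + 2 * R ^ 2) + 2 * ‖z‖ ^ 2 := by
    nlinarith [sq_nonneg (‖z‖ - R)]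
  calc ‖z‖ ^ k * ‖f z‖ * (1 + t ^ 2)
      ≤ ‖z‖ ^ k * ‖f z‖ * ((1 + 2 * R ^ 2) + 2 * ‖z‖ ^ 2) := by gcongr
    _ = (1 + 2 * R ^ 2) * (‖z‖ ^ k * ‖f z‖) + 2 * (‖z‖ ^ (k + 2) * ‖f z‖) := by ring
    _ ≤ (1 + 2 * R ^ 2) * A + 2 * B := by
      gcongr
      · exact hA z
      · exact hB z

lemma abs_le_norm_add_smul {e : E} (he : ‖e‖ = 1) (x : E) (t : ℝ) :
    |t| ≤ ‖x + t • e‖ + ‖x‖ := by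
  calc |t| = ‖(x + t • e) - x‖ := by simp [norm_smul, he]
    _ ≤ _ := norm_sub_le _ _

lemma SchwartzMap.integrable_line (f : 𝓢(E, F)) {e : E} (he : ‖e‖ = 1) (x : E) :
    Integrable fun t : ℝ => f (x + t • e) := by
  obtain ⟨C, -, hC⟩ := f.exists_pow_mul_norm_le_inv_one_add_sq 0 ‖x‖
  refine (integrable_inv_one_add_sq.const_mul C).mono'
    (Continuous.aestronglyMeasurable (by fun_prop)) (ae_of_all _ fun t => ?_)
  simpa using hC _ t (abs_le_norm_add_smul he x t)

lemma SchwartzMap.hasFDerivAt_setIntegral_line (f : 𝓢(E, F)) {e : E}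
    (he : ‖e‖ = 1) (s : Set ℝ) (x : E) :
    HasFDerivAt (fun y => ∫ t in s, f (y + t • e))
      (∫ t in s, fderivCLM ℝ E F f (x + t • e)) x := by
  obtain ⟨C, -, hC⟩ :=
    (fderivCLM ℝ E F f).exists_pow_mul_norm_le_inv_one_add_sq 0 (‖x‖ + 1)
  refine hasFDerivAt_integral_of_dominated_of_fderiv_le (𝕜 := ℝ)
    (F' := fun y t => fderivCLM ℝ E F f (y + t • e))
    (bound := fun t => C * (1 + t ^ 2)⁻¹)
    (Metric.ball_mem_nhds x one_pos) (Eventually.of_forall fun y => ?_)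
    (f.integrable_line he x).integrableOn ?_ (ae_of_all _ fun t y hy => ?_)
    (integrable_inv_one_add_sq.const_mul C).integrableOn (ae_of_all _ fun t y _ => ?_)
  · exact (f.integrable_line he y).integrableOn.aestronglyMeasurable
  · exact ((fderivCLM ℝ E F f).integrable_line he x).integrableOn.aestronglyMeasurable
  · have h1 := abs_le_norm_add_smul he y t
    have h2 : ‖y‖ ≤ ‖x‖ + 1 := by
      have := norm_le_norm_add_norm_sub' y x
      rw [mem_ball_iff_norm] at hy
      linarith
    simpa using hC (y + t • e) t (by linarith)
  · rw [fderivCLM_apply]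
    exact (hasFDerivAt_comp_add_right (t • e)).2 (f.hasFDerivAt (y + t • e))

lemma SchwartzMap.tendsto_line_zero (f : 𝓢(E, F)) {e : E} (he : ‖e‖ = 1) (x : E)
    {l : Filter ℝ} (hl : Tendsto (fun t : ℝ => |t|) l atTop) :
    Tendsto (fun t : ℝ => f (x + t • e)) l (𝓝 0) := by
  obtain ⟨C, -, hC⟩ := f.exists_pow_mul_norm_le_inv_one_add_sq 0 ‖x‖
  have h2 : Tendsto (fun t : ℝ => 1 + t ^ 2) l atTop := by
    refine tendsto_atTop_add_const_left _ _ ?_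
    simpa only [Function.comp_def, sq_abs] using
      (tendsto_pow_atTop (α := ℝ) two_ne_zero).comp hl
  have h3 : Tendsto (fun t : ℝ => C * (1 + t ^ 2)⁻¹) l (𝓝 0) := by
    simpa using h2.inv_tendsto_atTop.const_mul C
  refine squeeze_zero_norm (fun t => ?_) h3
  simpa using hC _ t (abs_le_norm_add_smul he x t)

lemma SchwartzMap.hasDerivAt_line (f : 𝓢(E, F)) (e x : E) (t : ℝ) :
    HasDerivAt (fun t : ℝ => f (x + t • e)) (fderivCLM ℝ E F f (x + t • e) e) t := by
  have h : HasDerivAt (fun t : ℝ => x + t • e) e t := by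
    simpa using ((hasDerivAt_id t).smul_const e).const_add x
  exact (f.hasFDerivAt (x + t • e)).comp_hasDerivAt t h

lemma SchwartzMap.integrable_fderiv_line (f : 𝓢(E, F)) {e : E} (he : ‖e‖ = 1) (x v : E) :
    Integrable fun t : ℝ => fderivCLM ℝ E F f (x + t • e) v :=
  ((fderivCLM ℝ E F f).integrable_line he x).apply_continuousLinearMap v

lemma SchwartzMap.integral_fderiv_line [CompleteSpace F] (f : 𝓢(E, F)) {e : E} (he : ‖e‖ = 1) (x : E) :
    ∫ t : ℝ, fderivCLM ℝ E F f (x + t • e) e = 0 := by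
  simpa using integral_of_hasDerivAt_of_tendsto (f.hasDerivAt_line e x)
    (f.integrable_fderiv_line he x e) (f.tendsto_line_zero he x tendsto_abs_atBot_atTop)
    (f.tendsto_line_zero he x tendsto_abs_atTop_atTop)

lemma SchwartzMap.setIntegral_Iic_fderiv_line [CompleteSpace F] (f : 𝓢(E, F)) {e : E} (he : ‖e‖ = 1)
    (x : E) : ∫ t in Iic (0 : ℝ), fderivCLM ℝ E F f (x + t • e) e = f x := by
  simpa using integral_Iic_of_hasDerivAt_of_tendsto' (a := (0 : ℝ))
    (fun t _ => f.hasDerivAt_line e x t)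
    (f.integrable_fderiv_line he x e).integrableOn
    (f.tendsto_line_zero he x tendsto_abs_atBot_atTop)

lemma SchwartzMap.integral_fderivCLM_line_eq_zero (f : 𝓢(E, F)) {e : E} (he : ‖e‖ = 1)
    (h : ∀ x, ∫ t : ℝ, f (x + t • e) = 0) (x : E) :
    ∫ t : ℝ, fderivCLM ℝ E F f (x + t • e) = 0 := by
  have h1 := f.hasFDerivAt_setIntegral_line he univ x
  simp only [Measure.restrict_univ, h] at h1
  exact h1.unique (hasFDerivAt_const 0 x)

/-- Moving from `x` in a direction `t • e` which does not point back towards the origin increases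
the norm. -/
lemma max_norm_abs_le_norm_add_smul {e : E} (he : ‖e‖ = 1) (x : E) (t : ℝ)
    (h : 0 ≤ t * inner ℝ x e) : ‖x‖ ≤ ‖x + t • e‖ ∧ |t| ≤ ‖x + t • e‖ := by
  have h1 : ‖x + t • e‖ ^ 2 = ‖x‖ ^ 2 + 2 * (t * inner ℝ x e) + t ^ 2 := by
    rw [norm_add_sq_real, inner_smul_right, norm_smul, he, mul_one, Real.norm_eq_abs, sq_abs]
  constructor
  · refine le_of_sq_le_sq ?_ (norm_nonneg _)
    nlinarith [sq_nonneg t]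
  · refine le_of_sq_le_sq ?_ (norm_nonneg _)
    rw [sq_abs]
    nlinarith [sq_nonneg ‖x‖]

lemma SchwartzMap.exists_pow_mul_norm_setIntegral_line_le (f : 𝓢(E, F)) {e : E}
    (he : ‖e‖ = 1) (h : ∀ x, ∫ t : ℝ, f (x + t • e) = 0) (k : ℕ) :
    ∃ C, ∀ x, ‖x‖ ^ k * ‖∫ t in Iic (0 : ℝ), f (x + t • e)‖ ≤ C := by
  obtain ⟨C, hC0, hC⟩ := f.exists_pow_mul_norm_le_inv_one_add_sq k 0
  have key : ∀ (s : Set ℝ) (x : E), MeasurableSet s → (∀ t ∈ s, 0 ≤ t * inner ℝ x e) →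
      ‖x‖ ^ k * ‖∫ t in s, f (x + t • e)‖ ≤ ∫ t : ℝ, C * (1 + t ^ 2)⁻¹ := by
    intro s x hs hx
    have hi : Integrable fun t : ℝ => C * (1 + t ^ 2)⁻¹ := integrable_inv_one_add_sq.const_mul C
    calc ‖x‖ ^ k * ‖∫ t in s, f (x + t • e)‖
        = ‖∫ t in s, ‖x‖ ^ k • f (x + t • e)‖ := by
          rw [integral_smul, norm_smul, norm_pow, norm_norm]
      _ ≤ ∫ t in s, C * (1 + t ^ 2)⁻¹ := by
          refine norm_integral_le_of_norm_le hi.integrableOn ?_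
          filter_upwards [ae_restrict_mem hs] with t ht
          obtain ⟨h1, h2⟩ := max_norm_abs_le_norm_add_smul he x t (hx t ht)
          rw [norm_smul, norm_pow, norm_norm]
          refine le_trans ?_ (hC (x + t • e) t (by simpa using h2))
          gcongr
      _ ≤ ∫ t : ℝ, C * (1 + t ^ 2)⁻¹ :=
          setIntegral_le_integral hi (ae_of_all _ fun t => by positivity)
  refine ⟨∫ t : ℝ, C * (1 + t ^ 2)⁻¹, fun x => ?_⟩
  rcases le_total (inner ℝ x e) 0 with hx | hx
  · exact key (Iic 0) x measurableSet_Iic fun t ht => mul_nonneg_of_nonpos_of_nonpos ht hx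
  · have h1 : ∫ t in Iic (0 : ℝ), f (x + t • e) = -∫ t in Ioi (0 : ℝ), f (x + t • e) := by
      rw [eq_neg_iff_add_eq_zero, ← h x]
      exact intervalIntegral.integral_Iic_add_Ioi
        (f.integrable_line he x).integrableOn (f.integrable_line he x).integrableOn
    rw [h1, norm_neg]
    exact key (Ioi 0) x measurableSet_Ioi fun t ht => mul_nonneg (le_of_lt ht) hx

end LineIntegral

section Primitive

variable {E : Type} [NormedAddCommGroup E] [InnerProductSpace ℝ E]

lemma SchwartzMap.contDiff_setIntegral_line {e : E} (he : ‖e‖ = 1) (s : Set ℝ) (n : ℕ) :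
    ∀ {F : Type} [NormedAddCommGroup F] [NormedSpace ℝ F] (f : 𝓢(E, F)),
      ContDiff ℝ n fun x => ∫ t in s, f (x + t • e) := by
  induction n with
  | zero =>
    intro F _ _ f
    exact contDiff_zero.2 (continuous_iff_continuousAt.2 fun x =>
      (f.hasFDerivAt_setIntegral_line he s x).continuousAt)
  | succ n ih =>
    intro F _ _ f
    exact contDiff_succ_iff_hasFDerivAt.2
      ⟨_, ih (fderivCLM ℝ E F f), f.hasFDerivAt_setIntegral_line he s⟩

lemma SchwartzMap.exists_pow_mul_norm_iteratedFDeriv_setIntegral_line_le {e : E}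
    (he : ‖e‖ = 1) (k n : ℕ) :
    ∀ {F : Type} [NormedAddCommGroup F] [NormedSpace ℝ F] (f : 𝓢(E, F)),
      (∀ x, ∫ t : ℝ, f (x + t • e) = 0) →
      ∃ C, ∀ x,
        ‖x‖ ^ k * ‖iteratedFDeriv ℝ n (fun x => ∫ t in Iic (0 : ℝ), f (x + t • e)) x‖ ≤ C := by
  induction n with
  | zero =>
    intro F _ _ f h
    simpa only [norm_iteratedFDeriv_zero] using f.exists_pow_mul_norm_setIntegral_line_le he h k
  | succ n ih =>
    intro F _ _ f h
    obtain ⟨C, hC⟩ := ih (fderivCLM ℝ E F f) (f.integral_fderivCLM_line_eq_zero he h)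
    refine ⟨C, fun x => ?_⟩
    rw [← norm_iteratedFDeriv_fderiv]
    convert hC x using 4
    ext1 y
    exact (f.hasFDerivAt_setIntegral_line he (Iic 0) y).fderiv

/-- The primitive along `e` of a Schwartz function whose integrals over all lines parallel to `e`
vanish is a Schwartz function. -/
lemma SchwartzMap.exists_eq_setIntegral_line {F : Type} [NormedAddCommGroup F] [NormedSpace ℝ F]
    (f : 𝓢(E, F)) {e : E} (he : ‖e‖ = 1) (h : ∀ x, ∫ t : ℝ, f (x + t • e) = 0) :
    ∃ Ω : 𝓢(E, F), ⇑Ω = fun x => ∫ t in Iic (0 : ℝ), f (x + t • e) :=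
  ⟨{ toFun := fun x => ∫ t in Iic (0 : ℝ), f (x + t • e)
     smooth' := contDiff_infty.2 fun n => contDiff_setIntegral_line he _ n f
     decay' := fun k n =>
      exists_pow_mul_norm_iteratedFDeriv_setIntegral_line_le he k n f h }, rfl⟩

/-- If `∂_v f = ∂_e g` with `e`, `v` orthonormal and `f`, `g` Schwartz, then the integrals of `f`
over all lines parallel to `e` vanish. -/
lemma SchwartzMap.integral_line_eq_zero {F : Type} [NormedAddCommGroup F] [NormedSpace ℝ F]
    [CompleteSpace F] (f g : 𝓢(E, F)) {e v : E} (he : ‖e‖ = 1) (hv : ‖v‖ = 1)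
    (hev : inner ℝ v e = 0) (hfg : ∀ x, fderiv ℝ f x v = fderiv ℝ g x e) (x : E) :
    ∫ t : ℝ, f (x + t • e) = 0 := by
  have hderiv : ∀ s : ℝ, HasDerivAt (fun s : ℝ => ∫ t : ℝ, f (x + s • v + t • e)) 0 s := by
    intro s
    have h1 := f.hasFDerivAt_setIntegral_line he univ (x + s • v)
    simp only [Measure.restrict_univ] at h1
    have h2 : HasDerivAt (fun s : ℝ => x + s • v) v s := by
      simpa using ((hasDerivAt_id s).smul_const v).const_add x
    have h3 := h1.comp_hasDerivAt s h2
    rw [ContinuousLinearMap.integral_apply ((fderivCLM ℝ E F f).integrable_line he _)] at h3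
    simp only [fderivCLM_apply, hfg] at h3
    simpa only [← fderivCLM_apply ℝ, g.integral_fderiv_line he, Function.comp_def] using h3
  have hconst : ∀ s : ℝ, ∫ t : ℝ, f (x + s • v + t • e) = ∫ t : ℝ, f (x + t • e) := by
    intro s
    simpa using is_const_of_deriv_eq_zero (fun s => (hderiv s).differentiableAt)
      (fun s => (hderiv s).deriv) s 0
  obtain ⟨C, -, hC⟩ := f.exists_pow_mul_norm_le_inv_one_add_sq 0 ‖x‖
  have hlim : Tendsto (fun s : ℝ => ∫ t : ℝ, f (x + s • v + t • e)) atTop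
      (𝓝 (∫ _ : ℝ, (0 : F))) := by
    refine tendsto_integral_filter_of_dominated_convergence (fun t => C * (1 + t ^ 2)⁻¹)
      (Eventually.of_forall fun s => (f.integrable_line he _).aestronglyMeasurable)
      (Eventually.of_forall fun s => ae_of_all _ fun t => ?_)
      (integrable_inv_one_add_sq.const_mul C) (ae_of_all _ fun t => ?_)
    · have h1 := (max_norm_abs_le_norm_add_smul he (s • v) t
        (by simp [inner_smul_left, hev])).2
      have h2 : ‖s • v + t • e‖ ≤ ‖x + s • v + t • e‖ + ‖x‖ := by
        calc ‖s • v + t • e‖ = ‖(x + s • v + t • e) - x‖ := by congr 1; abel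
          _ ≤ _ := norm_sub_le _ _
      simpa using hC _ t (h1.trans h2)
    · simpa only [add_right_comm] using
        f.tendsto_line_zero hv (x + t • e) tendsto_abs_atTop_atTop
  simp only [hconst, integral_zero] at hlim
  exact tendsto_nhds_unique tendsto_const_nhds hlim

end Primitive


/-- If `f₁, …, f_d` are Schwartz functions on `ℝ^g` (`2 ≤ d ≤ g`) satisfying the
curl-free conditions `∂f_i/∂x_j = ∂f_j/∂x_i` for `1 ≤ i,j ≤ d`, then there is a
Schwartz function `Ω` with `∂Ω/∂x_i = f_i` for all `i ≤ d`. -/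
theorem closed_one_form_has_schwartz_primitive (g d : ℕ) (hd : 2 ≤ d) (hdg : d ≤ g)
    (f : Fin d → SchwartzMap (EuclideanSpace ℝ (Fin g)) ℂ)
    (hclosed : ∀ i j : Fin d, ∀ x : EuclideanSpace ℝ (Fin g),
      fderiv ℝ (⇑(f i)) x (EuclideanSpace.single (Fin.castLE hdg j) 1) =
        fderiv ℝ (⇑(f j)) x (EuclideanSpace.single (Fin.castLE hdg i) 1)) :
    ∃ Ω : SchwartzMap (EuclideanSpace ℝ (Fin g)) ℂ,
      ∀ i : Fin d, ∀ x : EuclideanSpace ℝ (Fin g),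
        fderiv ℝ (⇑Ω) x (EuclideanSpace.single (Fin.castLE hdg i) 1) = f i x := by
  have hnorm (i : Fin d) : ‖EuclideanSpace.single (Fin.castLE hdg i) (1 : ℝ)‖ = 1 := by simp
  let i₀ : Fin d := ⟨0, by lia⟩
  let i₁ : Fin d := ⟨1, by lia⟩
  have horth : inner ℝ (EuclideanSpace.single (Fin.castLE hdg i₁) (1 : ℝ))
      (EuclideanSpace.single (Fin.castLE hdg i₀) (1 : ℝ)) = 0 := by
    simp [i₀, i₁, EuclideanSpace.inner_single_left]
  obtain ⟨Ω, hΩ⟩ := (f i₀).exists_eq_setIntegral_line (hnorm i₀)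
    ((f i₀).integral_line_eq_zero (f i₁) (hnorm i₀) (hnorm i₁) horth (hclosed i₀ i₁))
  refine ⟨Ω, fun i x => ?_⟩
  rw [hΩ, ((f i₀).hasFDerivAt_setIntegral_line (hnorm i₀) (Iic 0) x).fderiv,
    ContinuousLinearMap.integral_apply
      ((fderivCLM ℝ _ _ (f i₀)).integrable_line (hnorm i₀) x).integrableOn,
    ← (f i).setIntegral_Iic_fderiv_line (hnorm i₀) x]
  simp only [fderivCLM_apply, hclosed i₀ i]
end

section
/- Let g ≥ 1 and 1 ≤ d ≤ g. There exists a constant C = C(g) > 0 such that for all t = (t₁,…,t_d) ∈ ℝ^d and all Schwartz functions f : ℝ^g → ℂ: ‖ Σ_{k=1}^{d} t_k ( (1/2) f − x_k ∂f/∂x_k ) ‖_{L²(ℝ^g)} ≤ C · (max_k |t_k|) · ‖ H_g f ‖_{L²(ℝ^g)}, where (H_g f)(x) = ‖x‖² f(x) − (Δf)(x) is the harmonic oscillator and x_k ∂f/∂x_k denotes the function x ↦ x_k · (∂f/∂x_k)(x). -/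
open MeasureTheory

/-- The Euclidean Laplacian of a function on `ℝ^ι`, as a sum of second partial
derivatives in the standard coordinate directions. -/
noncomputable def eLap {ι : Type} [Fintype ι] [DecidableEq ι]
    (f : EuclideanSpace ℝ ι → ℂ) (x : EuclideanSpace ℝ ι) : ℂ :=
  ∑ i : ι, fderiv ℝ (fun y => fderiv ℝ f y (EuclideanSpace.single i 1)) x
    (EuclideanSpace.single i 1)

/-- The harmonic oscillator `(H f)(x) = ‖x‖² f(x) - (Δ f)(x)` on `ℝ^ι`. -/
noncomputable def Hosc {ι : Type} [Fintype ι] [DecidableEq ι]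
    (f : EuclideanSpace ℝ ι → ℂ) : EuclideanSpace ℝ ι → ℂ :=
  fun x => ((‖x‖ ^ 2 : ℝ) : ℂ) * f x - eLap f x

open scoped InnerProductSpace LineDeriv

section Abstract

variable {E : Type*} [NormedAddCommGroup E] [InnerProductSpace ℂ E]

/-- A summand of a family with pairwise nonnegative inner products is bounded by the sum. -/
lemma norm_le_norm_sum_of_re_inner_nonneg {ι : Type*} [Fintype ι] (a : ι → E)
    (h : ∀ i j, i ≠ j → 0 ≤ (⟪a i, a j⟫_ℂ).re) (k : ι) : ‖a k‖ ≤ ‖∑ i, a i‖ := by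
  classical
  have hsum : ‖∑ i, a i‖ ^ 2 = ∑ i, ∑ j, (⟪a i, a j⟫_ℂ).re := by
    rw [← inner_self_eq_norm_sq (𝕜 := ℂ), sum_inner]
    simp [inner_sum]
  have hnn : ∀ i j, 0 ≤ (⟪a i, a j⟫_ℂ).re := by
    intro i j
    rcases eq_or_ne i j with rfl | hij
    · exact inner_self_nonneg (𝕜 := ℂ)
    · exact h i j hij
  have hk : ‖a k‖ ^ 2 = (⟪a k, a k⟫_ℂ).re := (inner_self_eq_norm_sq (𝕜 := ℂ) _).symm
  refine le_of_sq_le_sq ?_ (norm_nonneg _)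
  rw [hsum, hk]
  calc (⟪a k, a k⟫_ℂ).re
      ≤ ∑ j, (⟪a k, a j⟫_ℂ).re :=
        Finset.single_le_sum (f := fun j => (⟪a k, a j⟫_ℂ).re) (fun j _ => hnn k j)
          (Finset.mem_univ k)
    _ ≤ _ := Finset.single_le_sum (f := fun i => ∑ j, (⟪a i, a j⟫_ℂ).re)
          (fun i _ => Finset.sum_nonneg fun j _ => hnn i j) (Finset.mem_univ k)

variable {V ι : Type*} [AddCommGroup V] [Module ℂ V]

/-- Position operators `X i` and derivations `D i` on a space `V`, with a map `T` to an inner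
product space for which they are symmetric and skew-symmetric respectively, satisfying the
canonical commutation relations. -/
structure IsCanonicalPair (T : V →ₗ[ℂ] E) (X D : ι → V →ₗ[ℂ] V) : Prop where
  inner_X : ∀ i u v, ⟪T (X i u), T v⟫_ℂ = ⟪T u, T (X i v)⟫_ℂ
  inner_D : ∀ i u v, ⟪T (D i u), T v⟫_ℂ = -⟪T u, T (D i v)⟫_ℂ
  X_comm : ∀ i j u, X i (X j u) = X j (X i u)
  D_comm : ∀ i j u, D i (D j u) = D j (D i u)
  D_X_of_ne : ∀ i j u, i ≠ j → D i (X j u) = X j (D i u)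
  D_X_self : ∀ i u, D i (X i u) = u + X i (D i u)

namespace IsCanonicalPair

variable {T : V →ₗ[ℂ] E} {X D : ι → V →ₗ[ℂ] V}

lemma two_mul_re_inner_X_D (h : IsCanonicalPair T X D) (i : ι) (u : V) :
    2 * (⟪T (X i u), T (D i u)⟫_ℂ).re = -‖T u‖ ^ 2 := by
  have h1 : ⟪T (X i u), T (D i u)⟫_ℂ = -⟪T u, T u⟫_ℂ - ⟪T (D i u), T (X i u)⟫_ℂ := by
    rw [h.inner_D i u (X i u), h.D_X_self, map_add, inner_add_right, h.inner_X]
    ring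
  have h2 : (⟪T (D i u), T (X i u)⟫_ℂ).re = (⟪T (X i u), T (D i u)⟫_ℂ).re :=
    inner_re_symm (𝕜 := ℂ) _ _
  have h3 : (⟪T u, T u⟫_ℂ).re = ‖T u‖ ^ 2 := inner_self_eq_norm_sq (𝕜 := ℂ) _
  have h4 := congrArg Complex.re h1
  simp only [Complex.sub_re, Complex.neg_re] at h4
  linarith

lemma re_inner_oscillator (h : IsCanonicalPair T X D) (i : ι) (u : V) :
    (⟪T u, T (X i (X i u) - D i (D i u))⟫_ℂ).re = ‖T (X i u)‖ ^ 2 + ‖T (D i u)‖ ^ 2 := by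
  have h1 : ⟪T u, T (X i (X i u) - D i (D i u))⟫_ℂ =
      ⟪T (X i u), T (X i u)⟫_ℂ + ⟪T (D i u), T (D i u)⟫_ℂ := by
    rw [map_sub, inner_sub_right, h.inner_X, h.inner_D]
    ring
  rw [h1, Complex.add_re]
  exact congrArg₂ _ (inner_self_eq_norm_sq (𝕜 := ℂ) _) (inner_self_eq_norm_sq (𝕜 := ℂ) _)

lemma norm_le_norm_oscillator (h : IsCanonicalPair T X D) (i : ι) (u : V) :
    ‖T u‖ ≤ ‖T (X i (X i u) - D i (D i u))‖ := by
  have h1 := h.re_inner_oscillator i u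
  have h2 := h.two_mul_re_inner_X_D i u
  have h3 : -(⟪T (X i u), T (D i u)⟫_ℂ).re ≤ ‖T (X i u)‖ * ‖T (D i u)‖ :=
    (neg_le_abs _).trans ((Complex.abs_re_le_norm _).trans (norm_inner_le_norm _ _))
  have h4 : (⟪T u, T (X i (X i u) - D i (D i u))⟫_ℂ).re ≤
      ‖T u‖ * ‖T (X i (X i u) - D i (D i u))‖ :=
    (le_abs_self _).trans ((Complex.abs_re_le_norm _).trans (norm_inner_le_norm _ _))
  by_contra! hlt
  nlinarith [sq_nonneg (‖T (X i u)‖ - ‖T (D i u)‖), norm_nonneg (T u),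
    norm_nonneg (T (X i (X i u) - D i (D i u)))]

lemma norm_oscillator_sq (h : IsCanonicalPair T X D) (i : ι) (u : V) :
    ‖T (X i (X i u) - D i (D i u))‖ ^ 2 = ‖T (X i (X i u))‖ ^ 2 + ‖T (D i (D i u))‖ ^ 2 +
      2 * ‖T (X i (D i u))‖ ^ 2 - 2 * ‖T u‖ ^ 2 := by
  have h1 : ⟪T (X i (X i u)), T (D i (D i u))⟫_ℂ =
      -(2 * ⟪T (X i u), T (D i u)⟫_ℂ) - ⟪T (X i (D i u)), T (X i (D i u))⟫_ℂ := by
    have := h.inner_D i (X i (X i u)) (D i u)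
    rw [← neg_eq_iff_eq_neg.mpr this, h.D_X_self, h.D_X_self, map_add, map_add, map_add,
      inner_add_left, inner_add_left, h.inner_X i (X i (D i u))]
    ring
  have h2 := h.two_mul_re_inner_X_D i u
  have h3 : (⟪T (X i (D i u)), T (X i (D i u))⟫_ℂ).re = ‖T (X i (D i u))‖ ^ 2 :=
    inner_self_eq_norm_sq (𝕜 := ℂ) _
  have h4 := congrArg Complex.re h1
  simp only [Complex.sub_re, Complex.neg_re, Complex.mul_re, Complex.re_ofNat, Complex.im_ofNat,
    zero_mul, sub_zero] at h4
  rw [map_sub, @norm_sub_sq ℂ]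
  simp only [RCLike.re_to_complex]
  linarith

lemma norm_X_D_sq_le (h : IsCanonicalPair T X D) (i : ι) (u : V) :
    ‖T (X i (D i u))‖ ^ 2 ≤ 3 / 2 * ‖T (X i (X i u) - D i (D i u))‖ ^ 2 := by
  have h1 := h.norm_oscillator_sq i u
  have h2 := pow_le_pow_left₀ (norm_nonneg _) (h.norm_le_norm_oscillator i u) 2
  nlinarith [sq_nonneg ‖T (X i (X i u))‖, sq_nonneg ‖T (D i (D i u))‖]

lemma re_inner_oscillator_oscillator_nonneg (h : IsCanonicalPair T X D) {i j : ι} (hij : i ≠ j)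
    (u : V) :
    0 ≤ (⟪T (X i (X i u) - D i (D i u)), T (X j (X j u) - D j (D j u))⟫_ℂ).re := by
  have h1 : ⟪T (X i (X i u)), T (X j (X j u))⟫_ℂ = ⟪T (X i (X j u)), T (X i (X j u))⟫_ℂ := by
    rw [h.inner_X, h.X_comm i j (X j u), ← h.inner_X j, h.X_comm j i u]
  have h2 : ⟪T (X i (X i u)), T (D j (D j u))⟫_ℂ = -⟪T (X i (D j u)), T (X i (D j u))⟫_ℂ := by
    rw [h.inner_X, ← h.D_X_of_ne j i _ hij.symm, ← h.D_X_of_ne j i _ hij.symm, h.inner_D, neg_neg]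
  have h3 : ⟪T (D i (D i u)), T (X j (X j u))⟫_ℂ = -⟪T (X j (D i u)), T (X j (D i u))⟫_ℂ := by
    rw [h.inner_D, h.D_X_of_ne i j _ hij, ← h.inner_X, h.D_X_of_ne i j _ hij]
  have h4 : ⟪T (D i (D i u)), T (D j (D j u))⟫_ℂ = ⟪T (D i (D j u)), T (D i (D j u))⟫_ℂ := by
    rw [h.inner_D, h.D_comm i j (D j u), h.D_comm i j u, h.inner_D j (D i u)]
  rw [map_sub, map_sub, inner_sub_left, inner_sub_right, inner_sub_right, h1, h2, h3, h4]
  simp only [Complex.sub_re, Complex.neg_re]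
  have hp : ∀ v : E, 0 ≤ (⟪v, v⟫_ℂ).re := fun v => inner_self_nonneg (𝕜 := ℂ)
  linarith [hp (T (X i (X j u))), hp (T (X i (D j u))), hp (T (X j (D i u))),
    hp (T (D i (D j u)))]

variable [Fintype ι]

lemma norm_oscillator_le_norm_sum (h : IsCanonicalPair T X D) (k : ι) (u : V) :
    ‖T (X k (X k u) - D k (D k u))‖ ≤ ‖T (∑ i, (X i (X i u) - D i (D i u)))‖ := by
  rw [map_sum]
  exact norm_le_norm_sum_of_re_inner_nonneg _
    (fun i j hij => h.re_inner_oscillator_oscillator_nonneg hij u) k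

lemma norm_generator_le (h : IsCanonicalPair T X D) (k : ι) (u : V) :
    ‖T ((1 / 2 : ℂ) • u - X k (D k u))‖ ≤ 2 * ‖T (∑ i, (X i (X i u) - D i (D i u)))‖ := by
  have h0 := h.norm_oscillator_le_norm_sum k u
  have h1 := h.norm_le_norm_oscillator k u
  have h2 : ‖T (X k (D k u))‖ ≤ 3 / 2 * ‖T (X k (X k u) - D k (D k u))‖ := by
    refine le_of_sq_le_sq ?_ (by positivity)
    nlinarith [h.norm_X_D_sq_le k u, sq_nonneg ‖T (X k (X k u) - D k (D k u))‖]
  have h3 := norm_sub_le (T ((1 / 2 : ℂ) • u)) (T (X k (D k u)))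
  rw [map_sub, map_smul]
  have h4 : ‖(1 / 2 : ℂ)‖ = 1 / 2 := by norm_num
  rw [map_smul, norm_smul, h4] at h3
  linarith

lemma norm_sum_generator_le (h : IsCanonicalPair T X D) {κ : Type*} [Fintype κ] (e : κ → ι)
    (t : κ → ℝ) (u : V) :
    ‖T (∑ k, (t k : ℂ) • ((1 / 2 : ℂ) • u - X (e k) (D (e k) u)))‖ ≤
      2 * Fintype.card κ * (⨆ k, |t k|) * ‖T (∑ i, (X i (X i u) - D i (D i u)))‖ := by
  rw [map_sum]
  refine (norm_sum_le _ _).trans ?_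
  have hk : ∀ k ∈ Finset.univ, ‖T ((t k : ℂ) • ((1 / 2 : ℂ) • u - X (e k) (D (e k) u)))‖ ≤
      (⨆ k, |t k|) * (2 * ‖T (∑ i, (X i (X i u) - D i (D i u)))‖) := by
    intro k _
    rw [map_smul, norm_smul, Complex.norm_real, Real.norm_eq_abs]
    have ht : |t k| ≤ ⨆ k, |t k| := le_ciSup (f := fun k => |t k|) (Set.finite_range _).bddAbove k
    exact mul_le_mul ht (h.norm_generator_le (e k) u) (norm_nonneg _)
      ((abs_nonneg _).trans ht)
  refine (Finset.sum_le_card_nsmul _ _ _ hk).trans (le_of_eq ?_)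
  rw [nsmul_eq_mul, Finset.card_univ]
  ring

end IsCanonicalPair

end Abstract

section Schwartz

variable {ι : Type} [Fintype ι]

/-- Multiplication by the `i`-th coordinate on Schwartz functions. -/
noncomputable def schwartzMulCoord (i : ι) :
    SchwartzMap (EuclideanSpace ℝ ι) ℂ →ₗ[ℂ] SchwartzMap (EuclideanSpace ℝ ι) ℂ :=
  (SchwartzMap.smulLeftCLM ℂ (fun x : EuclideanSpace ℝ ι => ((x i : ℝ) : ℂ))).toLinearMap

/-- The `i`-th partial derivative on Schwartz functions. -/
noncomputable def schwartzPartial [DecidableEq ι] (i : ι) :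
    SchwartzMap (EuclideanSpace ℝ ι) ℂ →ₗ[ℂ] SchwartzMap (EuclideanSpace ℝ ι) ℂ :=
  (LineDeriv.lineDerivOpCLM ℂ (SchwartzMap (EuclideanSpace ℝ ι) ℂ)
    (EuclideanSpace.single i (1 : ℝ))).toLinearMap

/-- The inclusion of Schwartz functions in `L²`. -/
noncomputable def schwartzToL2 :
    SchwartzMap (EuclideanSpace ℝ ι) ℂ →ₗ[ℂ] Lp ℂ 2 (volume : Measure (EuclideanSpace ℝ ι)) :=
  (SchwartzMap.toLpCLM ℂ ℂ 2 volume).toLinearMap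

lemma schwartzMulCoord_apply (i : ι) (f : SchwartzMap (EuclideanSpace ℝ ι) ℂ)
    (x : EuclideanSpace ℝ ι) : schwartzMulCoord i f x = ((x i : ℝ) : ℂ) * f x := by
  have hg : (fun x : EuclideanSpace ℝ ι => ((x i : ℝ) : ℂ)).HasTemperateGrowth :=
    (Complex.ofRealCLM.comp (EuclideanSpace.proj (𝕜 := ℝ) i)).hasTemperateGrowth
  exact SchwartzMap.smulLeftCLM_apply_apply hg f x

lemma schwartzPartial_apply [DecidableEq ι] (i : ι) (f : SchwartzMap (EuclideanSpace ℝ ι) ℂ)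
    (x : EuclideanSpace ℝ ι) :
    schwartzPartial i f x = fderiv ℝ f x (EuclideanSpace.single i 1) :=
  SchwartzMap.lineDerivOp_apply_eq_fderiv _ f x

lemma inner_schwartzToL2 (f g : SchwartzMap (EuclideanSpace ℝ ι) ℂ) :
    ⟪schwartzToL2 f, schwartzToL2 g⟫_ℂ = ∫ x, g x * starRingEnd ℂ (f x) :=
  SchwartzMap.inner_toL2_toL2_eq f g

lemma norm_schwartzToL2 (f : SchwartzMap (EuclideanSpace ℝ ι) ℂ) :
    ‖schwartzToL2 f‖ = Real.sqrt (∫ x, ‖f x‖ ^ 2) := by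
  rw [← Real.sqrt_sq (norm_nonneg (schwartzToL2 f)), ← inner_self_eq_norm_sq (𝕜 := ℂ),
    inner_schwartzToL2]
  have : ∀ x, f x * starRingEnd ℂ (f x) = ((‖f x‖ ^ 2 : ℝ) : ℂ) := fun x => by
    rw [Complex.mul_conj, Complex.normSq_eq_norm_sq]
  simp_rw [this]
  rw [integral_complex_ofReal]
  simp

lemma inner_schwartzPartial [DecidableEq ι] (i : ι) (f g : SchwartzMap (EuclideanSpace ℝ ι) ℂ) :
    ⟪schwartzToL2 (schwartzPartial i f), schwartzToL2 g⟫_ℂ =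
      -⟪schwartzToL2 f, schwartzToL2 (schwartzPartial i g)⟫_ℂ := by
  have h := SchwartzMap.integral_bilinear_lineDerivOp_right_eq_neg_left (μ := volume) g f
    ((ContinuousLinearMap.mul ℝ ℂ).bilinearComp (ContinuousLinearMap.id ℝ ℂ)
      Complex.conjCLE.toContinuousLinearMap) (EuclideanSpace.single i 1)
  rw [inner_schwartzToL2, inner_schwartzToL2]
  exact h

lemma schwartzPartial_comm [DecidableEq ι] (i j : ι) (f : SchwartzMap (EuclideanSpace ℝ ι) ℂ) :
    schwartzPartial i (schwartzPartial j f) = schwartzPartial j (schwartzPartial i f) := by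
  ext x
  have hp : ∀ k, (⇑(schwartzPartial k f)) = fun y => fderiv ℝ f y (EuclideanSpace.single k 1) :=
    fun k => funext (schwartzPartial_apply k f)
  have hd : DifferentiableAt ℝ (fderiv ℝ f) x :=
    (SchwartzMap.fderivCLM ℝ (EuclideanSpace ℝ ι) ℂ f).differentiableAt
  have hs : IsSymmSndFDerivAt ℝ f x :=
    (f.contDiffAt 2).isSymmSndFDerivAt (by simp)
  rw [schwartzPartial_apply, schwartzPartial_apply, hp, hp,
    fderiv_clm_apply hd (differentiableAt_const _), fderiv_clm_apply hd (differentiableAt_const _)]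
  simpa using hs _ _

lemma schwartzPartial_mulCoord [DecidableEq ι] (i j : ι)
    (f : SchwartzMap (EuclideanSpace ℝ ι) ℂ) :
    schwartzPartial i (schwartzMulCoord j f) =
      (if i = j then f else 0) + schwartzMulCoord j (schwartzPartial i f) := by
  ext x
  have hj : HasFDerivAt (fun y : EuclideanSpace ℝ ι => ((y j : ℝ) : ℂ))
      (Complex.ofRealCLM.comp (EuclideanSpace.proj (𝕜 := ℝ) j)) x :=
    (Complex.ofRealCLM.comp (EuclideanSpace.proj (𝕜 := ℝ) j)).hasFDerivAt
  have he : (⇑(schwartzMulCoord j f)) = (fun y => ((y j : ℝ) : ℂ) * f y) :=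
    funext (schwartzMulCoord_apply j f)
  rw [schwartzPartial_apply, he, fderiv_fun_mul hj.differentiableAt f.differentiableAt, hj.fderiv]
  simp only [add_apply, schwartzMulCoord_apply, schwartzPartial_apply]
  split_ifs with h
  · subst h
    simp
    ring
  · simp [Ne.symm h]

lemma isCanonicalPair_schwartz [DecidableEq ι] :
    IsCanonicalPair (schwartzToL2 (ι := ι)) schwartzMulCoord schwartzPartial where
  inner_X i u v := by
    rw [inner_schwartzToL2, inner_schwartzToL2]
    congr 1 with x
    rw [schwartzMulCoord_apply, schwartzMulCoord_apply, map_mul, Complex.conj_ofReal]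
    ring
  inner_D := inner_schwartzPartial
  X_comm i j u := by
    ext x
    simp only [schwartzMulCoord_apply]
    ring
  D_comm := schwartzPartial_comm
  D_X_of_ne i j u hij := by simp [schwartzPartial_mulCoord, hij]
  D_X_self i u := by simp [schwartzPartial_mulCoord]

lemma sum_schwartz_oscillator_apply [DecidableEq ι] (f : SchwartzMap (EuclideanSpace ℝ ι) ℂ)
    (x : EuclideanSpace ℝ ι) :
    (∑ i, (schwartzMulCoord i (schwartzMulCoord i f) -
      schwartzPartial i (schwartzPartial i f))) x = Hosc f x := by
  have hp : ∀ i, (⇑(schwartzPartial i f)) =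
      fun y => fderiv ℝ f y (EuclideanSpace.single i 1) :=
    fun i => funext (schwartzPartial_apply i f)
  have hn : ((‖x‖ ^ 2 : ℝ) : ℂ) = ∑ i, ((x i : ℝ) : ℂ) * ((x i : ℝ) : ℂ) := by
    rw [EuclideanSpace.real_norm_sq_eq]
    push_cast
    exact Finset.sum_congr rfl fun i _ => sq _
  rw [Hosc, eLap, hn, Finset.sum_mul, ← Finset.sum_sub_distrib, sum_apply]
  refine Finset.sum_congr rfl fun i _ => ?_
  rw [sub_apply, schwartzMulCoord_apply, schwartzMulCoord_apply,
    schwartzPartial_apply, hp, mul_assoc]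

end Schwartz

/-- The generator `Σ_k t_k (1/2 - x_k ∂/∂x_k)` of the diagonal metaplectic flow is
bounded by the harmonic oscillator in `L²`:
`‖Σ t_k ((1/2) f - x_k ∂f/∂x_k)‖_{L²} ≤ C (max_k |t_k|) ‖H_g f‖_{L²}`. -/
theorem metaplectic_generator_bound (g d : ℕ) (hg : 1 ≤ g) (hd : 1 ≤ d) (hdg : d ≤ g) :
    ∃ C : ℝ, 0 < C ∧ ∀ (t : Fin d → ℝ)
      (f : SchwartzMap (EuclideanSpace ℝ (Fin g)) ℂ),
      Real.sqrt (∫ x : EuclideanSpace ℝ (Fin g),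
          ‖∑ k : Fin d, (t k : ℂ) *
            ((1 / 2 : ℂ) * f x - ((x (Fin.castLE hdg k) : ℝ) : ℂ) *
              fderiv ℝ (⇑f) x (EuclideanSpace.single (Fin.castLE hdg k) 1))‖ ^ 2) ≤
        C * (⨆ k : Fin d, |t k|) *
          Real.sqrt (∫ x : EuclideanSpace ℝ (Fin g), ‖Hosc (⇑f) x‖ ^ 2) := by
  refine ⟨2 * d, by positivity, fun t f => ?_⟩
  have h := isCanonicalPair_schwartz.norm_sum_generator_le (Fin.castLE hdg) t f
  rw [norm_schwartzToL2, norm_schwartzToL2, Fintype.card_fin] at h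
  simp_rw [sum_schwartz_oscillator_apply] at h
  simpa only [sum_apply, smul_apply,
    sub_apply, schwartzMulCoord_apply, schwartzPartial_apply, smul_eq_mul] using h
end

section
/- Let g ≥ 1 and let δ₁,…,δ_g be nonnegative reals, not all zero; for t ≥ 0 let R_t = (D_t⁻¹ 0; 0 D_t) ∈ Sp(2g,ℝ), where D_t is the diagonal matrix with entries e^{tδ₁},…,e^{tδ_g}. Then for almost every α ∈ Sp(2g,ℝ) with respect to a Haar measure on Sp(2g,ℝ): limsup_{t→∞} ( log Hgt(R_t α) / log t ) ≤ 2/(g+1). In particular, almost every α satisfies the corresponding Roth condition: for every ε > 0 there is C > 0 with Hgt(R_t α) ≤ C e^{2(δ₁+…+δ_g)εt} for all t ≥ 0. -/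
open Matrix

/-- A real `2g × 2g` matrix is symplectic if `βᵀ J β = J`. -/
def IsSymp {g : ℕ} (β : Matrix (Fin g ⊕ Fin g) (Fin g ⊕ Fin g) ℝ) : Prop :=
  βᵀ * Jmat g * β = Jmat g

/-- A real matrix has integer entries. -/
def IsIntMat {g : ℕ} (γ : Matrix (Fin g ⊕ Fin g) (Fin g ⊕ Fin g) ℝ) : Prop :=
  ∀ i j, ∃ k : ℤ, γ i j = (k : ℝ)

/-- `det Im (β⁻¹ (i I))`, the height of the point of the Siegel upper half-space
attached to a symplectic matrix `β`. -/
noncomputable def detImPoint {g : ℕ} (β : Matrix (Fin g ⊕ Fin g) (Fin g ⊕ Fin g) ℝ) : ℝ :=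
  ((moebius β⁻¹ (Complex.I • (1 : Matrix (Fin g) (Fin g) ℂ))).map Complex.im).det

/-- The height function `Hgt(β) = sup_{γ ∈ Sp(2g,ℤ)} det Im ((βγ)⁻¹(i I))` on
`Sp(2g,ℝ)`. -/
noncomputable def Hgt {g : ℕ} (β : Matrix (Fin g ⊕ Fin g) (Fin g ⊕ Fin g) ℝ) : ℝ :=
  ⨆ γ : {γ : Matrix (Fin g ⊕ Fin g) (Fin g ⊕ Fin g) ℝ // IsSymp γ ∧ IsIntMat γ},
    detImPoint (β * (γ : Matrix (Fin g ⊕ Fin g) (Fin g ⊕ Fin g) ℝ))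

/-- The symplectic matrix `α_𝔮 = (I 0; 𝔮 I)` attached to a symmetric matrix `𝔮`. -/
def alphaQ {g : ℕ} (q : Matrix (Fin g) (Fin g) ℝ) :
    Matrix (Fin g ⊕ Fin g) (Fin g ⊕ Fin g) ℝ :=
  Matrix.fromBlocks 1 0 q 1

/-- The theta sum `Σ_{n ∈ ℤ^g ∩ [0,N]^g} e(nᵀ𝔮n + ℓᵀn)` with `e(t) = exp(2πit)`. -/
noncomputable def thetaSum {g : ℕ} (q : Matrix (Fin g) (Fin g) ℝ) (l : Fin g → ℝ)
    (N : ℕ) : ℂ :=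
  ∑ n : Fin g → Fin (N + 1),
    Complex.exp (2 * (Real.pi : ℂ) * Complex.I *
      (((∑ i, ∑ j, (n i : ℝ) * q i j * (n j : ℝ)) + ∑ i, l i * (n i : ℝ) : ℝ) : ℂ))

noncomputable instance {g : ℕ} :
    MeasurableSpace (Matrix (Fin g ⊕ Fin g) (Fin g ⊕ Fin g) ℝ) := borel _

section HeightCounting

open MeasureTheory

/-- The real symplectic group of rank `g`. -/
abbrev SpG (g : ℕ) := Matrix.symplecticGroup (Fin g) ℝ

/-- Real `2g × 2g` matrices in block form. -/
abbrev BMat (g : ℕ) := Matrix (Fin g ⊕ Fin g) (Fin g ⊕ Fin g) ℝ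

instance instBorelSpaceBMat {g : ℕ} : BorelSpace (BMat g) := ⟨rfl⟩

instance instBorelSpaceSpG {g : ℕ} : BorelSpace (SpG g) := Subtype.borelSpace _

instance instSecondCountableBMat {g : ℕ} : SecondCountableTopology (BMat g) :=
  inferInstanceAs (SecondCountableTopology (Fin g ⊕ Fin g → Fin g ⊕ Fin g → ℝ))

instance instProperSpaceBMat {g : ℕ} : LocallyCompactSpace (BMat g) :=
  inferInstanceAs (LocallyCompactSpace (Fin g ⊕ Fin g → Fin g ⊕ Fin g → ℝ))

instance instSecondCountableSpG {g : ℕ} : SecondCountableTopology (SpG g) :=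
  TopologicalSpace.Subtype.secondCountableTopology _

lemma isClosed_SpG (g : ℕ) : IsClosed ((Matrix.symplecticGroup (Fin g) ℝ : Set (BMat g))) := by
  have : ((Matrix.symplecticGroup (Fin g) ℝ : Set (BMat g))) =
      {A : BMat g | A * J (Fin g) ℝ * Aᵀ = J (Fin g) ℝ} := by
    ext A; exact SymplecticGroup.mem_iff
  rw [this]
  exact isClosed_eq (by fun_prop) continuous_const

lemma isClosedEmbedding_SpG (g : ℕ) :
    Topology.IsClosedEmbedding (Subtype.val : SpG g → BMat g) :=
  (isClosed_SpG g).isClosedEmbedding_subtypeVal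

instance instLocallyCompactSpG {g : ℕ} : LocallyCompactSpace (SpG g) :=
  (isClosedEmbedding_SpG g).locallyCompactSpace

instance instTopologicalGroupSpG {g : ℕ} : IsTopologicalGroup (SpG g) where
  continuous_inv := by
    refine Continuous.subtype_mk ?_ _
    fun_prop

/-- Markov and unfolding: the set of points of `K` whose `Γ`-orbit meets `Q` at least `w` times
has measure at most `N / w` times that of `Q`, when `Γ`-orbits meet `K` at most `N` times. -/
lemma unfolding_markov {G : Type*} [Group G] [MeasurableSpace G] [MeasurableMul G]
    (ρ : Measure G) [ρ.IsMulRightInvariant] (Γ : Subgroup G) [Countable Γ]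
    (K Q : Set G) (hK : MeasurableSet K) (hQ : MeasurableSet Q) (N : ENNReal)
    (hN : ∀ x, (∑' γ : Γ, K.indicator (1 : G → ENNReal) (x * γ)) ≤ N) (w : ENNReal) :
    w * ρ (K ∩ {α | w ≤ ∑' γ : Γ, Q.indicator (1 : G → ENNReal) (α * γ)}) ≤ N * ρ Q := by
  have mK : ∀ γ : Γ, Measurable fun x : G => K.indicator (1 : G → ENNReal) (x * γ) := fun γ =>
    (measurable_one.indicator hK).comp (measurable_mul_const _)
  have mQ : ∀ γ : Γ, Measurable fun x : G => Q.indicator (1 : G → ENNReal) (x * γ) := fun γ =>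
    (measurable_one.indicator hQ).comp (measurable_mul_const _)
  have mKi : Measurable (K.indicator (1 : G → ENNReal)) := measurable_one.indicator hK
  have mQi : Measurable (Q.indicator (1 : G → ENNReal)) := measurable_one.indicator hQ
  calc w * ρ (K ∩ {α | w ≤ ∑' γ : Γ, Q.indicator (1 : G → ENNReal) (α * γ)})
      ≤ w * (ρ.restrict K) {α | w ≤ ∑' γ : Γ, Q.indicator (1 : G → ENNReal) (α * γ)} := by
        rw [Set.inter_comm]
        exact mul_le_mul_right (Measure.le_restrict_apply _ _) w
    _ ≤ ∫⁻ α in K, ∑' γ : Γ, Q.indicator (1 : G → ENNReal) (α * γ) ∂ρ :=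
        mul_meas_ge_le_lintegral (Measurable.tsum mQ) w
    _ = ∫⁻ α, ∑' γ : Γ, K.indicator (1 : G → ENNReal) α *
          Q.indicator (1 : G → ENNReal) (α * γ) ∂ρ := by
        rw [← lintegral_indicator hK]
        congr 1; ext α
        by_cases h : α ∈ K <;> simp [h]
    _ = ∑' γ : Γ, ∫⁻ α, K.indicator (1 : G → ENNReal) α *
          Q.indicator (1 : G → ENNReal) (α * γ) ∂ρ :=
        lintegral_tsum fun γ => (mKi.mul (mQ γ)).aemeasurable
    _ = ∑' γ : Γ, ∫⁻ α, K.indicator (1 : G → ENNReal) (α * (γ⁻¹ : Γ)) *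
          Q.indicator (1 : G → ENNReal) α ∂ρ := by
        congr 1; ext γ
        rw [← lintegral_mul_right_eq_self (fun α => K.indicator (1 : G → ENNReal) (α * (γ⁻¹ : Γ)) *
          Q.indicator (1 : G → ENNReal) α) (γ : G)]
        simp
    _ = ∑' γ : Γ, ∫⁻ α, K.indicator (1 : G → ENNReal) (α * γ) *
          Q.indicator (1 : G → ENNReal) α ∂ρ :=
        (Equiv.inv Γ).tsum_eq (fun γ : Γ => ∫⁻ α, K.indicator (1 : G → ENNReal) (α * γ) *
          Q.indicator (1 : G → ENNReal) α ∂ρ)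
    _ = ∫⁻ α, (∑' γ : Γ, K.indicator (1 : G → ENNReal) (α * γ)) *
          Q.indicator (1 : G → ENNReal) α ∂ρ := by
        simp_rw [← ENNReal.tsum_mul_right]
        exact (lintegral_tsum fun γ => ((mK γ).mul mQi).aemeasurable).symm
    _ ≤ ∫⁻ α, N * Q.indicator (1 : G → ENNReal) α ∂ρ := by
        gcongr with α; exact hN α
    _ = N * ρ Q := by
        rw [lintegral_const_mul _ mQi, lintegral_indicator_one hQ]

/-- The integral symplectic group. -/
def intSp (g : ℕ) : Subgroup (SpG g) where
  carrier := {γ | IsIntMat (γ : BMat g)}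
  one_mem' := fun i j => ⟨if i = j then 1 else 0, by simp [Matrix.one_apply]⟩
  mul_mem' := by
    intro a b ha hb i j
    choose f hf using ha
    choose h hh using hb
    exact ⟨∑ k, f i k * h k j, by simp [Matrix.mul_apply, hf, hh]⟩
  inv_mem' := by
    intro a ha i j
    choose f hf using ha
    have hJ : J (Fin g) ℝ = (J (Fin g) ℤ).map (Int.castRingHom ℝ) := by
      rw [Matrix.map_J]
    have hA : (a : BMat g) = (Matrix.of f).map (Int.castRingHom ℝ) := by
      ext i j; simp [hf]
    refine ⟨((-J (Fin g) ℤ) * (Matrix.of f)ᵀ * J (Fin g) ℤ) i j, ?_⟩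
    rw [SymplecticGroup.coe_inv, hA, hJ, ← Matrix.transpose_map, ← Matrix.map_neg _ (by simp),
      ← Matrix.map_mul, ← Matrix.map_mul]
    simp

lemma mem_intSp {g : ℕ} {γ : SpG g} : γ ∈ intSp g ↔ IsIntMat (γ : BMat g) := Iff.rfl

lemma isSymp_iff_mem {g : ℕ} (β : BMat g) : IsSymp β ↔ β ∈ Matrix.symplecticGroup (Fin g) ℝ := by
  have : Jmat g = - J (Fin g) ℝ := by
    simp [Jmat, J, Matrix.fromBlocks_neg]
  rw [SymplecticGroup.mem_iff', IsSymp, this]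
  simp

lemma finite_intMat_bounded (g : ℕ) (B : ℝ) :
    {A : BMat g | IsIntMat A ∧ ∀ i j, |A i j| ≤ B}.Finite := by
  have hfin : (Set.pi Set.univ fun _ : Fin g ⊕ Fin g => Set.pi Set.univ
      fun _ : Fin g ⊕ Fin g => (fun k : ℤ => (k : ℝ)) '' Set.Icc (-⌊B⌋) ⌊B⌋).Finite :=
    Set.Finite.pi fun _ => Set.Finite.pi fun _ => (Set.finite_Icc _ _).image _
  refine hfin.subset ?_
  rintro A ⟨hA, hB⟩ i - j -
  obtain ⟨k, hk⟩ := hA i j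
  refine ⟨k, ?_, hk.symm⟩
  have := hB i j
  rw [hk, abs_le] at this
  have h2 : k ≤ ⌊B⌋ := Int.le_floor.2 this.2
  have h1 : -k ≤ ⌊B⌋ := Int.le_floor.2 (by push_cast; linarith)
  exact ⟨by omega, h2⟩

instance instCountableIntSp {g : ℕ} : Countable (intSp g) := by
  have : (Set.univ : Set (intSp g)) ⊆ ⋃ n : ℕ, (fun γ : intSp g => ((γ : SpG g) : BMat g)) ⁻¹'
      {A : BMat g | IsIntMat A ∧ ∀ i j, |A i j| ≤ n} := by
    intro γ _
    obtain ⟨n, hn⟩ := exists_nat_ge (∑ i, ∑ j, |((γ : SpG g) : BMat g) i j|)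
    refine Set.mem_iUnion.2 ⟨n, γ.2, fun i j => le_trans ?_ hn⟩
    refine le_trans ?_ (Finset.single_le_sum (f := fun i => ∑ j, |((γ : SpG g) : BMat g) i j|)
      (fun i _ => Finset.sum_nonneg fun j _ => abs_nonneg _) (Finset.mem_univ i))
    exact Finset.single_le_sum (f := fun j => |((γ : SpG g) : BMat g) i j|)
      (fun j _ => abs_nonneg _) (Finset.mem_univ j)
  rw [← Set.countable_univ_iff]
  refine Set.Countable.mono this (Set.countable_iUnion fun n => ?_)
  exact ((finite_intMat_bounded g n).preimage
    ((Subtype.val_injective.comp Subtype.val_injective).injOn)).countable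

/-- Orbits of the integral symplectic group meet a compact set boundedly often. -/
lemma exists_orbit_bound {g : ℕ} {K : Set (SpG g)} (hK : IsCompact K) :
    ∃ N : ℕ, ∀ x : SpG g, (∑' γ : intSp g, K.indicator (1 : SpG g → ENNReal) (x * γ)) ≤ N := by
  have hc : IsCompact ((fun p : SpG g × SpG g => p.1⁻¹ * p.2) '' (K ×ˢ K)) :=
    (hK.prod hK).image (by fun_prop)
  have hb : ∃ B : ℝ, ∀ x ∈ K, ∀ y ∈ K, ∀ i j, |((x⁻¹ * y : SpG g) : BMat g) i j| ≤ B := by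
    have h1 : ∀ i j, ∃ B : ℝ, ∀ z ∈ ((fun p : SpG g × SpG g => p.1⁻¹ * p.2) '' (K ×ˢ K)),
        |((z : SpG g) : BMat g) i j| ≤ B := by
      intro i j
      obtain ⟨B, hB⟩ := hc.exists_bound_of_continuousOn
        (f := fun z : SpG g => ((z : SpG g) : BMat g) i j)
        ((continuous_id.matrix_elem i j).comp continuous_subtype_val).continuousOn
      exact ⟨B, by simpa using hB⟩
    choose B hB using h1
    refine ⟨∑ i, ∑ j, |B i j|, fun x hx y hy i j => ?_⟩
    refine (hB i j _ ⟨(x, y), ⟨hx, hy⟩, rfl⟩).trans ((le_abs_self _).trans ?_)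
    refine le_trans ?_ (Finset.single_le_sum (f := fun i => ∑ j, |B i j|)
      (fun i _ => Finset.sum_nonneg fun j _ => abs_nonneg _) (Finset.mem_univ i))
    exact Finset.single_le_sum (f := fun j => |B i j|)
      (fun j _ => abs_nonneg _) (Finset.mem_univ j)
  obtain ⟨B, hB⟩ := hb
  have hF : ((fun γ : intSp g => ((γ : SpG g) : BMat g)) ⁻¹'
      {A : BMat g | IsIntMat A ∧ ∀ i j, |A i j| ≤ B}).Finite :=
    (finite_intMat_bounded g B).preimage
      ((Subtype.val_injective.comp Subtype.val_injective).injOn)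
  refine ⟨hF.toFinset.card, fun x => ?_⟩
  by_cases hx : ∃ γ₀ : intSp g, x * γ₀ ∈ K
  · obtain ⟨γ₀, h0⟩ := hx
    rw [← (Equiv.mulLeft γ₀).tsum_eq]
    rw [tsum_eq_sum (s := hF.toFinset)]
    · refine (Finset.sum_le_card_nsmul _ _ 1 fun γ _ => ?_).trans (by simp)
      exact Set.indicator_le_self' (by simp) _
    · intro γ hγ
      rw [Set.indicator_of_notMem]
      intro hmem
      apply hγ
      rw [Set.Finite.mem_toFinset]
      refine ⟨γ.2, ?_⟩
      have := hB _ h0 _ hmem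
      simpa [mul_assoc] using this
  · push Not at hx
    simp [hx]

/-- An element of a locally compact group which is conjugate to its inverse acts on the right by
measure-preserving transformations of Haar measure. -/
lemma map_mul_right_of_conj_inv {G : Type*} [Group G] [TopologicalSpace G] [IsTopologicalGroup G]
    [LocallyCompactSpace G] [MeasurableSpace G] [BorelSpace G] (μ : Measure G) [μ.IsHaarMeasure]
    [μ.InnerRegular] (r c : G) (h : c * r * c⁻¹ = r⁻¹) : μ.map (· * r) = μ := by
  rw [Measure.map_right_mul_eq_modularCharacterFun_smul]
  have h1 : Measure.modularCharacter r * Measure.modularCharacter r = 1 := by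
    have h2 : Measure.modularCharacter (c * r * c⁻¹ * r) = 1 := by rw [h]; simp
    have h3 : Measure.modularCharacter c * Measure.modularCharacter c⁻¹ = 1 := by
      rw [← map_mul]; simp
    rw [map_mul, map_mul, map_mul, mul_right_comm (Measure.modularCharacter c), h3, one_mul] at h2
    exact h2
  have h4 : Measure.modularCharacter r = 1 := by
    rw [← sq] at h1
    exact (pow_eq_one_iff_of_nonneg zero_le two_ne_zero).1 h1
  have h5 : Measure.modularCharacterFun r = 1 := h4
  rw [h5, one_smul]

/-- Gram matrix of the first `g` columns. -/
noncomputable def gramP {g : ℕ} (β : BMat g) : Matrix (Fin g) (Fin g) ℝ :=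
  (β.toCols₁)ᵀ * β.toCols₁

/-- The unipotent coordinate of `β`: minus the real part of `β⁻¹ (i I)` when `β` is symplectic. -/
noncomputable def shiftX {g : ℕ} (β : BMat g) : Matrix (Fin g) (Fin g) ℝ :=
  (gramP β)⁻¹ * ((β.toCols₁)ᵀ * β.toCols₂)

lemma isUnit_det_of_mem {g : ℕ} {β : BMat g} (h : β ∈ symplecticGroup (Fin g) ℝ) :
    IsUnit β.det := SymplecticGroup.symplectic_det h

lemma toCols₁_mulVec_injective {g : ℕ} {β : BMat g} (h : β ∈ symplecticGroup (Fin g) ℝ) :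
    Function.Injective (β.toCols₁).mulVec := by
  intro x y hxy
  have h1 : ∀ z : Fin g → ℝ, β.toCols₁ *ᵥ z = β *ᵥ (Sum.elim z 0) := by
    intro z; ext i
    simp [Matrix.mulVec, dotProduct, Fintype.sum_sum_type]
  have hxy' : β *ᵥ (Sum.elim x 0) = β *ᵥ (Sum.elim y 0) := by
    rw [← h1, ← h1]; exact hxy
  have := Matrix.mulVec_injective_of_isUnit
    ((Matrix.isUnit_iff_isUnit_det β).2 (isUnit_det_of_mem h)) hxy'
  ext i
  simpa using congrFun this (Sum.inl i)

lemma gramP_posDef {g : ℕ} {β : BMat g} (h : β ∈ symplecticGroup (Fin g) ℝ) :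
    (gramP β).PosDef := by
  have := Matrix.PosDef.conjTranspose_mul_self (β.toCols₁) (toCols₁_mulVec_injective h)
  simpa only [gramP, Matrix.conjTranspose_eq_transpose_of_trivial] using this

lemma gramP_isUnit {g : ℕ} {β : BMat g} (h : β ∈ symplecticGroup (Fin g) ℝ) :
    IsUnit (gramP β).det := (gramP_posDef h).det_pos.ne'.isUnit

lemma gramP_transpose {g : ℕ} (β : BMat g) : (gramP β)ᵀ = gramP β := by
  simp [gramP]

lemma cols_relation {g : ℕ} {β : BMat g} (h : β ∈ symplecticGroup (Fin g) ℝ) :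
    β.toCols₂ * (β.toCols₁)ᵀ - β.toCols₁ * (β.toCols₂)ᵀ = J (Fin g) ℝ := by
  rw [← SymplecticGroup.mem_iff.1 h]
  conv_rhs => rw [← Matrix.fromCols_toCols β]
  rw [J, Matrix.fromCols_mul_fromBlocks, Matrix.transpose_fromCols, Matrix.fromCols_mul_fromRows]
  simp [sub_eq_add_neg]

lemma cols_isotropic {g : ℕ} {β : BMat g} (h : β ∈ symplecticGroup (Fin g) ℝ) :
    (β.toCols₁)ᵀ * (J (Fin g) ℝ * β.toCols₁) = 0 := by
  have h1 := SymplecticGroup.mem_iff'.1 h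
  have h2 := congrArg Matrix.toBlocks₁₁ h1
  have h3 : (βᵀ * J (Fin g) ℝ * β).toBlocks₁₁ =
      (β.toCols₁)ᵀ * (J (Fin g) ℝ * β.toCols₁) := by
    rw [Matrix.mul_assoc]; rfl
  rw [← h3, h2]
  simp [J]

lemma toCols₂_eq {g : ℕ} {β : BMat g} (h : β ∈ symplecticGroup (Fin g) ℝ) :
    β.toCols₂ = β.toCols₁ * shiftX β + J (Fin g) ℝ * β.toCols₁ * (gramP β)⁻¹ ∧
      (shiftX β)ᵀ = shiftX β := by
  have hP := gramP_isUnit h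
  have hXT : (shiftX β)ᵀ = (β.toCols₂)ᵀ * β.toCols₁ * (gramP β)⁻¹ := by
    rw [shiftX, Matrix.transpose_mul, Matrix.transpose_mul, Matrix.transpose_transpose,
      Matrix.transpose_nonsing_inv, gramP_transpose]
  have h1 : β.toCols₂ = β.toCols₁ * (shiftX β)ᵀ + J (Fin g) ℝ * β.toCols₁ * (gramP β)⁻¹ := by
    have h2 := congrArg (fun M => M * β.toCols₁ * (gramP β)⁻¹) (cols_relation h)
    simp only [Matrix.sub_mul] at h2
    have h3 : β.toCols₂ * (β.toCols₁)ᵀ * β.toCols₁ * (gramP β)⁻¹ = β.toCols₂ := by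
      rw [Matrix.mul_assoc β.toCols₂, ← gramP, Matrix.mul_assoc, Matrix.mul_nonsing_inv _ hP,
        Matrix.mul_one]
    rw [h3] at h2
    rw [← h2, hXT]
    simp only [Matrix.mul_assoc]
    abel
  have hsym : shiftX β = (shiftX β)ᵀ := by
    conv_lhs => rw [shiftX, h1]
    rw [Matrix.mul_add, ← Matrix.mul_assoc _ (J (Fin g) ℝ * _), cols_isotropic h,
      Matrix.zero_mul, add_zero, ← Matrix.mul_assoc β.toCols₁ᵀ]
    exact Matrix.nonsing_inv_mul_cancel_left _ _ hP
  refine ⟨?_, hsym.symm⟩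
  rw [← hsym] at h1
  exact h1

/-- The Levi element `diag (A, A⁻ᵀ)`. -/
def leviElt {g : ℕ} (A A' : Matrix (Fin g) (Fin g) ℝ) (h : A * A' = 1) : SpG g :=
  ⟨fromBlocks A 0 0 A'ᵀ, by
    rw [SymplecticGroup.fromBlocks_mem_iff]
    have : Aᵀ * A'ᵀ = 1 := by
      rw [← Matrix.transpose_mul, mul_eq_one_comm.1 h, Matrix.transpose_one]
    simp [this]⟩

/-- The unipotent element `(1 B; 0 1)`. -/
def unipElt {g : ℕ} (B : Matrix (Fin g) (Fin g) ℝ) (h : Bᵀ = B) : SpG g :=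
  ⟨fromBlocks 1 B 0 1, by
    rw [SymplecticGroup.fromBlocks_mem_iff]
    simp [h]⟩

lemma toCols₁_mul {g : ℕ} (β γ : BMat g) : (β * γ).toCols₁ = β * γ.toCols₁ := rfl

lemma toCols₁_mul_levi {g : ℕ} (β : BMat g) (A A' : Matrix (Fin g) (Fin g) ℝ) (h : A * A' = 1) :
    (β * (leviElt A A' h : BMat g)).toCols₁ = β.toCols₁ * A := by
  conv_lhs => rw [← Matrix.fromCols_toCols β]
  rw [leviElt, Matrix.fromCols_mul_fromBlocks]
  simp

lemma toCols₂_mul_levi {g : ℕ} (β : BMat g) (A A' : Matrix (Fin g) (Fin g) ℝ) (h : A * A' = 1) :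
    (β * (leviElt A A' h : BMat g)).toCols₂ = β.toCols₂ * A'ᵀ := by
  conv_lhs => rw [← Matrix.fromCols_toCols β]
  rw [leviElt, Matrix.fromCols_mul_fromBlocks]
  simp

lemma toCols₁_mul_unip {g : ℕ} (β : BMat g) (B : Matrix (Fin g) (Fin g) ℝ) (h : Bᵀ = B) :
    (β * (unipElt B h : BMat g)).toCols₁ = β.toCols₁ := by
  conv_lhs => rw [← Matrix.fromCols_toCols β]
  rw [unipElt, Matrix.fromCols_mul_fromBlocks]
  simp

lemma toCols₂_mul_unip {g : ℕ} (β : BMat g) (B : Matrix (Fin g) (Fin g) ℝ) (h : Bᵀ = B) :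
    (β * (unipElt B h : BMat g)).toCols₂ = β.toCols₁ * B + β.toCols₂ := by
  conv_lhs => rw [← Matrix.fromCols_toCols β]
  rw [unipElt, Matrix.fromCols_mul_fromBlocks]
  simp

lemma gramP_mul_levi {g : ℕ} (β : BMat g) (A A' : Matrix (Fin g) (Fin g) ℝ) (h : A * A' = 1) :
    gramP (β * (leviElt A A' h : BMat g)) = Aᵀ * gramP β * A := by
  simp only [gramP, toCols₁_mul_levi, Matrix.transpose_mul, Matrix.mul_assoc]

lemma shiftX_mul_levi {g : ℕ} (β : BMat g) (A A' : Matrix (Fin g) (Fin g) ℝ) (h : A * A' = 1) :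
    shiftX (β * (leviElt A A' h : BMat g)) = A' * shiftX β * A'ᵀ := by
  have hA : IsUnit A.det := (Matrix.isUnit_iff_isUnit_det A).1 (IsUnit.of_mul_eq_one A' h)
  have hAT : IsUnit Aᵀ.det := by rwa [Matrix.det_transpose]
  have hinv : A⁻¹ = A' := Matrix.inv_eq_right_inv h
  rw [shiftX, gramP_mul_levi, Matrix.mul_inv_rev, Matrix.mul_inv_rev, toCols₁_mul_levi,
    toCols₂_mul_levi, Matrix.transpose_mul, hinv, shiftX]
  simp only [Matrix.mul_assoc]
  rw [Matrix.nonsing_inv_mul_cancel_left _ _ hAT]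

lemma shiftX_mul_unip {g : ℕ} {β : BMat g} (hβ : β ∈ symplecticGroup (Fin g) ℝ)
    (B : Matrix (Fin g) (Fin g) ℝ) (h : Bᵀ = B) :
    shiftX (β * (unipElt B h : BMat g)) = B + shiftX β := by
  rw [shiftX, gramP, toCols₁_mul_unip, toCols₂_mul_unip, ← gramP, Matrix.mul_add, Matrix.mul_add,
    ← Matrix.mul_assoc β.toCols₁ᵀ, ← gramP, Matrix.nonsing_inv_mul_cancel_left _ _ (gramP_isUnit hβ),
    shiftX]

lemma map_ofReal_mul {m n k : Type*} [Fintype n] (A : Matrix m n ℝ) (B : Matrix n k ℝ) :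
    (A * B).map Complex.ofReal = A.map Complex.ofReal * B.map Complex.ofReal :=
  Matrix.map_mul (f := Complex.ofRealHom)

lemma detImPoint_eq {g : ℕ} {β : BMat g} (h : β ∈ symplecticGroup (Fin g) ℝ) :
    detImPoint β = (gramP β).det⁻¹ := by
  have hP := gramP_isUnit h
  have hinv : β⁻¹ = fromBlocks β.toBlocks₂₂ᵀ (-β.toBlocks₁₂ᵀ) (-β.toBlocks₂₁ᵀ) β.toBlocks₁₁ᵀ := by
    rw [SymplecticGroup.inv_eq_symplectic_inv β h]
    conv_lhs => rw [← Matrix.fromBlocks_toBlocks β]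
    rw [J, Matrix.fromBlocks_transpose, Matrix.fromBlocks_neg, Matrix.fromBlocks_multiply,
      Matrix.fromBlocks_multiply]
    simp
  have hPb : gramP β = β.toBlocks₁₁ᵀ * β.toBlocks₁₁ + β.toBlocks₂₁ᵀ * β.toBlocks₂₁ := by
    ext i j
    simp [gramP, Matrix.mul_apply, Fintype.sum_sum_type, Matrix.toBlocks₁₁, Matrix.toBlocks₂₁]
  have h' := h
  rw [← Matrix.fromBlocks_toBlocks β, SymplecticGroup.fromBlocks_mem_iff] at h'
  obtain ⟨hac, -, hadcb⟩ := h'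
  have hdabc : β.toBlocks₂₂ᵀ * β.toBlocks₁₁ - β.toBlocks₁₂ᵀ * β.toBlocks₂₁ = 1 := by
    have := congrArg Matrix.transpose hadcb
    simpa using this
  rw [detImPoint, moebius, hinv]
  simp only [Matrix.toBlocks_fromBlocks₁₁, Matrix.toBlocks_fromBlocks₁₂,
    Matrix.toBlocks_fromBlocks₂₁, Matrix.toBlocks_fromBlocks₂₂]
  generalize β.toBlocks₁₁ = a at *
  generalize β.toBlocks₁₂ = b at *
  generalize β.toBlocks₂₁ = c at *
  generalize β.toBlocks₂₂ = d at *
  have hneg : ∀ m : Matrix (Fin g) (Fin g) ℝ, (-m).map Complex.ofReal = -(m.map Complex.ofReal) := by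
    intro m; ext i j; simp
  have hadd : ∀ m n : Matrix (Fin g) (Fin g) ℝ,
      (m + n).map Complex.ofReal = m.map Complex.ofReal + n.map Complex.ofReal := by
    intro m n; ext i j; simp
  have hone : (1 : Matrix (Fin g) (Fin g) ℝ).map Complex.ofReal = 1 := by
    ext i j; simp [Matrix.one_apply, apply_ite]
  set φ : Matrix (Fin g) (Fin g) ℝ → Matrix (Fin g) (Fin g) ℂ := fun m => m.map Complex.ofReal
    with hφ
  have hmul : ∀ m n : Matrix (Fin g) (Fin g) ℝ, φ (m * n) = φ m * φ n := map_ofReal_mul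
  have hPP : φ (gramP β) * φ (gramP β)⁻¹ = 1 := by
    rw [← hmul, Matrix.mul_nonsing_inv _ hP]; exact hone
  have hfirst : (φ (-cᵀ) * (Complex.I • 1) + φ aᵀ) * (φ a + Complex.I • φ c) =
      φ (gramP β) := by
    rw [hPb]
    have e1 : φ (-cᵀ) = -φ cᵀ := hneg _
    have e2 : φ (aᵀ * a + cᵀ * c) = φ aᵀ * φ a + φ cᵀ * φ c := by
      rw [← hmul, ← hmul]; exact hadd _ _
    have e3 : φ aᵀ * φ c = φ cᵀ * φ a := by rw [← hmul, ← hmul, hac]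
    rw [e1, e2]
    simp only [Matrix.mul_smul, Matrix.mul_one, Matrix.add_mul, Matrix.mul_add, Matrix.neg_mul, smul_add,
      Matrix.smul_mul, smul_neg, e3, smul_smul, Complex.I_mul_I, neg_smul, one_smul, neg_neg]
    abel
  have hden : (φ (-cᵀ) * (Complex.I • 1) + φ aᵀ) *
      ((φ a + Complex.I • φ c) * φ (gramP β)⁻¹) = 1 := by
    rw [← Matrix.mul_assoc, hfirst, hPP]
  have hnum : (φ dᵀ * (Complex.I • 1) + φ (-bᵀ)) * (φ a + Complex.I • φ c) =
      Complex.I • 1 - φ (bᵀ * a + dᵀ * c) := by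
    have e1 : φ (-bᵀ) = -φ bᵀ := hneg _
    have e2 : φ (bᵀ * a + dᵀ * c) = φ bᵀ * φ a + φ dᵀ * φ c := by
      rw [← hmul, ← hmul]; exact hadd _ _
    have e3 : φ dᵀ * φ a - φ bᵀ * φ c = 1 := by
      rw [← hmul, ← hmul, ← hone, ← hdabc]
      ext i j; simp [hφ]
    rw [e1, e2, Matrix.mul_smul, Matrix.mul_one, ← e3]
    simp only [Matrix.add_mul, Matrix.mul_add, Matrix.neg_mul, Matrix.mul_smul, smul_add,
      Matrix.smul_mul, smul_neg, smul_smul, Complex.I_mul_I, neg_smul, one_smul, smul_sub]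
    abel
  change (((φ dᵀ * (Complex.I • 1) + φ (-bᵀ)) *
    (φ (-cᵀ) * (Complex.I • 1) + φ aᵀ)⁻¹).map Complex.im).det = _
  rw [Matrix.inv_eq_right_inv hden, ← Matrix.mul_assoc, hnum, Matrix.sub_mul, Matrix.smul_mul,
    Matrix.one_mul, ← hmul]
  have : (Complex.I • φ (gramP β)⁻¹ - φ ((bᵀ * a + dᵀ * c) * (gramP β)⁻¹)).map Complex.im =
      (gramP β)⁻¹ := by
    ext i j
    simp [hφ]
  rw [this, Matrix.det_nonsing_inv, Ring.inverse_eq_inv']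

lemma continuousOn_matrix_inv {X n : Type*} [TopologicalSpace X] [Fintype n] [DecidableEq n]
    {f : X → Matrix n n ℝ} {s : Set X} (hf : ContinuousOn f s) (h : ∀ x ∈ s, (f x).det ≠ 0) :
    ContinuousOn (fun x => (f x)⁻¹) s := by
  simp only [Matrix.inv_def, Ring.inverse_eq_inv']
  rw [continuousOn_iff_continuous_domRestrict] at hf ⊢
  have h1 : Continuous fun x : s => (f x).det := Continuous.matrix_det hf
  have h2 : Continuous fun x : s => (f x).adjugate := Continuous.matrix_adjugate hf
  exact (h1.inv₀ fun x => h x x.2).smul h2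

lemma continuous_toCols₁ {g : ℕ} : Continuous fun y : SpG g => (y : BMat g).toCols₁ :=
  continuous_pi fun i => continuous_pi fun j =>
    (continuous_id.matrix_elem i (Sum.inl j)).comp continuous_subtype_val

lemma continuous_toCols₂ {g : ℕ} : Continuous fun y : SpG g => (y : BMat g).toCols₂ :=
  continuous_pi fun i => continuous_pi fun j =>
    (continuous_id.matrix_elem i (Sum.inr j)).comp continuous_subtype_val

lemma continuous_gramP {g : ℕ} : Continuous fun y : SpG g => gramP (y : BMat g) :=
  continuous_toCols₁.matrix_transpose.matrix_mul continuous_toCols₁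

lemma continuous_shiftX {g : ℕ} : Continuous fun y : SpG g => shiftX (y : BMat g) := by
  have h1 : Continuous fun y : SpG g => (gramP (y : BMat g))⁻¹ := by
    rw [← continuousOn_univ]
    exact continuousOn_matrix_inv continuous_gramP.continuousOn
      fun y _ => (gramP_isUnit y.2).ne_zero
  exact h1.matrix_mul (continuous_toCols₁.matrix_transpose.matrix_mul continuous_toCols₂)

/-- Elements whose first `g` columns lie in `W` and whose unipotent coordinate is bounded
entrywise by `r`. -/
def boxSet {g : ℕ} (W : Set (Matrix (Fin g ⊕ Fin g) (Fin g) ℝ)) (r : Fin g → Fin g → ℝ) :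
    Set (SpG g) :=
  {y | (y : BMat g).toCols₁ ∈ W ∧ ∀ i j, |shiftX (y : BMat g) i j| ≤ r i j}

lemma isCompact_matrix_box {m n : Type*} (r : m → n → ℝ) :
    IsCompact {X : Matrix m n ℝ | ∀ i j, |X i j| ≤ r i j} := by
  have : IsCompact (Set.pi Set.univ fun i : m => Set.pi Set.univ fun j : n =>
      Set.Icc (-(r i j)) (r i j)) :=
    isCompact_univ_pi fun i => isCompact_univ_pi fun j => isCompact_Icc
  have h : {X : Matrix m n ℝ | ∀ i j, |X i j| ≤ r i j} = Set.pi Set.univ fun i : m =>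
      Set.pi Set.univ fun j : n => Set.Icc (-(r i j)) (r i j) := by
    ext X
    simp only [Set.mem_ofPred_eq, abs_le]
    exact ⟨fun h i _ j _ => h i j, fun h i j => h i trivial j trivial⟩
  rw [h]
  exact this

lemma boxSet_subset_compact {g : ℕ} {W : Set (Matrix (Fin g ⊕ Fin g) (Fin g) ℝ)}
    (hW : IsCompact W) (hdet : ∀ w ∈ W, (wᵀ * w).det ≠ 0) (r : Fin g → Fin g → ℝ) :
    ∃ K : Set (SpG g), IsCompact K ∧ boxSet W r ⊆ K := by
  let F : Matrix (Fin g ⊕ Fin g) (Fin g) ℝ × Matrix (Fin g) (Fin g) ℝ → BMat g := fun p =>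
    Matrix.fromCols p.1 (p.1 * p.2 + J (Fin g) ℝ * p.1 * (p.1ᵀ * p.1)⁻¹)
  have hc : ContinuousOn F (W ×ˢ {X | ∀ i j, |X i j| ≤ r i j}) := by
    have h1 : ContinuousOn (fun p : Matrix (Fin g ⊕ Fin g) (Fin g) ℝ × Matrix (Fin g) (Fin g) ℝ =>
        (p.1ᵀ * p.1)⁻¹) (W ×ˢ {X | ∀ i j, |X i j| ≤ r i j}) :=
      continuousOn_matrix_inv (by fun_prop) fun p hp => hdet _ hp.1
    have h2 : ContinuousOn (fun p : Matrix (Fin g ⊕ Fin g) (Fin g) ℝ × Matrix (Fin g) (Fin g) ℝ =>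
        p.1 * p.2 + J (Fin g) ℝ * p.1 * (p.1ᵀ * p.1)⁻¹) (W ×ˢ {X | ∀ i j, |X i j| ≤ r i j}) := by
      rw [continuousOn_iff_continuous_domRestrict] at h1 ⊢
      have a1 : Continuous fun p : (W ×ˢ {X : Matrix (Fin g) (Fin g) ℝ | ∀ i j, |X i j| ≤ r i j} :
        Set (Matrix (Fin g ⊕ Fin g) (Fin g) ℝ × Matrix (Fin g) (Fin g) ℝ)) => p.1.1 := by fun_prop
      have a2 : Continuous fun p : (W ×ˢ {X : Matrix (Fin g) (Fin g) ℝ | ∀ i j, |X i j| ≤ r i j} :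
        Set (Matrix (Fin g ⊕ Fin g) (Fin g) ℝ × Matrix (Fin g) (Fin g) ℝ)) => p.1.2 := by fun_prop
      exact (a1.matrix_mul a2).add ((continuous_const.matrix_mul a1).matrix_mul h1)
    refine continuousOn_pi.2 fun i => continuousOn_pi.2 fun j => ?_
    rcases j with j | j
    · simp only [F, Matrix.fromCols_apply_inl]
      fun_prop
    · simp only [F, Matrix.fromCols_apply_inr]
      exact continuousOn_pi.1 (continuousOn_pi.1 h2 i) j
  refine ⟨Subtype.val ⁻¹' (F '' (W ×ˢ {X | ∀ i j, |X i j| ≤ r i j})),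
    (isClosedEmbedding_SpG g).isCompact_preimage
      ((hW.prod (isCompact_matrix_box r)).image_of_continuousOn hc), ?_⟩
  intro y hy
  refine ⟨((y : BMat g).toCols₁, shiftX (y : BMat g)), ⟨hy.1, hy.2⟩, ?_⟩
  have := (toCols₂_eq y.2).1
  simp only [F]
  rw [← gramP, ← this]
  exact Matrix.fromCols_toCols _

lemma measurableSet_boxSet {g : ℕ} {W : Set (Matrix (Fin g ⊕ Fin g) (Fin g) ℝ)}
    (hW : IsCompact W) (r : Fin g → Fin g → ℝ) : MeasurableSet (boxSet W r) := by
  have h1 : IsClosed W := hW.isClosed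
  refine ((h1.preimage continuous_toCols₁).inter
    (((isCompact_matrix_box r).isClosed).preimage continuous_shiftX)).measurableSet

/-- Two boxes in a translation coordinate have measures proportional to their volumes. -/
lemma measure_mul_measure_of_equivariant {G E : Type*} [Group G] [MeasurableSpace G]
    [MeasurableMul G] (ρ : Measure G) [ρ.IsMulRightInvariant] [SFinite ρ]
    [AddCommGroup E] [MeasurableSpace E] [MeasurableAdd₂ E] [MeasurableNeg E] (ν : Measure E)
    [ν.IsAddLeftInvariant] [ν.IsNegInvariant] [SFinite ν]
    (x : G → E) (hx : Measurable x) (u : E → G) (hu : ∀ y Y, x (y * u Y) = Y + x y)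
    (S : Set G) (hS : MeasurableSet S) (huS : ∀ y Y, y * u Y ∈ S ↔ y ∈ S) (A B : Set E)
    (hA : MeasurableSet A) (hB : MeasurableSet B) :
    ν B * ρ (S ∩ x ⁻¹' A) = ν A * ρ (S ∩ x ⁻¹' B) := by
  have key : ∀ A B : Set E, MeasurableSet A → MeasurableSet B →
      ∫⁻ Y, ∫⁻ y, (S ∩ x ⁻¹' A).indicator (1 : G → ENNReal) y *
        B.indicator (1 : E → ENNReal) (Y + x y) ∂ρ ∂ν = ν B * ρ (S ∩ x ⁻¹' A) := by
    intro A B hA hB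
    rw [lintegral_lintegral_swap]
    · have : ∀ y, ∫⁻ Y, (S ∩ x ⁻¹' A).indicator (1 : G → ENNReal) y *
          B.indicator (1 : E → ENNReal) (Y + x y) ∂ν =
          ν B * (S ∩ x ⁻¹' A).indicator (1 : G → ENNReal) y := by
        intro y
        have hm : Measurable fun Y => B.indicator (1 : E → ENNReal) (Y + x y) :=
          (measurable_one.indicator hB).comp (measurable_add_const _)
        rw [lintegral_const_mul _ hm,
          lintegral_add_right_eq_self (fun Y => B.indicator (1 : E → ENNReal) Y),
          lintegral_indicator_one hB, mul_comm]
      simp_rw [this]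
      rw [lintegral_const_mul _ (measurable_one.indicator (hS.inter (hx hA))),
        lintegral_indicator_one (hS.inter (hx hA))]
    · refine Measurable.aemeasurable (Measurable.mul ?_ ?_)
      · exact (measurable_one.indicator (hS.inter (hx hA))).comp measurable_snd
      · exact (measurable_one.indicator hB).comp (measurable_fst.add (hx.comp measurable_snd))
  rw [← key A B hA hB, ← key B A hB hA,
    ← lintegral_neg_eq_self (fun Y => ∫⁻ y, (S ∩ x ⁻¹' B).indicator (1 : G → ENNReal) y *
        A.indicator (1 : E → ENNReal) (Y + x y) ∂ρ)]
  refine lintegral_congr fun Y => ?_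
  rw [← lintegral_mul_right_eq_self (fun y => (S ∩ x ⁻¹' B).indicator (1 : G → ENNReal) y *
        A.indicator (1 : E → ENNReal) (-Y + x y)) (u Y)]
  refine lintegral_congr fun y => ?_
  by_cases h1 : y ∈ S <;> by_cases h2 : x y ∈ A <;> by_cases h3 : Y + x y ∈ B <;>
    simp [hu, huS, h1, h2, h3, Set.indicator]

/-- The index set of the coordinates of symmetric matrices. -/
abbrev SymIdx (g : ℕ) := {p : Fin g × Fin g // p.1 ≤ p.2}

/-- The symmetric matrix with given upper triangular part. -/
def symMat {g : ℕ} (Y : SymIdx g → ℝ) : Matrix (Fin g) (Fin g) ℝ :=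
  Matrix.of fun i j => Y ⟨(min i j, max i j), min_le_max⟩

lemma symMat_transpose {g : ℕ} (Y : SymIdx g → ℝ) : (symMat Y)ᵀ = symMat Y := by
  ext i j
  simp [symMat, min_comm, max_comm]

lemma measure_boxSet {g : ℕ} (ρ : Measure (SpG g)) [ρ.IsMulRightInvariant] [SFinite ρ]
    {W : Set (Matrix (Fin g ⊕ Fin g) (Fin g) ℝ)} (hW : IsCompact W)
    (s : Fin g → ℝ) (hs : ∀ i, 0 < s i) :
    ρ (boxSet W fun i j => s i * s j) =
      ENNReal.ofReal (∏ p : SymIdx g, (s p.1.1 * s p.1.2)) * ρ (boxSet W fun _ _ => 1) := by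
  let x : SpG g → (SymIdx g → ℝ) := fun y p => shiftX (y : BMat g) p.1.1 p.1.2
  have hxc : Continuous x := continuous_pi fun p => continuous_shiftX.matrix_elem _ _
  let S : Set (SpG g) := {y | (y : BMat g).toCols₁ ∈ W}
  have hS : MeasurableSet S := (hW.isClosed.preimage continuous_toCols₁).measurableSet
  let box : (Fin g → Fin g → ℝ) → Set (SymIdx g → ℝ) := fun r =>
    Set.pi Set.univ fun p => Set.Icc (-(r p.1.1 p.1.2)) (r p.1.1 p.1.2)
  have hbox : ∀ r : Fin g → Fin g → ℝ, (∀ i j, r i j = r j i) →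
      boxSet W r = S ∩ x ⁻¹' box r := by
    intro r hr
    ext y
    constructor
    · rintro ⟨h1, h2⟩
      exact ⟨h1, fun p _ => abs_le.1 (h2 _ _)⟩
    · rintro ⟨h1, h2⟩
      refine ⟨h1, fun i j => ?_⟩
      rcases le_total i j with hij | hij
      · exact abs_le.2 (h2 ⟨(i, j), hij⟩ trivial)
      · rw [hr, ← (toCols₂_eq y.2).2]
        exact abs_le.2 (h2 ⟨(j, i), hij⟩ trivial)
  have hvol : ∀ r : Fin g → Fin g → ℝ, (∀ i j, 0 ≤ r i j) → volume (box r) =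
      ENNReal.ofReal (2 ^ Fintype.card (SymIdx g) * ∏ p : SymIdx g, r p.1.1 p.1.2) := by
    intro r hr
    rw [volume_pi_pi]
    simp only [Real.volume_Icc]
    rw [← ENNReal.ofReal_prod_of_nonneg (fun p _ => by linarith [hr p.1.1 p.1.2])]
    congr 1
    rw [← Finset.card_univ, ← Finset.prod_const, ← Finset.prod_mul_distrib]
    exact Finset.prod_congr rfl fun p _ => by ring
  have hmeas : ∀ r, MeasurableSet (box r) := fun r =>
    MeasurableSet.univ_pi fun p => measurableSet_Icc
  have key := measure_mul_measure_of_equivariant ρ (volume : Measure (SymIdx g → ℝ)) x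
    hxc.measurable (fun Y => unipElt (symMat Y) (symMat_transpose Y))
    (by
      intro y Y
      ext p
      simp only [x, Submonoid.coe_mul, shiftX_mul_unip y.2, Pi.add_apply, Matrix.add_apply]
      simp [symMat, min_eq_left p.2, max_eq_right p.2])
    S hS (by
      intro y Y
      simp only [S, Set.mem_ofPred_eq, Submonoid.coe_mul, toCols₁_mul_unip])
    (box fun i j => s i * s j) (box fun _ _ => 1)
    (hmeas fun i j => s i * s j) (hmeas fun _ _ => 1)
  rw [← hbox (fun i j => s i * s j) (fun _ _ => mul_comm _ _),
    ← hbox (fun _ _ => 1) (fun _ _ => rfl), hvol _ (fun _ _ => zero_le_one),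
    hvol _ (fun i j => (mul_pos (hs i) (hs j)).le), Finset.prod_const_one, mul_one,
    ENNReal.ofReal_mul (by positivity), mul_assoc] at key
  refine (ENNReal.mul_right_inj ?_ ENNReal.ofReal_ne_top).1 key
  simp

/-- Elements whose first `g` columns, rescaled by `s⁻¹`, lie in `W`, with bounded unipotent
coordinate. -/
def cuspSet {g : ℕ} (W : Set (Matrix (Fin g ⊕ Fin g) (Fin g) ℝ)) (s : Fin g → ℝ) :
    Set (SpG g) :=
  {y | (y : BMat g).toCols₁ * diagonal (fun i => (s i)⁻¹) ∈ W ∧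
    ∀ i j, |shiftX (y : BMat g) i j| ≤ 1}

lemma cuspSet_eq {g : ℕ} (W : Set (Matrix (Fin g ⊕ Fin g) (Fin g) ℝ)) (s : Fin g → ℝ)
    (hs : ∀ i, 0 < s i) :
    ∃ a : SpG g, cuspSet W s = (fun y => y * a) ⁻¹' boxSet W fun i j => s i * s j := by
  have hinv : diagonal (fun i => (s i)⁻¹) * diagonal s = 1 := by
    rw [Matrix.diagonal_mul_diagonal, ← Matrix.diagonal_one]
    congr 1; ext i
    exact inv_mul_cancel₀ (hs i).ne'
  refine ⟨leviElt _ _ hinv, ?_⟩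
  ext y
  simp only [cuspSet, boxSet, Set.mem_ofPred_eq, Set.mem_preimage, Submonoid.coe_mul,
    toCols₁_mul_levi, shiftX_mul_levi, Matrix.diagonal_transpose, Matrix.mul_diagonal,
    Matrix.diagonal_mul]
  refine and_congr_right fun _ => forall_congr' fun i => forall_congr' fun j => ?_
  rw [abs_mul, abs_mul, abs_of_pos (hs i), abs_of_pos (hs j), mul_right_comm]
  exact (mul_le_iff_le_one_right (mul_pos (hs i) (hs j))).symm

lemma measurableSet_cuspSet {g : ℕ} {W : Set (Matrix (Fin g ⊕ Fin g) (Fin g) ℝ)}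
    (hW : IsCompact W) (s : Fin g → ℝ) (hs : ∀ i, 0 < s i) : MeasurableSet (cuspSet W s) := by
  obtain ⟨a, ha⟩ := cuspSet_eq W s hs
  rw [ha]
  exact measurable_mul_const a (measurableSet_boxSet hW _)

lemma measure_cuspSet_le {g : ℕ} (ρ : Measure (SpG g)) [ρ.IsMulRightInvariant] [SFinite ρ]
    [IsFiniteMeasureOnCompacts ρ] {W : Set (Matrix (Fin g ⊕ Fin g) (Fin g) ℝ)} (hW : IsCompact W)
    (hdet : ∀ w ∈ W, (wᵀ * w).det ≠ 0) :
    ∃ C : ℝ, 0 ≤ C ∧ ∀ s : Fin g → ℝ, (∀ i, 0 < s i) →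
      ρ (cuspSet W s) ≤ ENNReal.ofReal (C * ∏ p : SymIdx g, (s p.1.1 * s p.1.2)) := by
  obtain ⟨K, hK, hsub⟩ := boxSet_subset_compact hW hdet (fun _ _ => 1)
  have hfin : ρ (boxSet W fun _ _ => 1) ≠ ⊤ :=
    ((measure_mono hsub).trans_lt hK.measure_lt_top).ne
  refine ⟨(ρ (boxSet W fun _ _ => 1)).toReal, ENNReal.toReal_nonneg, fun s hs => ?_⟩
  obtain ⟨a, ha⟩ := cuspSet_eq W s hs
  rw [ha, measure_preimage_mul_right, measure_boxSet ρ hW s hs,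
    ENNReal.ofReal_mul ENNReal.toReal_nonneg, ENNReal.ofReal_toReal hfin, mul_comm]

/-- The diagonal flow as a curve in the symplectic group. -/
noncomputable def flowElt {g : ℕ} (δ : Fin g → ℝ) (t : ℝ) : SpG g :=
  leviElt (diagonal fun i => Real.exp (-(t * δ i))) (diagonal fun i => Real.exp (t * δ i)) (by
    rw [Matrix.diagonal_mul_diagonal, ← Matrix.diagonal_one]
    congr 1; ext i
    rw [← Real.exp_add]; simp)

lemma coe_flowElt {g : ℕ} (δ : Fin g → ℝ) (t : ℝ) : (flowElt δ t : BMat g) = Rmat g δ t := by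
  simp [flowElt, leviElt, Rmat]

lemma flowElt_add {g : ℕ} (δ : Fin g → ℝ) (s t : ℝ) :
    flowElt δ (s + t) = flowElt δ s * flowElt δ t := by
  apply Subtype.ext
  rw [Submonoid.coe_mul, coe_flowElt, coe_flowElt, coe_flowElt, Rmat, Rmat, Rmat,
    Matrix.fromBlocks_multiply]
  simp only [Matrix.diagonal_mul_diagonal, Matrix.mul_zero, Matrix.zero_mul, add_zero, zero_add,
    ← Real.exp_add]
  congr 2 <;> ext i <;> congr 1 <;> ring

lemma flowElt_zero {g : ℕ} (δ : Fin g → ℝ) : flowElt δ 0 = 1 := by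
  have := flowElt_add δ 0 0
  rw [add_zero] at this
  exact (mul_eq_left.1 this.symm)

lemma flowElt_neg_mul {g : ℕ} (δ : Fin g → ℝ) (t : ℝ) : flowElt δ (-t) * flowElt δ t = 1 := by
  rw [← flowElt_add, neg_add_cancel, flowElt_zero]

lemma continuous_flowElt {g : ℕ} (δ : Fin g → ℝ) :
    Continuous fun t => (flowElt δ t : BMat g) := by
  simp only [coe_flowElt, Rmat]
  refine Continuous.matrix_fromBlocks (Continuous.matrix_diagonal ?_) continuous_const
    continuous_const (Continuous.matrix_diagonal ?_) <;> fun_prop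

lemma det_gram_ne_zero_iff {m n : Type*} [Fintype m] [Fintype n] [DecidableEq n]
    (W : Matrix m n ℝ) : (Wᵀ * W).det ≠ 0 ↔ Function.Injective W.mulVec := by
  constructor
  · intro h x y hxy
    have h1 : (Wᵀ * W) *ᵥ x = (Wᵀ * W) *ᵥ y := by
      rw [← Matrix.mulVec_mulVec, ← Matrix.mulVec_mulVec]
      exact congrArg _ hxy
    exact Matrix.mulVec_injective_of_isUnit ((Matrix.isUnit_iff_isUnit_det _).2 h.isUnit) h1
  · intro h
    have := Matrix.PosDef.conjTranspose_mul_self W h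
    rw [Matrix.conjTranspose_eq_transpose_of_trivial] at this
    exact this.det_pos.ne'

/-- Matrices which become bounded and uniformly nondegenerate after flowing for some time in
`[0, 1]`. -/
def goodCols {g : ℕ} (δ : Fin g → ℝ) (B c : ℝ) : Set (Matrix (Fin g ⊕ Fin g) (Fin g) ℝ) :=
  {W | ∃ t ∈ Set.Icc (0 : ℝ) 1, (∀ i j, |((flowElt δ t : BMat g) * W) i j| ≤ B) ∧
    c ≤ (((flowElt δ t : BMat g) * W)ᵀ * ((flowElt δ t : BMat g) * W)).det}

lemma isCompact_goodCols {g : ℕ} (δ : Fin g → ℝ) (B c : ℝ) : IsCompact (goodCols δ B c) := by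
  have h0 : IsCompact {W : Matrix (Fin g ⊕ Fin g) (Fin g) ℝ |
      (∀ i j, |W i j| ≤ B) ∧ c ≤ (Wᵀ * W).det} := by
    refine (isCompact_matrix_box fun _ _ => B).inter_right
      (t := {W : Matrix (Fin g ⊕ Fin g) (Fin g) ℝ | c ≤ (Wᵀ * W).det}) ?_
    exact isClosed_le continuous_const (by fun_prop)
  have h1 := (isCompact_Icc (a := (0 : ℝ)) (b := 1)).prod h0
  have hc : Continuous fun p : ℝ × Matrix (Fin g ⊕ Fin g) (Fin g) ℝ =>
      (flowElt δ (-p.1) : BMat g) * p.2 :=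
    ((continuous_flowElt δ).comp continuous_fst.neg).matrix_mul continuous_snd
  have h2 := h1.image hc
  have key : ∀ t, (flowElt δ (-t) : BMat g) * (flowElt δ t : BMat g) = 1 := fun t => by
    rw [← Submonoid.coe_mul, flowElt_neg_mul]; rfl
  have key' : ∀ t, (flowElt δ t : BMat g) * (flowElt δ (-t) : BMat g) = 1 := fun t => by
    have := key (-t); rwa [neg_neg] at this
  have : goodCols δ B c = (fun p : ℝ × Matrix (Fin g ⊕ Fin g) (Fin g) ℝ =>
      (flowElt δ (-p.1) : BMat g) * p.2) '' (Set.Icc (0 : ℝ) 1 ×ˢ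
        {W | (∀ i j, |W i j| ≤ B) ∧ c ≤ (Wᵀ * W).det}) := by
    ext W
    constructor
    · rintro ⟨t, ht, hW⟩
      refine ⟨(t, (flowElt δ t : BMat g) * W), ⟨ht, hW⟩, ?_⟩
      simp only [← Matrix.mul_assoc, key, Matrix.one_mul]
    · rintro ⟨⟨t, W'⟩, ⟨ht, hW⟩, rfl⟩
      refine ⟨t, ht, ?_⟩
      simp only [← Matrix.mul_assoc, key', Matrix.one_mul]
      exact hW
  rw [this]
  exact h2

lemma det_goodCols {g : ℕ} {δ : Fin g → ℝ} {B c : ℝ} (hc : 0 < c)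
    (W : Matrix (Fin g ⊕ Fin g) (Fin g) ℝ) (hW : W ∈ goodCols δ B c) : (Wᵀ * W).det ≠ 0 := by
  obtain ⟨t, -, -, h⟩ := hW
  have h1 := (det_gram_ne_zero_iff _).1 (hc.trans_le h).ne'
  refine (det_gram_ne_zero_iff _).2 fun x y hxy => h1 ?_
  rw [← Matrix.mulVec_mulVec, ← Matrix.mulVec_mulVec]
  exact congrArg _ hxy

/-- Upper triangular matrices with unit diagonal. -/
def IsUnitri {R : Type*} [Zero R] [One R] {n : ℕ} (V : Matrix (Fin n) (Fin n) R) : Prop :=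
  (∀ i j, j < i → V i j = 0) ∧ ∀ i, V i i = 1

lemma IsUnitri.det {R : Type*} [CommRing R] {n : ℕ} {V : Matrix (Fin n) (Fin n) R}
    (h : IsUnitri V) : V.det = 1 := by
  rw [Matrix.det_of_isUpperTriangular (fun i j hij => h.1 i j hij)]
  exact Finset.prod_eq_one fun i _ => h.2 i

/-- Bounds on the Gram matrix of a reduced basis after an integral change of basis adapted to its
shape. -/
lemma gram_bounds {n : ℕ} {M : ℝ} (hM : 1 ≤ M) {s d : Fin n → ℝ} (hs : ∀ i, 0 < s i)
    (h1 : ∀ i, d i ≤ M * s i ^ 2) (h2 : ∀ i, s i ^ 2 ≤ M * d i)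
    (h3 : ∀ i j, i ≤ j → d i ≤ M * d j) {U V : Matrix (Fin n) (Fin n) ℝ} (hU : IsUnitri U)
    (hU1 : ∀ i j, |U i j| ≤ 1) (hV : IsUnitri V) (hVs : ∀ i j, |V i j| ≤ s j / s i) :
    (∀ j, ((V * diagonal fun i => (s i)⁻¹)ᵀ * (Uᵀ * diagonal d * U) *
      (V * diagonal fun i => (s i)⁻¹)) j j ≤ n ^ 3 * M ^ 5) ∧
    (M ^ n)⁻¹ ≤ ((V * diagonal fun i => (s i)⁻¹)ᵀ * (Uᵀ * diagonal d * U) *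
      (V * diagonal fun i => (s i)⁻¹)).det := by
  have hM0 : 0 < M := by linarith
  constructor
  · intro j
    have e : (V * diagonal fun i => (s i)⁻¹)ᵀ * (Uᵀ * diagonal d * U) *
        (V * diagonal fun i => (s i)⁻¹) =
        ((U * V) * diagonal fun i => (s i)⁻¹)ᵀ * (diagonal d *
          ((U * V) * diagonal fun i => (s i)⁻¹)) := by
      simp only [Matrix.transpose_mul, Matrix.mul_assoc]
    have hs_le : ∀ k l, k ≤ l → s k ≤ M ^ 2 * s l := by
      intro k l hkl
      have a1 : s k ^ 2 ≤ (M ^ 2 * s l) ^ 2 := by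
        calc s k ^ 2 ≤ M * d k := h2 k
          _ ≤ M * (M * d l) := by gcongr; exact h3 k l hkl
          _ ≤ M * (M * (M * s l ^ 2)) := by gcongr; exact h1 l
          _ ≤ M * (M * (M * s l ^ 2)) * M := le_mul_of_one_le_right (by positivity) hM
          _ = (M ^ 2 * s l) ^ 2 := by ring
      exact (pow_le_pow_iff_left₀ (hs k).le (by have := hs l; positivity) two_ne_zero).1 a1
    have hUV : ∀ k, |(U * V) k j| ≤ n * (M ^ 2 * (s j / s k)) := by
      intro k
      rw [Matrix.mul_apply]
      refine (Finset.abs_sum_le_sum_abs _ _).trans ?_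
      refine (Finset.sum_le_card_nsmul _ _ (M ^ 2 * (s j / s k)) fun l _ => ?_).trans (by simp)
      rw [abs_mul]
      rcases lt_or_ge l k with hlk | hkl
      · have := hs j; have := hs k
        rw [hU.1 k l hlk]; simp; positivity
      · calc |U k l| * |V l j| ≤ 1 * (s j / s l) :=
              mul_le_mul (hU1 _ _) (hVs _ _) (abs_nonneg _) zero_le_one
          _ ≤ M ^ 2 * (s j / s k) := by
            rw [one_mul, ← mul_div_assoc, div_le_div_iff₀ (hs l) (hs k)]
            have := mul_le_mul_of_nonneg_left (hs_le k l hkl) (hs j).le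
            linarith
    rw [e, Matrix.mul_apply]
    have hterm : ∀ k ∈ Finset.univ, ((U * V) * diagonal fun i => (s i)⁻¹)ᵀ j k *
        (diagonal d * ((U * V) * diagonal fun i => (s i)⁻¹)) k j ≤ n ^ 2 * M ^ 5 := by
      intro k _
      rw [Matrix.transpose_apply, Matrix.diagonal_mul, Matrix.mul_diagonal]
      have hk := hs k; have hj := hs j
      have a1 : ((U * V) k j) ^ 2 ≤ (n * (M ^ 2 * (s j / s k))) ^ 2 := by
        rw [← sq_abs]; exact pow_le_pow_left₀ (abs_nonneg _) (hUV k) 2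
      calc (U * V) k j * (s j)⁻¹ * (d k * ((U * V) k j * (s j)⁻¹))
          = d k * ((U * V) k j) ^ 2 * ((s j)⁻¹) ^ 2 := by ring
        _ ≤ (M * s k ^ 2) * (n * (M ^ 2 * (s j / s k))) ^ 2 * ((s j)⁻¹) ^ 2 := by
            gcongr
            exact h1 k
        _ = n ^ 2 * M ^ 5 := by field_simp
    refine (Finset.sum_le_card_nsmul _ _ _ hterm).trans (le_of_eq ?_)
    simp; ring
  · simp only [Matrix.det_mul, Matrix.det_transpose, hU.det, hV.det, Matrix.det_diagonal,
      one_mul, mul_one]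
    rw [← Finset.prod_mul_distrib, ← Finset.prod_mul_distrib]
    have : (M ^ n)⁻¹ = ∏ _i : Fin n, M⁻¹ := by simp
    rw [this]
    refine Finset.prod_le_prod (fun i _ => by positivity) fun i _ => ?_
    have hi := hs i
    have e : (s i)⁻¹ * d i * (s i)⁻¹ = d i / s i ^ 2 := by field_simp
    rw [e, inv_eq_one_div, div_le_div_iff₀ hM0 (by positivity)]
    linarith [h2 i]

/-- Integral unitriangular matrices whose entries are bounded by ratios of the scales `s`. -/
noncomputable def unitriBox {n : ℕ} (s : Fin n → ℝ) : Finset (Fin n → Fin n → ℤ) :=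
  Fintype.piFinset fun i => Fintype.piFinset fun j =>
    if i < j then Finset.Icc (-⌊s j / s i⌋) ⌊s j / s i⌋ else {if i = j then 1 else 0}

lemma mem_unitriBox {n : ℕ} {s : Fin n → ℝ} (hs : ∀ i, 0 < s i) {V : Fin n → Fin n → ℤ}
    (hV : V ∈ unitriBox s) :
    IsUnitri (Matrix.of V) ∧ ∀ i j, |(V i j : ℝ)| ≤ s j / s i := by
  simp only [unitriBox, Fintype.mem_piFinset] at hV
  refine ⟨⟨fun i j hij => ?_, fun i => ?_⟩, fun i j => ?_⟩
  · simpa [hij.not_gt, hij.ne'] using hV i j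
  · simpa using hV i i
  · have h := hV i j
    have hp : 0 < s j / s i := div_pos (hs j) (hs i)
    split_ifs at h with h1 h2
    · rw [Finset.mem_Icc] at h
      have a2 : (V i j : ℝ) ≤ s j / s i := Int.le_floor.1 h.2
      have a1 : ((-V i j : ℤ) : ℝ) ≤ s j / s i := Int.le_floor.1 (by omega)
      rw [abs_le]
      push_cast at a1
      exact ⟨by linarith, a2⟩
    · subst h2
      simp only [Finset.mem_singleton] at h
      rw [h]; simp [div_self (hs i).ne']
    · simp only [Finset.mem_singleton] at h
      rw [h]; simpa using hp.le

lemma le_card_unitriBox {n : ℕ} {s : Fin n → ℝ} (hs : ∀ i, 0 < s i) :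
    (∏ i, ∏ j, if i < j then s j / s i else 1) ≤ (unitriBox s).card := by
  simp only [unitriBox, Fintype.card_piFinset]
  push_cast
  refine Finset.prod_le_prod (fun i _ => Finset.prod_nonneg fun j _ => ?_) fun i _ =>
    Finset.prod_le_prod (fun j _ => ?_) fun j _ => ?_
  · split_ifs
    exacts [(div_pos (hs j) (hs i)).le, zero_le_one]
  · split_ifs
    exacts [(div_pos (hs j) (hs i)).le, zero_le_one]
  · have hp : 0 < s j / s i := div_pos (hs j) (hs i)
    split_ifs
    · have h0 : 0 ≤ ⌊s j / s i⌋ := Int.floor_nonneg.2 hp.le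
      have h1 : s j / s i < ⌊s j / s i⌋ + 1 := Int.lt_floor_add_one _
      have h2 : ((Finset.Icc (-⌊s j / s i⌋) ⌊s j / s i⌋).card : ℤ) = 2 * ⌊s j / s i⌋ + 1 := by
        rw [Int.card_Icc, Int.toNat_of_nonneg (by omega)]; ring
      have h3 : ((Finset.Icc (-⌊s j / s i⌋) ⌊s j / s i⌋).card : ℝ) = 2 * ⌊s j / s i⌋ + 1 := by
        exact_mod_cast h2
      have h0' : (0 : ℝ) ≤ ⌊s j / s i⌋ := by exact_mod_cast h0
      rw [h3]; linarith
    · rw [Finset.card_singleton]; simp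
    · rw [Finset.card_singleton]; simp

lemma unitri_int_inverse {n : ℕ} {V : Matrix (Fin n) (Fin n) ℤ} (hV : IsUnit V.det) :
    V.map (Int.cast : ℤ → ℝ) * (V⁻¹).map (Int.cast : ℤ → ℝ) = 1 := by
  have h := Matrix.mul_nonsing_inv V hV
  have h2 : (V * V⁻¹).map (Int.castRingHom ℝ) = 1 := by rw [h]; simp
  rw [Matrix.map_mul] at h2
  exact h2

/-- The Levi element of an integral unimodular matrix. -/
noncomputable def intLevi {g : ℕ} (V : Matrix (Fin g) (Fin g) ℤ) (hV : IsUnit V.det) : SpG g :=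
  leviElt _ _ (unitri_int_inverse hV)

lemma intLevi_mem {g : ℕ} (V : Matrix (Fin g) (Fin g) ℤ) (hV : IsUnit V.det) :
    intLevi V hV ∈ intSp g := by
  rw [mem_intSp]
  rintro (i | i) (j | j)
  · exact ⟨V i j, by simp [intLevi, leviElt]⟩
  · exact ⟨0, by simp [intLevi, leviElt]⟩
  · exact ⟨0, by simp [intLevi, leviElt]⟩
  · exact ⟨V⁻¹ j i, by simp [intLevi, leviElt]⟩

/-- Any symplectic matrix can be brought to bounded unipotent coordinate by an integral unipotent
translation. -/
lemma exists_int_unip {g : ℕ} {β : BMat g} (hβ : β ∈ symplecticGroup (Fin g) ℝ) :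
    ∃ (B : Matrix (Fin g) (Fin g) ℝ) (hB : Bᵀ = B), unipElt B hB ∈ intSp g ∧
      ∀ i j, |shiftX (β * (unipElt B hB : BMat g)) i j| ≤ 1 := by
  have hX := (toCols₂_eq hβ).2
  refine ⟨Matrix.of fun i j => -(round (shiftX β i j) : ℝ), ?_, ?_, ?_⟩
  · ext i j
    simp only [Matrix.transpose_apply, Matrix.of_apply]
    rw [← congrFun (congrFun hX i) j, Matrix.transpose_apply]
  · rw [mem_intSp]
    rintro (i | i) (j | j)
    · exact ⟨if i = j then 1 else 0, by simp [unipElt, Matrix.one_apply]⟩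
    · exact ⟨-round (shiftX β i j), by simp [unipElt]⟩
    · exact ⟨0, by simp [unipElt]⟩
    · exact ⟨if i = j then 1 else 0, by simp [unipElt, Matrix.one_apply]⟩
  · intro i j
    rw [shiftX_mul_unip hβ, Matrix.add_apply, Matrix.of_apply, neg_add_eq_sub]
    exact (abs_sub_round _).trans (by norm_num)

/-- `HasShape δ h M s α`: after flowing for time at most one from `h α`, some integral translate
has a reduced Gram matrix whose diagonal part is comparable to `s ^ 2`. -/
def HasShape {g : ℕ} (δ : Fin g → ℝ) (h : SpG g) (M : ℝ) (s : Fin g → ℝ) (α : SpG g) : Prop :=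
  ∃ γ ∈ intSp g, ∃ t ∈ Set.Icc (0 : ℝ) 1, ∃ (U : Matrix (Fin g) (Fin g) ℝ) (d : Fin g → ℝ),
    IsUnitri U ∧ (∀ i j, |U i j| ≤ 1) ∧
    gramP ((flowElt δ t * (h * (α * γ)) : SpG g) : BMat g) = Uᵀ * diagonal d * U ∧
    (∀ i, d i ≤ M * s i ^ 2) ∧ (∀ i, s i ^ 2 ≤ M * d i) ∧ ∀ i j, i ≤ j → d i ≤ M * d j

lemma card_unitriBox_le_tsum {g : ℕ} {δ : Fin g → ℝ} {h : SpG g} {M : ℝ} (hM : 1 ≤ M)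
    {s : Fin g → ℝ} (hs : ∀ i, 0 < s i) {α : SpG g} (hα : HasShape δ h M s α) :
    ((unitriBox s).card : ENNReal) ≤ ∑' γ : intSp g,
      ((fun y => h * y) ⁻¹' cuspSet (goodCols δ (g ^ 3 * M ^ 5 + 1) (M ^ g)⁻¹) s).indicator
        (1 : SpG g → ENNReal) (α * γ) := by
  obtain ⟨γ, hγ, t, ht, U, d, hU, hU1, hgram, h1, h2, h3⟩ := hα
  have hdet : ∀ V : unitriBox s, IsUnit (Matrix.of (V : Fin g → Fin g → ℤ)).det := fun V => by
    rw [(mem_unitriBox hs V.2).1.det]; exact isUnit_one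
  choose B hB hBint hBX using fun V : unitriBox s =>
    exists_int_unip (h * (α * γ) * intLevi _ (hdet V) : SpG g).2
  let f : unitriBox s → intSp g := fun V =>
    ⟨γ * (intLevi _ (hdet V) * unipElt (B V) (hB V)),
      mul_mem hγ (mul_mem (intLevi_mem _ _) (hBint V))⟩
  have hf : Function.Injective f := by
    intro V V' hVV
    have e1 : intLevi _ (hdet V) * unipElt (B V) (hB V) =
        intLevi _ (hdet V') * unipElt (B V') (hB V') :=
      mul_left_cancel (congrArg Subtype.val hVV)
    have e2 := congrArg (fun y : SpG g => (y : BMat g).toBlocks₁₁) e1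
    simp only [Submonoid.coe_mul, intLevi, leviElt, unipElt, Matrix.fromBlocks_multiply,
      Matrix.toBlocks_fromBlocks₁₁, Matrix.mul_one, Matrix.zero_mul, add_zero,
      Matrix.mul_zero] at e2
    apply Subtype.ext
    ext i j
    simpa using congrFun (congrFun e2 i) j
  refine le_trans ?_ (ENNReal.tsum_comp_le_tsum_of_injective hf _)
  have hmem : ∀ V : unitriBox s, α * (f V : SpG g) ∈ (fun y => h * y) ⁻¹'
      cuspSet (goodCols δ (g ^ 3 * M ^ 5 + 1) (M ^ g)⁻¹) s := by
    intro V
    have hy : h * (α * (f V : SpG g)) =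
        (h * (α * γ)) * intLevi _ (hdet V) * unipElt (B V) (hB V) := by
      simp only [f, mul_assoc]
    rw [Set.mem_preimage, hy]
    refine ⟨?_, hBX V⟩
    rw [Submonoid.coe_mul, toCols₁_mul_unip, Submonoid.coe_mul, intLevi, toCols₁_mul_levi]
    refine ⟨t, ht, ?_⟩
    set V' : Matrix (Fin g) (Fin g) ℝ :=
      (Matrix.of (V : Fin g → Fin g → ℤ)).map (Int.cast : ℤ → ℝ) with hV'
    have hVu := mem_unitriBox hs V.2
    have hV'u : IsUnitri V' := by
      refine ⟨fun i j hij => ?_, fun i => ?_⟩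
      · have := hVu.1.1 i j hij
        rw [hV', Matrix.map_apply, this, Int.cast_zero]
      · have := hVu.1.2 i
        rw [hV', Matrix.map_apply, this, Int.cast_one]
    obtain ⟨b1, b2⟩ := gram_bounds hM hs h1 h2 h3 hU hU1 hV'u (by simpa [hV'] using hVu.2)
    set W := (flowElt δ t : BMat g) * (((h * (α * γ) : SpG g) : BMat g).toCols₁ * V' *
      diagonal fun i => (s i)⁻¹) with hW
    have hWg : Wᵀ * W = (V' * diagonal fun i => (s i)⁻¹)ᵀ * (Uᵀ * diagonal d * U) *
        (V' * diagonal fun i => (s i)⁻¹) := by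
      rw [← hgram, gramP, Submonoid.coe_mul, toCols₁_mul, hW]
      simp only [Matrix.transpose_mul, Matrix.mul_assoc]
    rw [← hWg] at b1 b2
    refine ⟨fun i j => ?_, b2⟩
    have c1 : W i j ^ 2 ≤ (Wᵀ * W) j j := by
      rw [Matrix.mul_apply]
      refine le_trans (le_of_eq ?_) (Finset.single_le_sum (f := fun i => Wᵀ j i * W i j)
        (fun i _ => by rw [Matrix.transpose_apply]; exact mul_self_nonneg _) (Finset.mem_univ i))
      rw [Matrix.transpose_apply, sq]
    have c2 := c1.trans (b1 j)
    have c3 : (0 : ℝ) ≤ g ^ 3 * M ^ 5 := by positivity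
    refine abs_le_of_sq_le_sq (by nlinarith) (by linarith)
  simp only [Set.indicator_of_mem (hmem _), Pi.one_apply]
  simp

/-- The measure of the set of points with a given shape. -/
lemma measure_hasShape_le {g : ℕ} (δ : Fin g → ℝ) (ρ : Measure (SpG g)) [ρ.IsMulRightInvariant]
    [SFinite ρ] [IsFiniteMeasureOnCompacts ρ] {K : Set (SpG g)} (hK : IsCompact K)
    {M : ℝ} (hM : 1 ≤ M) :
    ∃ C : ℝ, 0 ≤ C ∧ ∀ h : SpG g, (∀ A, MeasurableSet A → ρ ((fun y => h * y) ⁻¹' A) = ρ A) →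
      ∀ s : Fin g → ℝ, (∀ i, 0 < s i) →
      ρ (K ∩ {α | HasShape δ h M s α}) ≤
        ENNReal.ofReal (C * (∏ p : SymIdx g, (s p.1.1 * s p.1.2)) /
          ∏ i, ∏ j, if i < j then s j / s i else 1) := by
  obtain ⟨N, hN⟩ := exists_orbit_bound hK
  have hW := isCompact_goodCols δ (g ^ 3 * M ^ 5 + 1) (M ^ g)⁻¹
  obtain ⟨C, hC0, hC⟩ := measure_cuspSet_le ρ hW
    (det_goodCols (by positivity : (0 : ℝ) < (M ^ g)⁻¹))
  refine ⟨N * C, by positivity, fun h hh s hs => ?_⟩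
  have hmQ := measurableSet_cuspSet hW s hs
  have key := unfolding_markov ρ (intSp g) K
    ((fun y => h * y) ⁻¹' cuspSet (goodCols δ (g ^ 3 * M ^ 5 + 1) (M ^ g)⁻¹) s)
    hK.measurableSet (measurable_const_mul h hmQ) N hN (unitriBox s).card
  rw [hh _ hmQ] at key
  set D : ℝ := ∏ i, ∏ j, if i < j then s j / s i else 1 with hD
  have hD0 : 0 < D := Finset.prod_pos fun i _ => Finset.prod_pos fun j _ => by
    split_ifs
    exacts [div_pos (hs j) (hs i), one_pos]
  have hDc : ENNReal.ofReal D ≤ (unitriBox s).card := by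
    rw [← ENNReal.ofReal_natCast]
    exact ENNReal.ofReal_le_ofReal (le_card_unitriBox hs)
  rw [ENNReal.ofReal_div_of_pos hD0]
  rw [ENNReal.le_div_iff_mul_le (Or.inl (by simpa using hD0)) (Or.inl ENNReal.ofReal_ne_top)]
  rw [mul_comm]
  calc ENNReal.ofReal D * ρ (K ∩ {α | HasShape δ h M s α})
      ≤ (unitriBox s).card * ρ (K ∩ {α | ((unitriBox s).card : ENNReal) ≤ ∑' γ : intSp g,
        ((fun y => h * y) ⁻¹' cuspSet (goodCols δ (g ^ 3 * M ^ 5 + 1) (M ^ g)⁻¹) s).indicator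
        (1 : SpG g → ENNReal) (α * γ)}) := by
        exact mul_le_mul' hDc (measure_mono (Set.inter_subset_inter_right _
          fun α hα => card_unitriBox_le_tsum hM hs hα))
    _ ≤ _ := key
    _ ≤ _ := by
        rw [mul_assoc (N : ℝ), ENNReal.ofReal_mul (by positivity), ENNReal.ofReal_natCast]
        gcongr
        exact hC s hs

/-- A square matrix bordered by a first row and a first column. -/
def bordered {R : Type*} {n : ℕ} (a : R) (r c : Fin n → R) (A : Matrix (Fin n) (Fin n) R) :
    Matrix (Fin (n + 1)) (Fin (n + 1)) R :=
  Matrix.of (Fin.cons (Fin.cons a r) fun i => Fin.cons (c i) (A i))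

section bordered

variable {R : Type*} {n : ℕ} (a : R) (r c : Fin n → R) (A : Matrix (Fin n) (Fin n) R)

@[simp] lemma bordered_zero_zero : bordered a r c A 0 0 = a := rfl

@[simp] lemma bordered_zero_succ (j : Fin n) : bordered a r c A 0 j.succ = r j := rfl

@[simp] lemma bordered_succ_zero (i : Fin n) : bordered a r c A i.succ 0 = c i := rfl

@[simp] lemma bordered_succ_succ (i j : Fin n) : bordered a r c A i.succ j.succ = A i j := rfl

lemma ext_bordered {M N : Matrix (Fin (n + 1)) (Fin (n + 1)) R} (h0 : M 0 0 = N 0 0)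
    (h1 : ∀ j : Fin n, M 0 j.succ = N 0 j.succ) (h2 : ∀ i : Fin n, M i.succ 0 = N i.succ 0)
    (h3 : ∀ i j : Fin n, M i.succ j.succ = N i.succ j.succ) : M = N := by
  ext i j
  refine Fin.cases ?_ (fun i => ?_) i <;> refine Fin.cases ?_ (fun j => ?_) j
  exacts [h0, h1 _, h2 _, h3 _ _]

end bordered

lemma bordered_mul_upper {R : Type*} [CommRing R] {n : ℕ} (u z : Fin n → R)
    (A B : Matrix (Fin n) (Fin n) R) :
    bordered 1 u 0 A * bordered 1 z 0 B = bordered 1 (z + u ᵥ* B) 0 (A * B) := by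
  apply ext_bordered <;> intros <;>
    simp [Matrix.mul_apply, Fin.sum_univ_succ, Matrix.vecMul, dotProduct]

lemma bordered_congr {R : Type*} [CommRing R] {n : ℕ} (p : R) (w : Fin n → R)
    (A S : Matrix (Fin n) (Fin n) R) :
    (bordered 1 w 0 A)ᵀ * bordered p 0 0 S * bordered 1 w 0 A =
      bordered p (p • w) (p • w) (p • vecMulVec w w + Aᵀ * S * A) := by
  apply ext_bordered <;> intros <;>
    simp [Matrix.mul_apply, Fin.sum_univ_succ, Matrix.vecMulVec_apply]
  all_goals ring

lemma det_bordered_upper {R : Type*} [CommRing R] {n : ℕ} (z : Fin n → R)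
    (A : Matrix (Fin n) (Fin n) R) : (bordered 1 z 0 A).det = A.det := by
  rw [Matrix.det_succ_column_zero, Fin.sum_univ_succ]
  have : (bordered 1 z 0 A).submatrix Fin.succ Fin.succ = A := by
    ext i j; simp
  simp [this]

lemma bordered_one {R : Type*} [CommRing R] {n : ℕ} :
    bordered (1 : R) 0 0 (1 : Matrix (Fin n) (Fin n) R) = 1 := by
  apply ext_bordered <;> intros <;> simp [Matrix.one_apply, Fin.succ_ne_zero, eq_comm]

/-- Positive definite forms are bounded below on nonzero integral vectors. -/
lemma exists_pos_le_form {n : ℕ} {P : Matrix (Fin n) (Fin n) ℝ} (hP : P.PosDef) :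
    ∃ c : ℝ, 0 < c ∧ ∀ v : Fin n → ℤ, v ≠ 0 →
      c ≤ (fun i => (v i : ℝ)) ⬝ᵥ (P *ᵥ fun i => (v i : ℝ)) := by
  have hpos : ∀ x : Fin n → ℝ, x ≠ 0 → 0 < x ⬝ᵥ (P *ᵥ x) := by
    intro x hx
    simpa using hP.dotProduct_mulVec_pos hx
  have hcont : Continuous fun x : Fin n → ℝ => x ⬝ᵥ (P *ᵥ x) := by fun_prop
  by_cases hne : (Metric.sphere (0 : Fin n → ℝ) 1).Nonempty
  · obtain ⟨x, hx, hmin⟩ := (isCompact_sphere (0 : Fin n → ℝ) 1).exists_isMinOn hne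
      hcont.continuousOn
    have hx0 : x ≠ 0 := by
      rintro rfl; simp at hx
    refine ⟨_, hpos x hx0, fun v hv => ?_⟩
    set y : Fin n → ℝ := fun i => (v i : ℝ) with hy
    obtain ⟨i, hi⟩ : ∃ i, v i ≠ 0 := by
      by_contra! h; exact hv (funext h)
    have hyi : 1 ≤ ‖y‖ := by
      refine le_trans ?_ (norm_le_pi_norm y i)
      rw [hy, Real.norm_eq_abs, ← Int.cast_abs]
      exact_mod_cast Int.one_le_abs hi
    have hy0 : 0 < ‖y‖ := by linarith
    have hmem : ‖y‖⁻¹ • y ∈ Metric.sphere (0 : Fin n → ℝ) 1 := by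
      rw [mem_sphere_zero_iff_norm, norm_smul, norm_inv, norm_norm, inv_mul_cancel₀ hy0.ne']
    have h1 : x ⬝ᵥ (P *ᵥ x) ≤ (‖y‖⁻¹ • y) ⬝ᵥ (P *ᵥ (‖y‖⁻¹ • y)) := hmin hmem
    rw [Matrix.mulVec_smul, dotProduct_smul, smul_dotProduct, smul_eq_mul, smul_eq_mul,
      ← mul_assoc] at h1
    have h2 : 0 < y ⬝ᵥ (P *ᵥ y) := hpos y (norm_pos_iff.1 hy0)
    refine h1.trans (mul_le_of_le_one_left h2.le ?_)
    have := inv_le_one_of_one_le₀ hyi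
    nlinarith [inv_pos.2 hy0]
  · refine ⟨1, one_pos, fun v hv => (hne ?_).elim⟩
    obtain ⟨i, hi⟩ : ∃ i, v i ≠ 0 := by
      by_contra! h; exact hv (funext h)
    have : Nonempty (Fin n) := ⟨i⟩
    exact NormedSpace.sphere_nonempty.2 zero_le_one

/-- Hermite reduction of positive definite forms. -/
lemma exists_hermite_reduction (n : ℕ) : ∀ P : Matrix (Fin n) (Fin n) ℝ, P.PosDef →
    ∃ (V : Matrix (Fin n) (Fin n) ℤ) (U : Matrix (Fin n) (Fin n) ℝ) (d : Fin n → ℝ),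
      IsUnit V.det ∧ IsUnitri U ∧ (∀ i j, |U i j| ≤ 1) ∧ (∀ i, 0 < d i) ∧
      (V.map (Int.cast : ℤ → ℝ))ᵀ * P * V.map (Int.cast : ℤ → ℝ) = Uᵀ * diagonal d * U ∧
      ∀ i j : Fin n, (i : ℕ) + 1 = j → d i ≤ 2 * d j := by
  induction n with
  | zero =>
    intro P _
    exact ⟨1, 1, 0, by simp, ⟨fun i => i.elim0, fun i => i.elim0⟩, fun i => i.elim0,
      fun i => i.elim0, Subsingleton.elim _ _, fun i => i.elim0⟩
  | succ n ih =>
    intro P hP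
    let q : Matrix (Fin (n + 1)) (Fin (n + 1)) ℤ → ℝ := fun V =>
      ((V.map (Int.cast : ℤ → ℝ))ᵀ * P * V.map (Int.cast : ℤ → ℝ)) 0 0
    obtain ⟨c, hc, hcP⟩ := exists_pos_le_form hP
    have hq : ∀ V : Matrix (Fin (n + 1)) (Fin (n + 1)) ℤ, IsUnit V.det → c ≤ q V := by
      intro V hV
      have h0 : (fun i => V i 0) ≠ 0 := by
        intro h
        apply hV.ne_zero
        exact Matrix.det_eq_zero_of_column_eq_zero 0 (fun i => congrFun h i)
      refine (hcP _ h0).trans (le_of_eq ?_)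
      simp only [q]
      rw [Matrix.mul_assoc]
      rfl
    let S : Set ℝ := q '' {V | IsUnit V.det}
    have hSne : S.Nonempty := ⟨q 1, 1, by simp, rfl⟩
    have hSc : c ≤ sInf S := le_csInf hSne (by rintro _ ⟨V, hV, rfl⟩; exact hq V hV)
    have hSb : BddBelow S := ⟨c, by rintro _ ⟨V, hV, rfl⟩; exact hq V hV⟩
    obtain ⟨_, ⟨V₀, hV₀, rfl⟩, hlt⟩ := exists_lt_of_csInf_lt hSne
      (show sInf S < 6 / 5 * sInf S by linarith)
    have hmin : ∀ V : Matrix (Fin (n + 1)) (Fin (n + 1)) ℤ, IsUnit V.det → q V₀ ≤ 6 / 5 * q V := by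
      intro V hV
      have := csInf_le hSb ⟨V, hV, rfl⟩
      linarith
    set Q := (V₀.map (Int.cast : ℤ → ℝ))ᵀ * P * V₀.map (Int.cast : ℤ → ℝ) with hQ
    have hV₀R : IsUnit (V₀.map (Int.cast : ℤ → ℝ)) := IsUnit.of_mul_eq_one _ (unitri_int_inverse hV₀)
    have hQpos : Q.PosDef := by
      have := hP.conjTranspose_mul_mul_same (Matrix.mulVec_injective_of_isUnit hV₀R)
      rwa [Matrix.conjTranspose_eq_transpose_of_trivial] at this
    have hQs : ∀ i j, Q i j = Q j i := fun i j => by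
      have := congrFun (congrFun hQpos.1 i) j
      simpa using this.symm
    have hp : 0 < Q 0 0 := hc.trans_le (hq V₀ hV₀)
    set p := Q 0 0 with hpdef
    let u : Fin n → ℝ := fun j => Q 0 j.succ / p
    let T : Matrix (Fin n) (Fin n) ℝ := Matrix.of fun i j => Q i.succ j.succ - p * (u i * u j)
    have hQ' : Q = (bordered 1 u 0 1)ᵀ * bordered p 0 0 T * bordered 1 u 0 1 := by
      rw [bordered_congr]
      apply ext_bordered
      · simp [hpdef]
      · intro j; simp [u]; field_simp
      · intro j; simp [u]; rw [hQs]; field_simp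
      · intro i j; simp [T, Matrix.vecMulVec_apply]
    have hTpos : T.PosDef := by
      have e1 : bordered 1 u 0 1 * bordered 1 (-u) 0 1 = (1 : Matrix _ _ ℝ) := by
        rw [bordered_mul_upper]; simp [bordered_one]
      have e2 : (bordered 1 (-u) 0 1)ᵀ * Q * bordered 1 (-u) 0 1 = bordered p 0 0 T := by
        rw [hQ']
        calc _ = (bordered 1 u 0 1 * bordered 1 (-u) 0 1)ᵀ * bordered p 0 0 T *
              (bordered 1 u 0 1 * bordered 1 (-u) 0 1) := by
              simp only [Matrix.transpose_mul, Matrix.mul_assoc]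
          _ = _ := by rw [e1]; simp
      have e3 : (bordered p 0 0 T).PosDef := by
        rw [← e2]
        have := hQpos.conjTranspose_mul_mul_same (B := bordered 1 (-u) 0 1)
          (Matrix.mulVec_injective_of_isUnit (IsUnit.of_mul_eq_one _ (mul_eq_one_comm.1 e1)))
        rwa [Matrix.conjTranspose_eq_transpose_of_trivial] at this
      have e4 : T = (bordered p 0 0 T).submatrix Fin.succ Fin.succ := by ext i j; simp
      rw [e4]
      exact e3.submatrix (Fin.succ_injective n)
    obtain ⟨V', U', d', hV', hU', hU'1, hd', hred, hd'2⟩ := ih T hTpos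
    let z : Fin n → ℤ := fun j => -round ((u ᵥ* V'.map (Int.cast : ℤ → ℝ)) j)
    let w : Fin n → ℝ := (fun j => (z j : ℝ)) + u ᵥ* V'.map (Int.cast : ℤ → ℝ)
    have hw : ∀ j, |w j| ≤ 1 / 2 := by
      intro j
      have : w j = (u ᵥ* V'.map (Int.cast : ℤ → ℝ)) j -
          round ((u ᵥ* V'.map (Int.cast : ℤ → ℝ)) j) := by
        simp [w, z]; ring
      rw [this]
      exact abs_sub_round _
    have hmap : (V₀ * bordered 1 z 0 V').map (Int.cast : ℤ → ℝ) =
        V₀.map (Int.cast : ℤ → ℝ) *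
          bordered 1 (fun j => (z j : ℝ)) 0 (V'.map (Int.cast : ℤ → ℝ)) := by
      have h1 : (bordered 1 z 0 V').map (Int.cast : ℤ → ℝ) =
          bordered 1 (fun j => (z j : ℝ)) 0 (V'.map (Int.cast : ℤ → ℝ)) := by
        apply ext_bordered <;> intros <;> simp
      rw [← h1]
      exact Matrix.map_mul (f := Int.castRingHom ℝ)
    have hVdet : IsUnit (V₀ * bordered 1 z 0 V').det := by
      rw [Matrix.det_mul, det_bordered_upper]
      exact hV₀.mul hV'
    have hgram : ((V₀ * bordered 1 z 0 V').map (Int.cast : ℤ → ℝ))ᵀ * P *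
        (V₀ * bordered 1 z 0 V').map (Int.cast : ℤ → ℝ) =
        bordered p (p • w) (p • w) (p • vecMulVec w w + U'ᵀ * diagonal d' * U') := by
      rw [hmap, ← hred, ← bordered_congr]
      have e1 : bordered 1 u 0 1 * bordered 1 (fun j => (z j : ℝ)) 0 (V'.map (Int.cast : ℤ → ℝ)) =
          bordered 1 w 0 (V'.map (Int.cast : ℤ → ℝ)) := by
        rw [bordered_mul_upper, Matrix.one_mul]
      calc _ = (bordered 1 (fun j => (z j : ℝ)) 0 (V'.map (Int.cast : ℤ → ℝ)))ᵀ * Q *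
            bordered 1 (fun j => (z j : ℝ)) 0 (V'.map (Int.cast : ℤ → ℝ)) := by
            rw [hQ]; simp only [Matrix.transpose_mul, Matrix.mul_assoc]
        _ = _ := by
            rw [hQ', ← e1]; simp only [Matrix.transpose_mul, Matrix.mul_assoc]
    refine ⟨V₀ * bordered 1 z 0 V', bordered 1 w 0 U', Fin.cons p d', hVdet, ⟨?_, ?_⟩, ?_, ?_, ?_,
      ?_⟩
    · intro i j
      refine Fin.cases ?_ (fun i => ?_) i <;> refine Fin.cases ?_ (fun j => ?_) j
      · simp
      · simp
      · simp
      · simpa using hU'.1 i j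
    · intro i
      refine Fin.cases ?_ (fun i => ?_) i
      · simp
      · simpa using hU'.2 i
    · intro i j
      refine Fin.cases ?_ (fun i => ?_) i <;> refine Fin.cases ?_ (fun j => ?_) j
      · simp
      · simpa using (hw j).trans (by norm_num)
      · simp
      · simpa using hU'1 i j
    · intro i
      refine Fin.cases ?_ (fun i => ?_) i
      · simpa using hp
      · simpa using hd' i
    · have : diagonal (Fin.cons p d' : Fin (n + 1) → ℝ) = bordered p 0 0 (diagonal d') := by
        apply ext_bordered <;> intros <;> simp [Matrix.diagonal_apply, Fin.succ_ne_zero, eq_comm]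
      rw [hgram, this, bordered_congr]
    · intro i j
      refine Fin.cases ?_ (fun i => ?_) i <;> refine Fin.cases ?_ (fun j => ?_) j
      · simp
      · intro hj
        have hj0 : (j : ℕ) = 0 := by simpa using hj.symm
        have hsw := hmin ((V₀ * bordered 1 z 0 V').submatrix id (Equiv.swap 0 j.succ)) (by
          rw [Matrix.det_permute']
          exact (Units.isUnit _).map (Int.castRingHom ℤ) |>.mul hVdet)
        have e1 : q ((V₀ * bordered 1 z 0 V').submatrix id (Equiv.swap 0 j.succ)) =
            (((V₀ * bordered 1 z 0 V').map (Int.cast : ℤ → ℝ))ᵀ * P *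
              (V₀ * bordered 1 z 0 V').map (Int.cast : ℤ → ℝ)) j.succ j.succ := by
          have : j.succ = Equiv.swap 0 j.succ 0 := by simp
          conv_rhs => rw [this]
          rfl
        have e2 : (U'ᵀ * diagonal d' * U') j j = d' j := by
          rw [Matrix.mul_apply, Finset.sum_eq_single j]
          · simp [hU'.2 j]
          · intro k _ hk
            have : j < k := by
              rw [Fin.lt_def]
              have : (k : ℕ) ≠ j := fun h => hk (Fin.ext h)
              omega
            rw [hU'.1 k j this, mul_zero]
          · simp
        rw [e1, hgram, bordered_succ_succ, Matrix.add_apply, e2, Matrix.smul_apply,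
          Matrix.vecMulVec_apply, smul_eq_mul] at hsw
        have e3 : w j * w j ≤ 1 / 4 := by
          have := abs_le.1 (hw j)
          nlinarith
        have e4 : p * (w j * w j) ≤ p * (1 / 4) := mul_le_mul_of_nonneg_left e3 hp.le
        have e5 : q V₀ = p := rfl
        have := hd' j
        simp only [Fin.cons_zero, Fin.cons_succ]
        linarith
      · simp
      · intro hij
        simpa using hd'2 i j (by simpa using hij)

lemma sum_symIdx {g : ℕ} (k : Fin g → ℝ) :
    ∑ p : SymIdx g, (k p.1.1 + k p.1.2) = ((g : ℝ) + 1) * ∑ i, k i := by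
  have h1 : ∑ p : SymIdx g, (k p.1.1 + k p.1.2) =
      ∑ i, ∑ j, if i ≤ j then k i + k j else 0 := by
    rw [← Fintype.sum_prod_type' (f := fun i j => if i ≤ j then k i + k j else 0),
      ← Finset.sum_filter, Finset.sum_subtype (p := fun p : Fin g × Fin g => p.1 ≤ p.2)]
    simp
  have h2 : ∑ p : SymIdx g, (k p.1.1 + k p.1.2) =
      ∑ i, ∑ j, if j ≤ i then k i + k j else 0 := by
    rw [h1, Finset.sum_comm]
    simp only [add_comm]
  have h3 : ∑ i, ∑ j, ((if i ≤ j then k i + k j else 0) + if j ≤ i then k i + k j else 0) =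
      ∑ i, ∑ j, ((k i + k j) + if i = j then k i + k j else 0) := by
    refine Finset.sum_congr rfl fun i _ => Finset.sum_congr rfl fun j _ => ?_
    rcases lt_trichotomy i j with h | h | h
    · simp [h.le, h.ne, h.not_ge]
    · simp [h]
    · simp [h.le, h.ne', h.not_ge]
  simp only [Finset.sum_add_distrib, ← h1, ← h2, Finset.sum_ite_eq, Finset.mem_univ, if_true,
    Finset.sum_const, Finset.card_univ, Fintype.card_fin, nsmul_eq_mul, ← Finset.mul_sum] at h3
  rw [Finset.sum_add_distrib]
  linarith

lemma le_sum_sub {g : ℕ} (i₀ : Fin g) (h₀ : ∀ j, i₀ ≤ j) (k : Fin g → ℝ)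
    (hk : ∀ i j, i ≤ j → k i ≤ k j + g) :
    ∑ j, (k j - k i₀) - (g : ℝ) ^ 3 ≤ ∑ i, ∑ j, if i < j then k j - k i else 0 := by
  have h1 : ∀ i j, 0 ≤ (if i < j then k j - k i else 0) + (g : ℝ) := by
    intro i j
    split_ifs with h
    · linarith [hk i j h.le]
    · positivity
  have h2 := Finset.single_le_sum
    (f := fun i => ∑ j, ((if i < j then k j - k i else 0) + (g : ℝ)))
    (fun i _ => Finset.sum_nonneg fun j _ => h1 i j) (Finset.mem_univ i₀)
  have h3 : ∑ j, (if i₀ < j then k j - k i₀ else 0) = ∑ j, (k j - k i₀) := by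
    refine Finset.sum_congr rfl fun j _ => ?_
    rcases (h₀ j).eq_or_lt with h | h
    · simp [h]
    · simp [h]
  simp only [Finset.sum_add_distrib, h3, Finset.sum_const, Finset.card_univ, Fintype.card_fin,
    nsmul_eq_mul] at h2
  nlinarith [sq_nonneg (g : ℝ)]

lemma cell_weight_le {g : ℕ} (i₀ : Fin g) (h₀ : ∀ j, i₀ ≤ j) (k : Fin g → ℝ)
    (hk : ∀ i j, i ≤ j → k i ≤ k j + g) :
    (∏ p : SymIdx g, (Real.exp (k p.1.1 / 2) * Real.exp (k p.1.2 / 2))) /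
      (∏ i, ∏ j, if i < j then Real.exp (k j / 2) / Real.exp (k i / 2) else 1) ≤
    Real.exp ((((g : ℝ) + 1) * ∑ i, k i - ∑ j, (k j - k i₀) + (g : ℝ) ^ 3) / 2) := by
  have h1 : ∏ p : SymIdx g, (Real.exp (k p.1.1 / 2) * Real.exp (k p.1.2 / 2)) =
      Real.exp ((((g : ℝ) + 1) * ∑ i, k i) / 2) := by
    rw [← sum_symIdx, Finset.sum_div, Real.exp_sum]
    simp only [← Real.exp_add, add_div]
  have h2 : (∏ i, ∏ j, if i < j then Real.exp (k j / 2) / Real.exp (k i / 2) else 1) =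
      Real.exp ((∑ i, ∑ j, if i < j then k j - k i else 0) / 2) := by
    simp only [Finset.sum_div, Real.exp_sum]
    refine Finset.prod_congr rfl fun i _ => Finset.prod_congr rfl fun j _ => ?_
    split_ifs
    · rw [← Real.exp_sub]; ring_nf
    · simp
  rw [h1, h2, ← Real.exp_sub]
  have := le_sum_sub i₀ h₀ k hk
  apply Real.exp_le_exp.2
  linarith

lemma tsum_prod_pow (q : ENNReal) (n : ℕ) :
    ∑' a : Fin n → ℕ, ∏ i, q ^ a i = (∑' m : ℕ, q ^ m) ^ n := by
  induction n with
  | zero => simp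
  | succ n ih =>
    rw [← (Fin.consEquiv fun _ : Fin (n + 1) => ℕ).tsum_eq, ENNReal.tsum_prod', pow_succ', ← ih,
      ← ENNReal.tsum_mul_right]
    refine tsum_congr fun m => ?_
    rw [← ENNReal.tsum_mul_left]
    refine tsum_congr fun a => ?_
    simp [Fin.consEquiv, Fin.prod_univ_succ]

/-- Integral exponents of the cells that meet the region where the determinant is at most
`e ^ L`. -/
def cellIdx (g : ℕ) (L : ℤ) : Set (Fin g → ℤ) :=
  {k | (∀ i j, i ≤ j → k i ≤ k j + g) ∧ ∑ i, k i ≤ L}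

lemma tsum_cell_weight_le {g : ℕ} (i₀ : Fin g) (h₀ : ∀ j, i₀ ≤ j) :
    ∃ C : ℝ, 0 ≤ C ∧ ∀ L : ℤ, ∑' k : cellIdx g L, ENNReal.ofReal
      (Real.exp ((((g : ℝ) + 1) * ∑ i, (k.1 i : ℝ) - ∑ j, ((k.1 j : ℝ) - k.1 i₀) +
        (g : ℝ) ^ 3) / 2)) ≤ ENNReal.ofReal (C * Real.exp (((g : ℝ) + 1) * L / 2)) := by
  set q : ENNReal := ENNReal.ofReal (Real.exp (-1 / 2)) with hq
  have hq1 : q < 1 := by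
    rw [hq, ENNReal.ofReal_lt_one, Real.exp_lt_one_iff]; norm_num
  have hfin : (∑' m : ℕ, q ^ m) ^ (g + 1) ≠ ⊤ := by
    rw [ENNReal.tsum_geometric]
    exact ENNReal.pow_ne_top (ENNReal.inv_ne_top.2 (tsub_pos_of_lt hq1).ne')
  refine ⟨Real.exp (((g : ℝ) ^ 3 + (g : ℝ) ^ 2) / 2) * ((∑' m : ℕ, q ^ m) ^ (g + 1)).toReal,
    by positivity, fun L => ?_⟩
  let φ : cellIdx g L → (Fin (g + 1) → ℕ) := fun k =>
    Fin.cons (L - ∑ i, k.1 i).toNat fun j => (k.1 j - k.1 i₀ + g).toNat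
  have hp : ∀ k : cellIdx g L, (((L - ∑ i, k.1 i).toNat : ℕ) : ℤ) = L - ∑ i, k.1 i := fun k =>
    Int.toNat_of_nonneg (by have := k.2.2; omega)
  have ha : ∀ (k : cellIdx g L) j, (((k.1 j - k.1 i₀ + g).toNat : ℕ) : ℤ) = k.1 j - k.1 i₀ + g :=
    fun k j => Int.toNat_of_nonneg (by have := k.2.1 i₀ j (h₀ j); omega)
  have hφ : Function.Injective φ := by
    intro k k' hkk
    have e1 : ∑ i, k.1 i = ∑ i, k'.1 i := by
      have e0 := congrFun hkk 0
      simp only [φ, Fin.cons_zero] at e0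
      have := hp k
      rw [e0, hp k'] at this
      omega
    have e2 : ∀ j, k.1 j - k.1 i₀ = k'.1 j - k'.1 i₀ := by
      intro j
      have e0 := congrFun hkk j.succ
      simp only [φ, Fin.cons_succ] at e0
      have := ha k j
      rw [e0, ha k' j] at this
      omega
    have e3 : k.1 i₀ = k'.1 i₀ := by
      have e4 := Finset.sum_congr rfl fun j (_ : j ∈ Finset.univ) => e2 j
      simp only [Finset.sum_sub_distrib, e1, Finset.sum_const, Finset.card_univ, Fintype.card_fin,
        nsmul_eq_mul] at e4
      have hg : (g : ℤ) ≠ 0 := by have := i₀.2; omega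
      exact mul_left_cancel₀ hg (by linarith)
    refine Subtype.ext (funext fun j => ?_)
    have := e2 j
    omega
  have hterm : ∀ k : cellIdx g L, ENNReal.ofReal
      (Real.exp ((((g : ℝ) + 1) * ∑ i, (k.1 i : ℝ) - ∑ j, ((k.1 j : ℝ) - k.1 i₀) +
        (g : ℝ) ^ 3) / 2)) ≤ ENNReal.ofReal (Real.exp (((g : ℝ) ^ 3 + (g : ℝ) ^ 2) / 2) *
          Real.exp (((g : ℝ) + 1) * L / 2)) * ∏ i, q ^ φ k i := by
    intro k
    have hp' : (((L - ∑ i, k.1 i).toNat : ℕ) : ℝ) = L - ∑ i, (k.1 i : ℝ) := by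
      have := congrArg (Int.cast : ℤ → ℝ) (hp k)
      push_cast at this
      exact this
    have ha' : ∀ j, (((k.1 j - k.1 i₀ + g).toNat : ℕ) : ℝ) = (k.1 j : ℝ) - k.1 i₀ + g := by
      intro j
      have := congrArg (Int.cast : ℤ → ℝ) (ha k j)
      push_cast at this
      exact this
    have e1 : ∏ i, q ^ φ k i = ENNReal.ofReal (Real.exp (-(∑ i, (φ k i : ℝ)) / 2)) := by
      have : -(∑ i, (φ k i : ℝ)) / 2 = ∑ i, (φ k i : ℝ) * (-1 / 2) := by
        rw [← Finset.sum_mul]; ring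
      rw [this, Real.exp_sum, ENNReal.ofReal_prod_of_nonneg fun i _ => (Real.exp_pos _).le]
      refine Finset.prod_congr rfl fun i _ => ?_
      rw [Real.exp_nat_mul, ENNReal.ofReal_pow (Real.exp_pos _).le]
    have e2 : ∑ i, (φ k i : ℝ) = (L - ∑ i, (k.1 i : ℝ)) + ∑ j, ((k.1 j : ℝ) - k.1 i₀ + g) := by
      rw [Fin.sum_univ_succ]
      simp only [φ, Fin.cons_zero, Fin.cons_succ, ha', hp']
    rw [e1, ← ENNReal.ofReal_mul (by positivity), ← Real.exp_add, ← Real.exp_add, e2]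
    refine ENNReal.ofReal_le_ofReal (Real.exp_le_exp.2 ?_)
    rw [Finset.sum_add_distrib]
    simp only [Finset.sum_const, Finset.card_univ, Fintype.card_fin, nsmul_eq_mul]
    have hL : ∑ i, (k.1 i : ℝ) ≤ L := by exact_mod_cast k.2.2
    have hgg : 0 ≤ (g : ℝ) * (L - ∑ i, (k.1 i : ℝ)) :=
      mul_nonneg (Nat.cast_nonneg _) (by linarith)
    nlinarith
  refine (ENNReal.tsum_le_tsum hterm).trans ?_
  rw [ENNReal.tsum_mul_left]
  refine (mul_le_mul_right (ENNReal.tsum_comp_le_tsum_of_injective hφ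
    fun a : Fin (g + 1) → ℕ => ∏ i, q ^ a i) _).trans ?_
  rw [tsum_prod_pow, ← ENNReal.ofReal_toReal hfin, ← ENNReal.ofReal_mul (by positivity),
    ENNReal.toReal_ofReal ENNReal.toReal_nonneg]
  exact ENNReal.ofReal_le_ofReal (by linarith)

lemma le_two_pow_mul {n : ℕ} {d : Fin n → ℝ} (hd : ∀ i, 0 < d i)
    (h : ∀ i j : Fin n, (i : ℕ) + 1 = j → d i ≤ 2 * d j) {i j : Fin n} (hij : i ≤ j) :
    d i ≤ 2 ^ n * d j := by
  have key : ∀ m, ∀ j : Fin n, (j : ℕ) = i + m → d i ≤ 2 ^ m * d j := by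
    intro m
    induction m with
    | zero =>
      intro j hj
      rw [Fin.ext (a := j) (b := i) (by simpa using hj)]
      simp
    | succ m ih =>
      intro j hj
      have h1 := ih ⟨i + m, by omega⟩ rfl
      have h2 := h ⟨i + m, by omega⟩ j (by simp only; omega)
      calc d i ≤ 2 ^ m * d ⟨i + m, by omega⟩ := h1
        _ ≤ 2 ^ m * (2 * d j) := by gcongr
        _ = _ := by ring
  have h1 := key (j - i) j (by have : (i : ℕ) ≤ j := hij; omega)
  refine h1.trans (mul_le_mul_of_nonneg_right ?_ (hd j).le)
  exact pow_le_pow_right₀ one_le_two (by omega)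

/-- A point of large height along the flow has the shape of one of the cells. -/
lemma exists_cell {g : ℕ} {δ : Fin g → ℝ} {h α : SpG g} {T t : ℝ} (hT : 0 < T)
    (ht : t ∈ Set.Icc (0 : ℝ) 1)
    (hH : T < Hgt ((flowElt δ t * (h * α) : SpG g) : BMat g)) {L : ℤ} (hL : -Real.log T ≤ L) :
    ∃ k ∈ cellIdx g L, HasShape δ h (Real.exp (g + 1)) (fun i => Real.exp ((k i : ℝ) / 2)) α := by
  have : Nonempty {γ : BMat g // IsSymp γ ∧ IsIntMat γ} :=
    ⟨⟨1, (isSymp_iff_mem _).2 (one_mem _), mem_intSp.1 (one_mem (intSp g))⟩⟩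
  obtain ⟨⟨γ₀, hγ₀, hγi⟩, hγ⟩ := exists_lt_of_lt_ciSup hH
  set γ : SpG g := ⟨γ₀, (isSymp_iff_mem _).1 hγ₀⟩ with hγdef
  have hγint : γ ∈ intSp g := mem_intSp.2 hγi
  set β : SpG g := flowElt δ t * (h * α) * γ with hβ
  have hdet : T < (gramP (β : BMat g)).det⁻¹ := by
    rw [← detImPoint_eq β.2]; exact hγ
  obtain ⟨V, U, d, hV, hU, hU1, hd, hgram, hd2⟩ := exists_hermite_reduction g _ (gramP_posDef β.2)
  have hprod : ∏ i, d i = (gramP (β : BMat g)).det := by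
    have e := congrArg Matrix.det hgram
    rw [Matrix.det_mul, Matrix.det_mul, Matrix.det_mul, Matrix.det_mul, Matrix.det_transpose,
      Matrix.det_transpose, hU.det, Matrix.det_diagonal, one_mul, mul_one] at e
    rw [← e]
    have hv : (V.map (Int.cast : ℤ → ℝ)).det = ((V.det : ℤ) : ℝ) :=
      ((Int.castRingHom ℝ).map_det V).symm
    rw [hv]
    rcases Int.isUnit_iff.1 hV with h1 | h1 <;> simp [h1]
  have hsum : ∑ i, Real.log (d i) < -Real.log T := by
    rw [← Real.log_prod fun i _ => (hd i).ne', hprod, ← Real.log_inv]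
    have hp := (gramP_posDef β.2).det_pos
    refine Real.log_lt_log hp ?_
    rwa [lt_inv_comm₀ hT hp] at hdet
  have hlow : ∀ i, Real.exp (⌊Real.log (d i)⌋ : ℝ) ≤ d i := fun i => by
    rw [← Real.le_log_iff_exp_le (hd i)]; exact Int.floor_le _
  have hup : ∀ i, d i < Real.exp ((⌊Real.log (d i)⌋ : ℝ) + 1) := fun i => by
    rw [← Real.log_lt_iff_lt_exp (hd i)]; exact Int.lt_floor_add_one _
  have h2e : (2 : ℝ) ^ g ≤ Real.exp g := by
    have : (2 : ℝ) ≤ Real.exp 1 := by have := Real.add_one_le_exp (1 : ℝ); linarith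
    calc (2 : ℝ) ^ g ≤ Real.exp 1 ^ g := by gcongr
      _ = _ := by rw [← Real.exp_nat_mul, mul_one]
  have hmono : ∀ i j, i ≤ j → d i ≤ Real.exp g * d j := fun i j hij =>
    (le_two_pow_mul hd hd2 hij).trans (mul_le_mul_of_nonneg_right h2e (hd j).le)
  have hsq : ∀ i, Real.exp ((⌊Real.log (d i)⌋ : ℝ) / 2) ^ 2 = Real.exp (⌊Real.log (d i)⌋ : ℝ) :=
    fun i => by rw [← Real.exp_nat_mul]; congr 1; push_cast; ring
  have hM : Real.exp g ≤ Real.exp ((g : ℝ) + 1) := Real.exp_le_exp.2 (by linarith)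
  refine ⟨fun i => ⌊Real.log (d i)⌋, ⟨fun i j hij => ?_, ?_⟩, γ * intLevi V hV,
    mul_mem hγint (intLevi_mem V hV), t, ht, U, d, hU, hU1, ?_, fun i => ?_, fun i => ?_,
    fun i j hij => (hmono i j hij).trans (mul_le_mul_of_nonneg_right hM (hd j).le)⟩
  · have h1 := (hlow i).trans (hmono i j hij)
    have h2 : Real.exp (⌊Real.log (d i)⌋ : ℝ) <
        Real.exp ((g : ℝ) + ((⌊Real.log (d j)⌋ : ℝ) + 1)) := by
      rw [Real.exp_add]
      exact h1.trans_lt (mul_lt_mul_of_pos_left (hup j) (Real.exp_pos _))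
    have h3 := Real.exp_lt_exp.1 h2
    have h4 : ⌊Real.log (d i)⌋ < (g : ℤ) + (⌊Real.log (d j)⌋ + 1) := by exact_mod_cast h3
    exact (by omega : ⌊Real.log (d i)⌋ ≤ ⌊Real.log (d j)⌋ + g)
  · have h1 : ∑ i, (⌊Real.log (d i)⌋ : ℝ) ≤ L :=
      (Finset.sum_le_sum fun i _ => Int.floor_le (Real.log (d i))).trans (hsum.le.trans hL)
    exact_mod_cast h1
  · rw [← hgram, intLevi, ← gramP_mul_levi _ _ _ (unitri_int_inverse hV), ← Submonoid.coe_mul]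
    simp only [hβ, mul_assoc]
  · rw [hsq]
    refine (hup i).le.trans ?_
    rw [← Real.exp_add]
    exact Real.exp_le_exp.2 (by have : (0 : ℝ) ≤ g := Nat.cast_nonneg _; linarith)
  · rw [hsq]
    refine (hlow i).trans (le_mul_of_one_le_left (hd i).le ?_)
    exact Real.one_le_exp (by positivity)

/-- The measure of the set of points of `K` reaching height `T` during a unit time interval. -/
lemma measure_height_le {g : ℕ} (hg : 1 ≤ g) (δ : Fin g → ℝ) (ρ : Measure (SpG g))
    [ρ.IsMulRightInvariant] [SFinite ρ] [IsFiniteMeasureOnCompacts ρ] {K : Set (SpG g)}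
    (hK : IsCompact K) :
    ∃ C : ℝ, 0 ≤ C ∧ ∀ h : SpG g, (∀ A, MeasurableSet A → ρ ((fun y => h * y) ⁻¹' A) = ρ A) →
      ∀ T : ℝ, 0 < T →
      ρ (K ∩ {α | ∃ t ∈ Set.Icc (0 : ℝ) 1,
        T < Hgt ((flowElt δ t * (h * α) : SpG g) : BMat g)}) ≤
      ENNReal.ofReal (C * T ^ (-(((g : ℝ) + 1) / 2))) := by
  have hM : (1 : ℝ) ≤ Real.exp (g + 1) := Real.one_le_exp (by positivity)
  obtain ⟨C₁, hC₁, h₁⟩ := measure_hasShape_le δ ρ hK hM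
  obtain ⟨C₂, hC₂, h₂⟩ := tsum_cell_weight_le (g := g) ⟨0, hg⟩ fun j => Nat.zero_le _
  refine ⟨C₁ * (C₂ * Real.exp (((g : ℝ) + 1) / 2)), by positivity, fun h hh T hT => ?_⟩
  set L : ℤ := ⌈-Real.log T⌉ with hLdef
  have hsub : K ∩ {α | ∃ t ∈ Set.Icc (0 : ℝ) 1,
        T < Hgt ((flowElt δ t * (h * α) : SpG g) : BMat g)} ⊆
      ⋃ k : cellIdx g L, K ∩ {α | HasShape δ h (Real.exp (g + 1))
        (fun i => Real.exp ((k.1 i : ℝ) / 2)) α} := by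
    rintro α ⟨hαK, t, ht, hH⟩
    obtain ⟨k, hk, hs⟩ := exists_cell hT ht hH (Int.le_ceil (-Real.log T))
    exact Set.mem_iUnion.2 ⟨⟨k, hk⟩, hαK, hs⟩
  refine (measure_mono hsub).trans ((measure_iUnion_le _).trans ?_)
  have hterm : ∀ k : cellIdx g L, ρ (K ∩ {α | HasShape δ h (Real.exp (g + 1))
        (fun i => Real.exp ((k.1 i : ℝ) / 2)) α}) ≤ ENNReal.ofReal C₁ * ENNReal.ofReal
      (Real.exp ((((g : ℝ) + 1) * ∑ i, (k.1 i : ℝ) - ∑ j, ((k.1 j : ℝ) - k.1 ⟨0, hg⟩) +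
        (g : ℝ) ^ 3) / 2)) := by
    intro k
    refine (h₁ h hh _ fun i => Real.exp_pos _).trans ?_
    rw [← ENNReal.ofReal_mul hC₁, mul_div_assoc]
    refine ENNReal.ofReal_le_ofReal (mul_le_mul_of_nonneg_left ?_ hC₁)
    refine cell_weight_le ⟨0, hg⟩ (fun j => Nat.zero_le _) (fun i => (k.1 i : ℝ)) fun i j hij => ?_
    exact_mod_cast k.2.1 i j hij
  refine (ENNReal.tsum_le_tsum hterm).trans ?_
  rw [ENNReal.tsum_mul_left]
  refine (mul_le_mul_right (h₂ L) _).trans ?_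
  rw [← ENNReal.ofReal_mul hC₁]
  refine ENNReal.ofReal_le_ofReal ?_
  rw [mul_assoc, mul_assoc]
  refine mul_le_mul_of_nonneg_left (mul_le_mul_of_nonneg_left ?_ hC₂) hC₁
  rw [Real.rpow_def_of_pos hT, ← Real.exp_add]
  refine Real.exp_le_exp.2 ?_
  have h3 : (L : ℝ) ≤ -Real.log T + 1 := (Int.ceil_lt_add_one _).le
  have h4 : (0 : ℝ) ≤ ((g : ℝ) + 1) / 2 := by positivity
  nlinarith [mul_le_mul_of_nonneg_left h3 h4]

open Filter in
/-- The real `limsup` is bounded by a nonnegative number that is a limit of eventual bounds. -/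
lemma limsup_le_of_forall_eventually {f : ℝ → ℝ} {a : ℝ} (ha : 0 ≤ a)
    (h : ∀ m : ℕ, ∀ᶠ t in atTop, f t ≤ a + 1 / ((m : ℝ) + 1)) : limsup f atTop ≤ a := by
  rw [limsup_eq]
  by_cases hb : BddBelow {b | ∀ᶠ t in atTop, f t ≤ b}
  · refine le_of_forall_pos_le_add fun ε hε => ?_
    obtain ⟨m, hm⟩ := exists_nat_one_div_lt hε
    exact (csInf_le hb (h m)).trans (by linarith)
  · rwa [Real.sInf_of_not_bddBelow hb]

open Filter in
/-- Deterministic consequences of polynomial growth along unit time intervals. -/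
lemma growth_of_intervals {H : ℝ → ℝ} (hH : ∀ t, 0 ≤ H t) {a κ : ℝ} (ha : 0 ≤ a) (hκ : 0 < κ)
    (h1 : ∀ m : ℕ, ∀ᶠ n : ℕ in atTop, ∀ t ∈ Set.Icc (0 : ℝ) 1,
      H (((n : ℝ) + 1) + t) ≤ ((n : ℝ) + 1) ^ (a + 1 / ((m : ℝ) + 1)))
    (h2 : ∀ n : ℕ, ∃ B : ℝ, ∀ t ∈ Set.Icc (0 : ℝ) 1, H (n + t) ≤ B) :
    limsup (fun t => Real.log (H t) / Real.log t) atTop ≤ a ∧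
      ∃ C : ℝ, 0 < C ∧ ∀ t : ℝ, 0 ≤ t → H t ≤ C * Real.exp (κ * t) := by
  have h3 : ∀ m : ℕ, ∀ᶠ t : ℝ in atTop, H t ≤ t ^ (a + 1 / ((m : ℝ) + 1)) := by
    intro m
    obtain ⟨N, hN⟩ := eventually_atTop.1 (h1 m)
    filter_upwards [eventually_ge_atTop ((N : ℝ) + 1)] with t ht
    have ht0 : 0 ≤ t := le_trans (by positivity) ht
    have hfl : N + 1 ≤ ⌊t⌋₊ := Nat.le_floor (by push_cast; exact ht)
    obtain ⟨n, hn⟩ : ∃ n, ⌊t⌋₊ = n + 1 := ⟨⌊t⌋₊ - 1, by omega⟩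
    have e1 : (n : ℝ) + 1 ≤ t := by
      have := Nat.floor_le ht0
      rw [hn] at this; exact_mod_cast this
    have e2 : t < (n : ℝ) + 1 + 1 := by
      have := Nat.lt_floor_add_one t
      rw [hn] at this; exact_mod_cast this
    have e3 := hN n (by omega) (t - ((n : ℝ) + 1)) ⟨by linarith, by linarith⟩
    rw [add_sub_cancel] at e3
    exact e3.trans (Real.rpow_le_rpow (by positivity) e1 (by positivity))
  constructor
  · refine limsup_le_of_forall_eventually ha fun m => ?_
    filter_upwards [h3 m, eventually_gt_atTop 1] with t ht ht1
    have hl : 0 < Real.log t := Real.log_pos ht1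
    rw [div_le_iff₀ hl, ← Real.log_rpow (by linarith)]
    rcases (hH t).eq_or_lt with h0 | h0
    · rw [← h0, Real.log_zero, Real.log_rpow (by linarith)]
      positivity
    · exact Real.log_le_log h0 ht
  · have h4 := (isLittleO_rpow_exp_pos_mul_atTop (a + 1 / (((0 : ℕ) : ℝ) + 1)) hκ).bound one_pos
    obtain ⟨T, hT⟩ := eventually_atTop.1 ((h3 0).and h4)
    choose B hB using h2
    refine ⟨1 + ∑ n ∈ Finset.range (⌊T⌋₊ + 1), |B n|, by positivity, fun t ht => ?_⟩
    have hS : 0 ≤ ∑ n ∈ Finset.range (⌊T⌋₊ + 1), |B n| := by positivity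
    rcases le_or_gt T t with h | h
    · obtain ⟨e1, e2⟩ := hT t h
      rw [Real.norm_eq_abs, Real.norm_eq_abs, Real.abs_exp, one_mul] at e2
      calc H t ≤ Real.exp (κ * t) := e1.trans ((le_abs_self _).trans e2)
        _ ≤ _ := le_mul_of_one_le_left (Real.exp_pos _).le (by linarith)
    · have e1 := Nat.floor_le ht
      have e2 := Nat.lt_floor_add_one t
      have e3 := hB ⌊t⌋₊ (t - ⌊t⌋₊) ⟨by linarith, by linarith⟩
      rw [add_sub_cancel] at e3
      have e4 : ⌊t⌋₊ ∈ Finset.range (⌊T⌋₊ + 1) := by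
        rw [Finset.mem_range, Nat.lt_succ_iff]
        exact Nat.floor_mono h.le
      have e5 := Finset.single_le_sum (f := fun n => |B n|) (fun n _ => abs_nonneg (B n)) e4
      calc H t ≤ 1 + ∑ n ∈ Finset.range (⌊T⌋₊ + 1), |B n| := by
            linarith [le_abs_self (B ⌊t⌋₊)]
        _ ≤ _ := le_mul_of_one_le_right (by linarith) (Real.one_le_exp (by positivity))

lemma symJ_mul_flowElt {g : ℕ} (δ : Fin g → ℝ) (t : ℝ) :
    SymplecticGroup.symJ (Fin g) ℝ * flowElt δ t =
      flowElt δ (-t) * SymplecticGroup.symJ (Fin g) ℝ := by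
  apply Subtype.ext
  rw [Submonoid.coe_mul, Submonoid.coe_mul, coe_flowElt, coe_flowElt, SymplecticGroup.coe_J, Rmat,
    Rmat, J, Matrix.fromBlocks_multiply, Matrix.fromBlocks_multiply]
  simp

/-- The inverse of a Haar measure is invariant under left translation by the flow. -/
lemma inv_measure_preimage_flow {g : ℕ} (δ : Fin g → ℝ) (μ : Measure (SpG g)) [μ.IsHaarMeasure]
    (t : ℝ) (A : Set (SpG g)) (hA : MeasurableSet A) :
    μ.inv ((fun y => flowElt δ t * y) ⁻¹' A) = μ.inv A := by
  have hinv : (flowElt δ t)⁻¹ = flowElt δ (-t) :=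
    inv_eq_of_mul_eq_one_left (flowElt_neg_mul δ t)
  have hmap : μ.map (· * (flowElt δ t)⁻¹) = μ := by
    refine map_mul_right_of_conj_inv μ _ (SymplecticGroup.symJ (Fin g) ℝ) ?_
    rw [hinv, symJ_mul_flowElt, mul_inv_cancel_right, neg_neg, ← hinv, inv_inv]
  rw [Measure.inv_apply, Measure.inv_apply]
  conv_rhs => rw [← hmap, Measure.map_apply (measurable_mul_const _) hA.inv]
  congr 1
  ext x
  simp [_root_.mul_inv_rev]

lemma detImPoint_nonneg {g : ℕ} {β : BMat g} (h : β ∈ symplecticGroup (Fin g) ℝ) :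
    0 ≤ detImPoint β := by
  rw [detImPoint_eq h]
  exact (inv_pos.2 (gramP_posDef h).det_pos).le

lemma Hgt_nonneg {g : ℕ} (β : SpG g) : 0 ≤ Hgt (β : BMat g) :=
  Real.iSup_nonneg fun γ => detImPoint_nonneg (mul_mem β.2 ((isSymp_iff_mem _).1 γ.2.1))

section AlmostEverywhere

variable {g : ℕ} {δ : Fin g → ℝ} {ρ : Measure (SpG g)} [ρ.IsMulRightInvariant] [SFinite ρ]
  [IsFiniteMeasureOnCompacts ρ]

lemma ae_height_bounded (hg : 1 ≤ g) {h : SpG g}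
    (hh : ∀ A, MeasurableSet A → ρ ((fun y => h * y) ⁻¹' A) = ρ A) :
    ∀ᵐ α ∂ρ, ∃ B : ℝ, ∀ t ∈ Set.Icc (0 : ℝ) 1,
      Hgt ((flowElt δ t * (h * α) : SpG g) : BMat g) ≤ B := by
  have key : ∀ m : ℕ, ∀ᵐ α ∂ρ, α ∉ compactCovering (SpG g) m ∩ {α | ¬ ∃ B : ℝ,
      ∀ t ∈ Set.Icc (0 : ℝ) 1, Hgt ((flowElt δ t * (h * α) : SpG g) : BMat g) ≤ B} := by
    intro m
    obtain ⟨C, hC, hb⟩ := measure_height_le hg δ ρ (isCompact_compactCovering (SpG g) m)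
    rw [← measure_eq_zero_iff_ae_notMem]
    refine le_antisymm ?_ zero_le
    have hlim : Filter.Tendsto (fun n : ℕ => ENNReal.ofReal
        (C * ((n : ℝ) + 1) ^ (-(((g : ℝ) + 1) / 2)))) Filter.atTop (nhds 0) := by
      rw [← ENNReal.ofReal_zero, ← mul_zero C]
      refine ENNReal.tendsto_ofReal (Filter.Tendsto.const_mul C ?_)
      exact (tendsto_rpow_neg_atTop (by positivity)).comp
        (Filter.tendsto_atTop_add_const_right _ _ tendsto_natCast_atTop_atTop)
    refine ge_of_tendsto' hlim fun n => ?_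
    refine (measure_mono ?_).trans (hb h hh ((n : ℝ) + 1) (by positivity))
    rintro α ⟨hα, hB⟩
    refine ⟨hα, ?_⟩
    by_contra hcon
    refine hB ⟨(n : ℝ) + 1, fun t ht => ?_⟩
    by_contra hlt
    exact hcon ⟨t, ht, not_le.1 hlt⟩
  filter_upwards [ae_all_iff.2 key] with α hα
  obtain ⟨m, hm⟩ := exists_mem_compactCovering α
  by_contra hcon
  exact hα m ⟨hm, hcon⟩

lemma ae_height_eventually_le (hg : 1 ≤ g)
    (hh : ∀ (t : ℝ) A, MeasurableSet A → ρ ((fun y => flowElt δ t * y) ⁻¹' A) = ρ A)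
    {c : ℝ} (hc : 2 / ((g : ℝ) + 1) < c) :
    ∀ᵐ α ∂ρ, ∀ᶠ n : ℕ in Filter.atTop, ∀ t ∈ Set.Icc (0 : ℝ) 1,
      Hgt ((flowElt δ t * (flowElt δ ((n : ℝ) + 1) * α) : SpG g) : BMat g) ≤
        ((n : ℝ) + 1) ^ c := by
  have hgc : 1 < c * (((g : ℝ) + 1) / 2) := by
    rw [div_lt_iff₀ (by positivity)] at hc
    linarith
  have key : ∀ m : ℕ, ∀ᵐ α ∂ρ, ∀ᶠ n : ℕ in Filter.atTop, α ∉ compactCovering (SpG g) m ∩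
      {α | ∃ t ∈ Set.Icc (0 : ℝ) 1, ((n : ℝ) + 1) ^ c <
        Hgt ((flowElt δ t * (flowElt δ ((n : ℝ) + 1) * α) : SpG g) : BMat g)} := by
    intro m
    obtain ⟨C, hC, hb⟩ := measure_height_le hg δ ρ (isCompact_compactCovering (SpG g) m)
    refine ae_eventually_notMem (ne_top_of_le_ne_top ?_ (ENNReal.tsum_le_tsum fun n : ℕ =>
      hb (flowElt δ ((n : ℝ) + 1)) (hh _) (((n : ℝ) + 1) ^ c) (by positivity)))
    refine Summable.tsum_ofReal_ne_top (Summable.mul_left C ?_)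
    have hs := (Real.summable_one_div_nat_add_rpow 1 (c * (((g : ℝ) + 1) / 2))).2 hgc
    refine hs.congr fun n => ?_
    have hn : (0 : ℝ) < (n : ℝ) + 1 := by positivity
    rw [abs_of_pos hn, ← Real.rpow_mul hn.le, mul_neg, Real.rpow_neg hn.le, one_div]
  filter_upwards [ae_all_iff.2 key] with α hα
  obtain ⟨m, hm⟩ := exists_mem_compactCovering α
  filter_upwards [hα m] with n hn t ht
  by_contra hlt
  exact hn ⟨hm, t, ht, not_le.1 hlt⟩

end AlmostEverywhere

end HeightCounting

open MeasureTheory in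
/-- Logarithm law for the height along diagonal Cartan flows on `Sp(2g,ℝ)`:
for Haar-almost every `α`, `limsup_{t→∞} log Hgt(R_t α)/log t ≤ 2/(g+1)`; in
particular almost every `α` satisfies the corresponding Roth condition. -/
theorem height_logarithm_law (g : ℕ) (hg : 1 ≤ g)
    (δ : Fin g → ℝ) (hδ : ∀ i, 0 ≤ δ i) (hδ0 : ∃ i, δ i ≠ 0)
    (μ : Measure (Matrix.symplecticGroup (Fin g) ℝ)) (hμ : μ.IsHaarMeasure) :
    ∀ᵐ (α : Matrix.symplecticGroup (Fin g) ℝ) ∂μ,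
      (Filter.limsup
          (fun t : ℝ =>
            Real.log (Hgt (Rmat g δ t * (α : Matrix (Fin g ⊕ Fin g) (Fin g ⊕ Fin g) ℝ))) /
              Real.log t)
          Filter.atTop ≤ 2 / ((g : ℝ) + 1)) ∧
      ∀ ε : ℝ, 0 < ε → ∃ C : ℝ, 0 < C ∧ ∀ t : ℝ, 0 ≤ t →
        Hgt (Rmat g δ t * (α : Matrix (Fin g ⊕ Fin g) (Fin g ⊕ Fin g) ℝ)) ≤
          C * Real.exp (2 * (∑ i, δ i) * ε * t) := by
  refine (absolutelyContinuous_inv μ).ae_le ?_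
  have hh := inv_measure_preimage_flow δ μ
  have h1 : ∀ᵐ α ∂μ.inv, ∀ m : ℕ, ∀ᶠ n : ℕ in Filter.atTop, ∀ t ∈ Set.Icc (0 : ℝ) 1,
      Hgt ((flowElt δ t * (flowElt δ ((n : ℝ) + 1) * α) : SpG g) : BMat g) ≤
        ((n : ℝ) + 1) ^ (2 / ((g : ℝ) + 1) + 1 / ((m : ℝ) + 1)) :=
    ae_all_iff.2 fun m => ae_height_eventually_le hg hh (lt_add_of_pos_right _ (by positivity))
  have h2 : ∀ᵐ α ∂μ.inv, ∀ n : ℕ, ∃ B : ℝ, ∀ t ∈ Set.Icc (0 : ℝ) 1,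
      Hgt ((flowElt δ t * (flowElt δ (n : ℝ) * α) : SpG g) : BMat g) ≤ B :=
    ae_all_iff.2 fun n => ae_height_bounded hg (hh n)
  have hδs : 0 < ∑ i, δ i := by
    obtain ⟨i, hi⟩ := hδ0
    exact Finset.sum_pos' (fun i _ => hδ i) ⟨i, Finset.mem_univ i, (hδ i).lt_of_ne' hi⟩
  have hflow : ∀ (α : SpG g) (s t : ℝ), ((flowElt δ t * (flowElt δ s * α) : SpG g) : BMat g) =
      Rmat g δ (s + t) * (α : BMat g) := fun α s t => by
    rw [← mul_assoc, ← flowElt_add, Submonoid.coe_mul, coe_flowElt, add_comm]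
  simp only [hflow] at h1 h2
  filter_upwards [h1, h2] with α hα1 hα2
  have hpos : ∀ t, 0 ≤ Hgt (Rmat g δ t * (α : BMat g)) := fun t => by
    rw [← coe_flowElt, ← Submonoid.coe_mul]
    exact Hgt_nonneg _
  exact ⟨(growth_of_intervals hpos (by positivity) one_pos hα1 hα2).1, fun ε hε =>
    (growth_of_intervals hpos (by positivity) (by positivity) hα1 hα2).2⟩
end
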